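/- arXiv:1808.03172 — 3 statements merged into one kernel-verified Lean document; each statement's English description precedes it below -/
import Mathlib

section
/- Let D be an associative division ring that is an algebra over the real numbers ℝ and is finite-dimensional as a real vector space. Then the dimension of D over ℝ is 1, 2, or 4. -/
namespace RealDivisionAlgebra

variable {D : Type*} [DivisionRing D] [Algebra ℝ D]

/-- An element algebraic over `ℝ` is real or a real affine image of a square root of `-1`. -/
theorem exists_eq_algebraMap_or_exists_sq_eq_neg_one [FiniteDimensional ℝ D] (x : D) :
    (∃ a : ℝ, x = algebraMap ℝ D a) ∨
      ∃ (a b : ℝ) (i : D), i * i = -1 ∧ x = algebraMap ℝ D a + b • i := by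
  have hx : IsIntegral ℝ x := Algebra.IsIntegral.isIntegral x
  have hdeg := (minpoly.irreducible hx).natDegree_le_two
  have hpos := minpoly.natDegree_pos hx
  have hmon := minpoly.monic hx
  have hzero := minpoly.aeval ℝ x
  set p := minpoly ℝ x
  have hsum := Polynomial.aeval_eq_sum_range (p := p) x
  rw [hzero] at hsum
  obtain h | h : p.natDegree = 1 ∨ p.natDegree = 2 := by omega
  · have hlead : p.coeff 1 = 1 := h ▸ hmon.coeff_natDegree
    rw [h] at hsum
    simp only [Finset.sum_range_succ, Finset.sum_range_zero, hlead] at hsum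
    refine Or.inl ⟨-p.coeff 0, ?_⟩
    rw [Algebra.algebraMap_eq_smul_one]
    rw [pow_zero, pow_one, one_smul, zero_add] at hsum
    rw [neg_smul, eq_neg_iff_add_eq_zero, add_comm, hsum]
  · have hlead : p.coeff 2 = 1 := h ▸ hmon.coeff_natDegree
    rw [h] at hsum
    simp only [Finset.sum_range_succ, Finset.sum_range_zero, hlead] at hsum
    set c := p.coeff 0
    set d := p.coeff 1
    have hsq : (x + (d / 2) • (1 : D)) * (x + (d / 2) • (1 : D)) =
        (d ^ 2 / 4 - c) • (1 : D) := by
      have hxx : x * x = -(c • (1 : D)) - d • x := by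
        rw [pow_zero, pow_one, one_smul, zero_add, sq] at hsum
        rw [← sub_eq_zero, hsum]; abel
      simp only [mul_add, add_mul, hxx, smul_mul_assoc, mul_smul_comm, one_mul, mul_one]
      module
    by_cases hd : 0 ≤ d ^ 2 / 4 - c
    · left
      have hs := Real.mul_self_sqrt hd
      set s := √(d ^ 2 / 4 - c)
      have hy : (x + (d / 2) • (1 : D)) * (x + (d / 2) • (1 : D)) =
          (s • (1 : D)) * (s • (1 : D)) := by
        rw [hsq, smul_mul_smul_comm, mul_one, hs]
      have hcomm : Commute (x + (d / 2) • (1 : D)) (s • (1 : D)) := by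
        simp [Commute, SemiconjBy]
      rcases hcomm.mul_self_eq_mul_self_iff.mp hy with h | h
      · exact ⟨s - d / 2, by
          rw [Algebra.algebraMap_eq_smul_one, eq_sub_of_add_eq h, sub_smul]⟩
      · exact ⟨-s - d / 2, by
          rw [Algebra.algebraMap_eq_smul_one, eq_sub_of_add_eq h, sub_smul, neg_smul]⟩
    · right
      have hd' : 0 < c - d ^ 2 / 4 := by linarith
      have hs := Real.mul_self_sqrt hd'.le
      have hs0 := (Real.sqrt_pos.mpr hd').ne'
      set s := √(c - d ^ 2 / 4)
      refine ⟨-(d / 2), s, s⁻¹ • (x + (d / 2) • (1 : D)), ?_, ?_⟩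
      · rw [smul_mul_smul_comm, hsq, smul_smul,
          show s⁻¹ * s⁻¹ * (d ^ 2 / 4 - c) = -1 by field_simp; linarith, neg_one_smul]
      · rw [smul_inv_smul₀ hs0, Algebra.algebraMap_eq_smul_one]
        module

/-- The elements `x` with `i * x = x * i`. -/
def commuting (i : D) : Submodule ℝ D :=
  LinearMap.ker (LinearMap.mulLeft ℝ i - LinearMap.mulRight ℝ i)

/-- The elements `x` with `i * x = -(x * i)`. -/
def anticommuting (i : D) : Submodule ℝ D :=
  LinearMap.ker (LinearMap.mulLeft ℝ i + LinearMap.mulRight ℝ i)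

theorem mem_commuting {i x : D} : x ∈ commuting i ↔ i * x = x * i := by
  simp [commuting, sub_eq_zero]

theorem mem_anticommuting {i x : D} : x ∈ anticommuting i ↔ i * x = -(x * i) := by
  simp [anticommuting, add_eq_zero_iff_eq_neg]

theorem isCompl_commuting_anticommuting {i : D} (hi : i * i = -1) :
    IsCompl (commuting i) (anticommuting i) := by
  have hi0 : i ≠ 0 := by rintro rfl; simp at hi
  constructor
  · rw [Submodule.disjoint_def]
    intro x hc ha
    rw [mem_commuting] at hc
    rw [mem_anticommuting, ← hc] at ha
    have h2 : (2 : ℝ) • (i * x) = 0 := by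
      rw [two_smul]; nth_rewrite 1 [ha]; exact neg_add_cancel _
    simpa [hi0] using h2
  · rw [codisjoint_iff, eq_top_iff]
    intro x _
    have hl (y : D) : i * (i * y) = -y := by rw [← mul_assoc, hi, neg_one_mul]
    have hr (y : D) : y * i * i = -y := by rw [mul_assoc, hi, mul_neg_one]
    refine Submodule.mem_sup.mpr ⟨(1 / 2 : ℝ) • (x - i * x * i), ?_,
      (1 / 2 : ℝ) • (x + i * x * i), ?_, by module⟩
    · rw [mem_commuting, mul_smul_comm, smul_mul_assoc, mul_sub, sub_mul, hr,
        mul_assoc i x i, hl]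
      congr 1; abel
    · rw [mem_anticommuting, mul_smul_comm, smul_mul_assoc, mul_add, add_mul, hr,
        mul_assoc i x i, hl, ← smul_neg]
      congr 1; abel

theorem commuting_eq_span [FiniteDimensional ℝ D] {i : D} (hi : i * i = -1) :
    commuting i = Submodule.span ℝ {1, i} := by
  apply le_antisymm
  · intro x hx
    rw [mem_commuting] at hx
    rw [Submodule.mem_span_pair]
    rcases exists_eq_algebraMap_or_exists_sq_eq_neg_one x with ⟨a, rfl⟩ | ⟨a, b, j, hj, rfl⟩
    · exact ⟨a, 0, by simp [Algebra.algebraMap_eq_smul_one]⟩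
    · by_cases hb : b = 0
      · exact ⟨a, 0, by simp [hb, Algebra.algebraMap_eq_smul_one]⟩
      have hij : Commute j i := by
        rw [mul_add, add_mul, Algebra.commutes, add_right_inj, mul_smul_comm,
          smul_mul_assoc] at hx
        exact (smul_right_injective D hb hx).symm
      rcases hij.mul_self_eq_mul_self_iff.mp (hj.trans hi.symm) with rfl | rfl
      · exact ⟨a, b, by rw [Algebra.algebraMap_eq_smul_one]⟩
      · exact ⟨a, -b, by rw [Algebra.algebraMap_eq_smul_one, neg_smul, smul_neg]⟩
  · rw [Submodule.span_le]
    rintro x (rfl | rfl)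
    · simp [mem_commuting]
    · simp [mem_commuting]

theorem finrank_commuting [FiniteDimensional ℝ D] {i : D} (hi : i * i = -1) :
    Module.finrank ℝ (commuting i) = 2 := by
  have hli : LinearIndependent ℝ ![1, i] := by
    rw [LinearIndependent.pair_iff' one_ne_zero]
    rintro a rfl
    have h : (a * a + 1) • (1 : D) = 0 := by
      rw [add_smul, one_smul, ← eq_neg_iff_add_eq_zero, ← hi, smul_mul_smul_comm, mul_one]
    rcases smul_eq_zero.mp h with h | h
    · nlinarith [mul_self_nonneg a]
    · exact one_ne_zero h
  rw [commuting_eq_span hi, ← Matrix.range_cons_cons_empty, finrank_span_eq_card hli,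
    Fintype.card_fin]

theorem finrank_anticommuting_eq [FiniteDimensional ℝ D] {i j : D}
    (hj : j ∈ anticommuting i) (hj0 : j ≠ 0) :
    Module.finrank ℝ (anticommuting i) = Module.finrank ℝ (commuting i) := by
  have hinj : Function.Injective (LinearMap.mulLeft ℝ j) := fun x y h ↦
    mul_left_cancel₀ hj0 h
  rw [mem_anticommuting] at hj
  apply le_antisymm
  · rw [(Submodule.equivMapOfInjective _ hinj _).finrank_eq]
    refine Submodule.finrank_mono ?_
    rintro _ ⟨x, hx, rfl⟩
    have hx' := mem_anticommuting.mp hx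
    rw [mem_commuting, LinearMap.mulLeft_apply, ← mul_assoc, hj, neg_mul, mul_assoc, hx',
      mul_neg, neg_neg, mul_assoc]
  · rw [(Submodule.equivMapOfInjective _ hinj _).finrank_eq]
    refine Submodule.finrank_mono ?_
    rintro _ ⟨x, hx, rfl⟩
    have hx' := mem_commuting.mp hx
    rw [mem_anticommuting, LinearMap.mulLeft_apply, ← mul_assoc, hj, neg_mul, mul_assoc, hx',
      mul_assoc]

end RealDivisionAlgebra

open RealDivisionAlgebra in
/-- Frobenius' theorem: an associative finite-dimensional real division algebra has
dimension 1, 2, or 4 over `ℝ`. -/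
theorem stmt_3 (D : Type*) [DivisionRing D] [Algebra ℝ D] [FiniteDimensional ℝ D] :
    Module.finrank ℝ D = 1 ∨ Module.finrank ℝ D = 2 ∨ Module.finrank ℝ D = 4 := by
  by_cases h : ∃ i : D, i * i = -1
  · obtain ⟨i, hi⟩ := h
    have hsum := Submodule.finrank_add_eq_of_isCompl (isCompl_commuting_anticommuting hi)
    have hC := finrank_commuting hi
    right
    by_cases hA : anticommuting i = ⊥
    · left
      rw [← hsum, hC, hA, finrank_bot]
    · right
      obtain ⟨j, hj, hj0⟩ := Submodule.exists_mem_ne_zero_of_ne_bot hA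
      rw [← hsum, finrank_anticommuting_eq hj hj0, hC]
  · left
    refine finrank_eq_one (1 : D) one_ne_zero fun x ↦ ?_
    rcases exists_eq_algebraMap_or_exists_sq_eq_neg_one x with ⟨a, rfl⟩ | ⟨_, _, i, hi, _⟩
    · exact ⟨a, (Algebra.algebraMap_eq_smul_one a).symm⟩
    · exact absurd ⟨i, hi⟩ h
end

section
/- Let D be an associative division ring that is an algebra over ℝ with dim_ℝ D = 2. Then D is isomorphic to ℂ as an ℝ-algebra. -/
/-- A unital algebra of dimension two over a field is commutative. -/
theorem mul_comm_of_finrank_eq_two {K A : Type*} [Field K] [Ring A] [Nontrivial A] [Algebra K A]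
    (h : Module.finrank K A = 2) (a b : A) : a * b = b * a := by
  by_cases ha : ∃ r : K, r • (1 : A) = a
  · obtain ⟨r, rfl⟩ := ha
    simp
  · push Not at ha
    have hli : LinearIndependent K ![(1 : A), a] :=
      (LinearIndependent.pair_iff' one_ne_zero).2 ha
    have hspan : Submodule.span K (Set.range ![(1 : A), a]) = ⊤ :=
      hli.span_eq_top_of_card_eq_finrank (by simp [h])
    have hb : b ∈ Submodule.span K {1, a} := by
      rw [Matrix.range_cons_cons_empty] at hspan
      simp [hspan]
    obtain ⟨r, s, rfl⟩ := Submodule.mem_span_pair.1 hb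
    simp [mul_add, add_mul]

/-- A 2-dimensional associative real division algebra is isomorphic to `ℂ` as an `ℝ`-algebra. -/
theorem stmt_4 (D : Type*) [DivisionRing D] [Algebra ℝ D] [FiniteDimensional ℝ D]
    (h : Module.finrank ℝ D = 2) :
    Nonempty (D ≃ₐ[ℝ] ℂ) := by
  let _ : Field D := { ‹DivisionRing D› with mul_comm := mul_comm_of_finrank_eq_two h }
  rcases Real.nonempty_algEquiv_or D with ⟨⟨e⟩⟩ | e
  · have := e.toLinearEquiv.finrank_eq
    simp [h] at this
  · exact e
end

section
/- Let V be a nonzero finite-dimensional real vector space equipped with an ℝ-bilinear multiplication m : V × V → V having no zero divisors (i.e., m(v,w) = 0 implies v = 0 or w = 0). Then dim_ℝ V ∈ {1, 2, 4, 8}. -/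
set_option linter.unusedSectionVars false

namespace Fock

open Finset

variable {k : ℕ} {E : Type*} [NormedAddCommGroup E] [InnerProductSpace ℂ E]

/-- Total degree of a multi-index. -/
def deg (α : Fin k → ℕ) : ℕ := ∑ j, α j

/-- The shift `α ↦ α + δ_j`. -/
def up (j : Fin k) (α : Fin k → ℕ) : Fin k → ℕ := α + Pi.single j 1

/-- The truncated shift `α ↦ α - δ_j`. -/
def down (j : Fin k) (α : Fin k → ℕ) : Fin k → ℕ := α - Pi.single j 1

@[simp] lemma down_up (j : Fin k) (α : Fin k → ℕ) : down j (up j α) = α := by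
  simp [down, up]

lemma up_down {j : Fin k} {α : Fin k → ℕ} (h : α j ≠ 0) : up j (down j α) = α := by
  funext i
  rcases eq_or_ne i j with rfl | hi
  · simp [down, up]; omega
  · simp [down, up, hi]

@[simp] lemma up_same (j : Fin k) (α : Fin k → ℕ) : up j α j = α j + 1 := by simp [up]

lemma up_ne {i j : Fin k} (h : i ≠ j) (α : Fin k → ℕ) : up j α i = α i := by simp [up, h]

@[simp] lemma down_same (j : Fin k) (α : Fin k → ℕ) : down j α j = α j - 1 := by simp [down]

lemma down_ne {i j : Fin k} (h : i ≠ j) (α : Fin k → ℕ) : down j α i = α i := by simp [down, h]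

lemma up_injective (j : Fin k) : Function.Injective (up j) :=
  Function.LeftInverse.injective (g := down j) (down_up j)

lemma up_comm (i j : Fin k) (α : Fin k → ℕ) : up i (up j α) = up j (up i α) := by
  simp only [up]; abel

lemma down_comm (i j : Fin k) (α : Fin k → ℕ) : down i (down j α) = down j (down i α) := by
  funext l; simp only [down, Pi.sub_apply]; omega

lemma up_down_comm {i j : Fin k} (h : i ≠ j) (α : Fin k → ℕ) :
    up i (down j α) = down j (up i α) := by
  funext l
  rcases eq_or_ne l i with rfl | hi
  · simp [up, down, h]
  · simp [up, down, hi]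

@[simp] lemma deg_up (j : Fin k) (α : Fin k → ℕ) : deg (up j α) = deg α + 1 := by
  simp [deg, up, Finset.sum_add_distrib]

lemma le_deg (j : Fin k) (α : Fin k → ℕ) : α j ≤ deg α :=
  Finset.single_le_sum (f := α) (fun _ _ => Nat.zero_le _) (Finset.mem_univ j)

lemma deg_down {j : Fin k} {α : Fin k → ℕ} (h : α j ≠ 0) : deg (down j α) + 1 = deg α := by
  rw [← deg_up j, up_down h]

lemma mem_range_up {j : Fin k} {α : Fin k → ℕ} : α ∈ Set.range (up j) ↔ α j ≠ 0 :=
  ⟨by rintro ⟨β, rfl⟩; simp, fun h => ⟨_, up_down h⟩⟩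

/-- Annihilation operator on sequences. -/
noncomputable def an (j : Fin k) : ((Fin k → ℕ) → E) →ₗ[ℂ] ((Fin k → ℕ) → E) where
  toFun u := fun α => ((Real.sqrt (α j + 1) : ℝ) : ℂ) • u (up j α)
  map_add' u v := by funext α; simp
  map_smul' c u := by funext α; simp [smul_comm c]

/-- Creation operator on sequences. -/
noncomputable def cr (j : Fin k) : ((Fin k → ℕ) → E) →ₗ[ℂ] ((Fin k → ℕ) → E) where
  toFun u := fun α => ((Real.sqrt (α j) : ℝ) : ℂ) • u (down j α)
  map_add' u v := by funext α; simp
  map_smul' c u := by funext α; simp [smul_comm c]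

/-- A linear map acting on each coefficient. -/
def coeffMap (M : E →L[ℂ] E) : ((Fin k → ℕ) → E) →ₗ[ℂ] ((Fin k → ℕ) → E) where
  toFun u := fun α => M (u α)
  map_add' u v := by funext α; simp
  map_smul' c u := by funext α; simp

lemma an_apply (j : Fin k) (u : (Fin k → ℕ) → E) (α : Fin k → ℕ) :
    an j u α = ((Real.sqrt (α j + 1) : ℝ) : ℂ) • u (up j α) := rfl

lemma cr_apply (j : Fin k) (u : (Fin k → ℕ) → E) (α : Fin k → ℕ) :
    cr j u α = ((Real.sqrt (α j) : ℝ) : ℂ) • u (down j α) := rfl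

lemma coeffMap_apply (M : E →L[ℂ] E) (u : (Fin k → ℕ) → E) (α : Fin k → ℕ) :
    coeffMap M u α = M (u α) := rfl

lemma cr_apply_up (j : Fin k) (u : (Fin k → ℕ) → E) (α : Fin k → ℕ) :
    cr j u (up j α) = ((Real.sqrt (α j + 1) : ℝ) : ℂ) • u α := by
  simp [cr_apply]

lemma cr_apply_of_eq_zero {j : Fin k} {α : Fin k → ℕ} (h : α j = 0) (u : (Fin k → ℕ) → E) :
    cr j u α = 0 := by
  simp [cr_apply, h]

lemma an_coeffMap (j : Fin k) (M : E →L[ℂ] E) (u : (Fin k → ℕ) → E) :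
    an j (coeffMap M u) = coeffMap M (an j u) := by
  funext α; simp [an_apply, coeffMap_apply]

lemma cr_coeffMap (j : Fin k) (M : E →L[ℂ] E) (u : (Fin k → ℕ) → E) :
    cr j (coeffMap M u) = coeffMap M (cr j u) := by
  funext α; simp [cr_apply, coeffMap_apply]

lemma an_an (i j : Fin k) (u : (Fin k → ℕ) → E) : an i (an j u) = an j (an i u) := by
  funext α
  rcases eq_or_ne i j with rfl | h
  · rfl
  · simp only [an_apply, up_ne h, up_ne h.symm, up_comm i j]
    rw [smul_comm]

lemma cr_cr (i j : Fin k) (u : (Fin k → ℕ) → E) : cr i (cr j u) = cr j (cr i u) := by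
  funext α
  rcases eq_or_ne i j with rfl | h
  · rfl
  · simp only [cr_apply, down_ne h, down_ne h.symm, down_comm i j]
    rw [smul_comm]

lemma sqrt_smul_sqrt {x : ℝ} (hx : 0 ≤ x) (v : E) :
    ((Real.sqrt x : ℝ) : ℂ) • ((Real.sqrt x : ℝ) : ℂ) • v = (x : ℂ) • v := by
  rw [smul_smul, ← Complex.ofReal_mul, Real.mul_self_sqrt hx]

lemma an_cr_same_apply (j : Fin k) (u : (Fin k → ℕ) → E) (α : Fin k → ℕ) :
    an j (cr j u) α = ((α j + 1 : ℝ) : ℂ) • u α := by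
  rw [an_apply, cr_apply_up, sqrt_smul_sqrt (by positivity)]

lemma cr_an_same_apply (j : Fin k) (u : (Fin k → ℕ) → E) (α : Fin k → ℕ) :
    cr j (an j u) α = ((α j : ℝ) : ℂ) • u α := by
  by_cases h : α j = 0
  · rw [cr_apply_of_eq_zero h, h]; simp
  · obtain ⟨β, rfl⟩ := mem_range_up.2 h
    rw [cr_apply_up, an_apply, sqrt_smul_sqrt (by positivity)]
    simp

lemma an_cr_same (j : Fin k) (u : (Fin k → ℕ) → E) : an j (cr j u) = cr j (an j u) + u := by
  funext α
  rw [Pi.add_apply, an_cr_same_apply, cr_an_same_apply]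
  push_cast
  rw [add_smul, one_smul]

lemma an_cr_ne {i j : Fin k} (h : i ≠ j) (u : (Fin k → ℕ) → E) :
    an i (cr j u) = cr j (an i u) := by
  funext α
  simp only [an_apply, cr_apply, up_ne h.symm, down_ne h, up_down_comm h]
  rw [smul_comm]

/-- The weight `1 + |α|`. -/
def wt (α : Fin k → ℕ) : ℝ := 1 + deg α

lemma one_le_wt (α : Fin k → ℕ) : 1 ≤ wt α := by simp [wt]

lemma wt_pos (α : Fin k → ℕ) : 0 < wt α := lt_of_lt_of_le one_pos (one_le_wt α)

@[simp] lemma wt_up (j : Fin k) (α : Fin k → ℕ) : wt (up j α) = wt α + 1 := by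
  simp [wt]; ring

/-- Terms of the weighted square norm. -/
noncomputable def term (s : ℤ) (u : (Fin k → ℕ) → E) (α : Fin k → ℕ) : ℝ := wt α ^ s * ‖u α‖ ^ 2

/-- Membership in the weighted space of order `s`. -/
def Mem (s : ℤ) (u : (Fin k → ℕ) → E) : Prop := Summable (term s u)

/-- The weighted square norm of order `s`. -/
noncomputable def nsq (s : ℤ) (u : (Fin k → ℕ) → E) : ℝ := ∑' α, term s u α

lemma term_nonneg (s : ℤ) (u : (Fin k → ℕ) → E) (α : Fin k → ℕ) : 0 ≤ term s u α := by
  have := wt_pos α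
  unfold term; positivity

lemma nsq_nonneg (s : ℤ) (u : (Fin k → ℕ) → E) : 0 ≤ nsq s u :=
  tsum_nonneg (term_nonneg s u)

lemma term_le_nsq {s : ℤ} {u : (Fin k → ℕ) → E} (h : Mem s u) (α : Fin k → ℕ) :
    term s u α ≤ nsq s u := h.le_tsum α (fun _ _ => term_nonneg _ _ _)

/-- Comparison principle for weighted norms. -/
lemma Mem.of_le {s r : ℤ} {u v : (Fin k → ℕ) → E} {C : ℝ}
    (h : ∀ α, term s v α ≤ C * term r u α) (hu : Mem r u) :
    Mem s v ∧ nsq s v ≤ C * nsq r u := by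
  have hs : Summable (fun α => C * term r u α) := hu.mul_left C
  have hm : Mem s v := Summable.of_nonneg_of_le (term_nonneg _ _) h hs
  refine ⟨hm, ?_⟩
  unfold nsq
  rw [← tsum_mul_left]
  exact hm.tsum_le_tsum h hs

lemma Mem.mono {s r : ℤ} (hsr : s ≤ r) {u : (Fin k → ℕ) → E} (hu : Mem r u) :
    Mem s u ∧ nsq s u ≤ nsq r u := by
  have := Mem.of_le (s := s) (v := u) (C := 1) (fun α => ?_) hu
  · simpa using this
  · rw [one_mul]
    exact mul_le_mul_of_nonneg_right (zpow_le_zpow_right₀ (one_le_wt α) hsr) (by positivity)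

lemma norm_add_sq_le (x y : E) : ‖x + y‖ ^ 2 ≤ 2 * (‖x‖ ^ 2 + ‖y‖ ^ 2) := by
  have h1 := norm_add_le x y
  have h2 : ‖x + y‖ ^ 2 ≤ (‖x‖ + ‖y‖) ^ 2 := by gcongr
  nlinarith [sq_nonneg (‖x‖ - ‖y‖)]

lemma Mem.add {s : ℤ} {u v : (Fin k → ℕ) → E} (hu : Mem s u) (hv : Mem s v) :
    Mem s (u + v) ∧ nsq s (u + v) ≤ 2 * (nsq s u + nsq s v) := by
  have hle : ∀ α, term s (u + v) α ≤ 2 * (term s u α + term s v α) := fun α => by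
    have := wt_pos α
    have h0 : (0 : ℝ) ≤ wt α ^ s := by positivity
    have := mul_le_mul_of_nonneg_left (norm_add_sq_le (u α) (v α)) h0
    unfold term; rw [Pi.add_apply]; linarith
  have hs : Summable (fun α => 2 * (term s u α + term s v α)) :=
    (Summable.add hu hv).mul_left 2
  have hm : Mem s (u + v) := Summable.of_nonneg_of_le (term_nonneg _ _) hle hs
  refine ⟨hm, ?_⟩
  unfold nsq
  rw [← Summable.tsum_add hu hv, ← tsum_mul_left]
  exact hm.tsum_le_tsum hle hs

lemma Mem.smul {s : ℤ} {u : (Fin k → ℕ) → E} (hu : Mem s u) (c : ℂ) :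
    Mem s (c • u) ∧ nsq s (c • u) ≤ ‖c‖ ^ 2 * nsq s u := by
  refine Mem.of_le (fun α => le_of_eq ?_) hu
  simp only [term, Pi.smul_apply, norm_smul]; ring

lemma Mem.zero (s : ℤ) : Mem s (0 : (Fin k → ℕ) → E) := by
  have : term s (0 : (Fin k → ℕ) → E) = 0 := by funext α; simp [term]
  unfold Mem; rw [this]; exact summable_zero

@[simp] lemma nsq_zero (s : ℤ) : nsq s (0 : (Fin k → ℕ) → E) = 0 := by
  simp [nsq, term]

lemma Mem.sum {s : ℤ} {ι : Type*} (t : Finset ι) {u : ι → (Fin k → ℕ) → E}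
    (hu : ∀ i ∈ t, Mem s (u i)) : Mem s (∑ i ∈ t, u i) := by
  classical
  induction t using Finset.induction_on with
  | empty => simpa using Mem.zero s
  | insert i t hi ih =>
    rw [Finset.sum_insert hi]
    exact ((hu i (by simp)).add (ih fun j hj => hu j (by simp [hj]))).1

/-- Sequence operators of order at most `r`. -/
def Order (r : ℤ) (T : ((Fin k → ℕ) → E) →ₗ[ℂ] ((Fin k → ℕ) → E)) : Prop :=
  ∀ s : ℤ, ∃ C : ℝ, 0 ≤ C ∧ ∀ u, Mem (s + r) u → Mem s (T u) ∧ nsq s (T u) ≤ C * nsq (s + r) u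

lemma Order.add {r : ℤ} {T T' : ((Fin k → ℕ) → E) →ₗ[ℂ] ((Fin k → ℕ) → E)}
    (h : Order r T) (h' : Order r T') : Order r (T + T') := fun s => by
  obtain ⟨C, hC, h⟩ := h s
  obtain ⟨C', hC', h'⟩ := h' s
  refine ⟨2 * (C + C'), by positivity, fun u hu => ?_⟩
  have h1 := h u hu
  have h2 := h' u hu
  refine ⟨(h1.1.add h2.1).1, (h1.1.add h2.1).2.trans ?_⟩
  linarith

lemma Order.zero (r : ℤ) : Order r (0 : ((Fin k → ℕ) → E) →ₗ[ℂ] ((Fin k → ℕ) → E)) :=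
  fun s => ⟨0, le_rfl, fun u _ => ⟨Mem.zero s, by simp⟩⟩

lemma Order.sum {r : ℤ} {ι : Type*} (t : Finset ι)
    {T : ι → ((Fin k → ℕ) → E) →ₗ[ℂ] ((Fin k → ℕ) → E)}
    (h : ∀ i ∈ t, Order r (T i)) : Order r (∑ i ∈ t, T i) := by
  classical
  induction t using Finset.induction_on with
  | empty => simpa using Order.zero r
  | insert i t hi ih =>
    rw [Finset.sum_insert hi]
    exact (h i (by simp)).add (ih fun j hj => h j (by simp [hj]))

lemma Order.comp {r r' : ℤ} {T T' : ((Fin k → ℕ) → E) →ₗ[ℂ] ((Fin k → ℕ) → E)}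
    (h : Order r T) (h' : Order r' T') : Order (r + r') (T ∘ₗ T') := fun s => by
  obtain ⟨C, hC, h⟩ := h s
  obtain ⟨C', hC', h'⟩ := h' (s + r)
  refine ⟨C * C', by positivity, fun u hu => ?_⟩
  rw [← add_assoc] at hu ⊢
  have h2 := h' u hu
  have h1 := h _ h2.1
  refine ⟨h1.1, h1.2.trans ?_⟩
  rw [mul_assoc]
  exact mul_le_mul_of_nonneg_left h2.2 hC

lemma order_coeffMap (M : E →L[ℂ] E) : Order (k := k) 0 (coeffMap M) := fun s => by
  refine ⟨‖M‖ ^ 2, by positivity, fun u hu => ?_⟩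
  rw [add_zero] at hu ⊢
  refine Mem.of_le (fun α => ?_) hu
  have h1 : ‖M (u α)‖ ^ 2 ≤ (‖M‖ * ‖u α‖) ^ 2 := by gcongr; exact M.le_opNorm _
  have h0 : (0 : ℝ) ≤ wt α ^ s := by have := wt_pos α; positivity
  calc term s (coeffMap M u) α ≤ wt α ^ s * (‖M‖ * ‖u α‖) ^ 2 := mul_le_mul_of_nonneg_left h1 h0
    _ = _ := by unfold term; ring

lemma zpow_le_of_comparable (s : ℤ) : ∃ C : ℝ, 0 ≤ C ∧ ∀ x y : ℝ, 0 < x → 0 < y → x ≤ 2 * y →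
    y ≤ 2 * x → x ^ s ≤ C * y ^ s := by
  obtain ⟨n, rfl | rfl⟩ := s.eq_nat_or_neg
  · refine ⟨2 ^ n, by positivity, fun x y hx hy h _ => ?_⟩
    rw [zpow_natCast, zpow_natCast, ← mul_pow]
    gcongr
  · refine ⟨2 ^ n, by positivity, fun x y hx hy _ h => ?_⟩
    rw [zpow_neg, zpow_neg, zpow_natCast, zpow_natCast]
    rw [← div_eq_mul_inv, le_div_iff₀ (by positivity), ← div_eq_inv_mul,
      div_le_iff₀ (by positivity), ← mul_pow]
    gcongr

lemma order_an (j : Fin k) : Order (E := E) 1 (an j) := fun s => by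
  obtain ⟨C, hC, hz⟩ := zpow_le_of_comparable s
  refine ⟨C, hC, fun u hu => ?_⟩
  have hle : ∀ α, term s (an j u) α ≤ C * term (s + 1) u (up j α) := fun α => by
    have hw := wt_pos α
    have h1 := hz (wt α) (wt α + 1) hw (by linarith) (by linarith) (by linarith [one_le_wt α])
    have h2 : ((α j : ℝ) + 1) ≤ wt α + 1 := by
      have : (α j : ℝ) ≤ deg α := by exact_mod_cast le_deg j α
      simp only [wt]; linarith
    simp only [term, an_apply, norm_smul, wt_up, Complex.norm_real, Real.norm_eq_abs,
      abs_of_nonneg (Real.sqrt_nonneg _), mul_pow]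
    rw [Real.sq_sqrt (by positivity), zpow_add_one₀ (by positivity)]
    calc wt α ^ s * ((α j + 1) * ‖u (up j α)‖ ^ 2)
        ≤ (C * (wt α + 1) ^ s) * ((wt α + 1) * ‖u (up j α)‖ ^ 2) := by gcongr
      _ = _ := by ring
  have hs : Summable (fun α => C * term (s + 1) u (up j α)) :=
    (hu.comp_injective (up_injective j)).mul_left C
  have hm : Mem s (an j u) := Summable.of_nonneg_of_le (term_nonneg _ _) hle hs
  refine ⟨hm, ?_⟩
  calc nsq s (an j u) ≤ ∑' α, C * term (s + 1) u (up j α) := hm.tsum_le_tsum hle hs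
    _ = C * ∑' α, term (s + 1) u (up j α) := tsum_mul_left
    _ ≤ _ := mul_le_mul_of_nonneg_left
      (tsum_comp_le_tsum_of_inj hu (term_nonneg _ _) (up_injective j)) hC

lemma support_term_cr (s : ℤ) (j : Fin k) (u : (Fin k → ℕ) → E) :
    Function.support (term s (cr j u)) ⊆ Set.range (up j) := by
  intro α hα
  rw [mem_range_up]
  intro h
  exact hα (by simp [term, cr_apply_of_eq_zero h])

lemma order_cr (j : Fin k) : Order (E := E) 1 (cr j) := fun s => by
  obtain ⟨C, hC, hz⟩ := zpow_le_of_comparable s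
  refine ⟨C, hC, fun u hu => ?_⟩
  have hle : ∀ α, term s (cr j u) (up j α) ≤ C * term (s + 1) u α := fun α => by
    have hw := wt_pos α
    have h1 := hz (wt α + 1) (wt α) (by linarith) hw (by linarith [one_le_wt α]) (by linarith)
    have h2 : ((α j : ℝ) + 1) ≤ wt α := by
      have : (α j : ℝ) ≤ deg α := by exact_mod_cast le_deg j α
      simp only [wt]; linarith
    simp only [term, cr_apply_up, norm_smul, wt_up, Complex.norm_real, Real.norm_eq_abs,
      abs_of_nonneg (Real.sqrt_nonneg _), mul_pow]
    rw [Real.sq_sqrt (by positivity), zpow_add_one₀ (by positivity)]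
    calc (wt α + 1) ^ s * ((α j + 1) * ‖u α‖ ^ 2)
        ≤ (C * wt α ^ s) * (wt α * ‖u α‖ ^ 2) := by gcongr
      _ = _ := by ring
  have hs : Summable (fun α => C * term (s + 1) u α) := hu.mul_left C
  have hs' : Summable (term s (cr j u) ∘ up j) :=
    Summable.of_nonneg_of_le (fun _ => term_nonneg _ _ _) hle hs
  have hsupp := support_term_cr s j u
  have hm : Mem s (cr j u) :=
    ((up_injective j).summable_iff (fun x hx => by
      by_contra h; exact hx (hsupp h))).1 hs'
  refine ⟨hm, ?_⟩
  calc nsq s (cr j u) = ∑' α, term s (cr j u) (up j α) :=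
        ((up_injective j).tsum_eq hsupp).symm
    _ ≤ ∑' α, C * term (s + 1) u α := hs'.tsum_le_tsum hle hs
    _ = _ := tsum_mul_left

/-- The pairing of sequences. -/
noncomputable def ip (u v : (Fin k → ℕ) → E) : ℂ := ∑' α, inner ℂ (u α) (v α)

lemma ip_an (j : Fin k) (u v : (Fin k → ℕ) → E) : ip (an j u) v = ip u (cr j v) := by
  unfold ip
  have hsupp : Function.support (fun α => inner ℂ (u α) (cr j v α)) ⊆ Set.range (up j) := by
    intro α hα
    rw [mem_range_up]
    intro h
    exact hα (by simp [cr_apply_of_eq_zero h])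
  rw [← (up_injective j).tsum_eq hsupp]
  refine tsum_congr fun α => ?_
  rw [an_apply, cr_apply_up, inner_smul_left, inner_smul_right, Complex.conj_ofReal]

lemma ip_conj (u v : (Fin k → ℕ) → E) : (starRingEnd ℂ) (ip u v) = ip v u := by
  unfold ip
  rw [Complex.conj_tsum]
  exact tsum_congr fun α => inner_conj_symm _ _

lemma ip_cr (j : Fin k) (u v : (Fin k → ℕ) → E) : ip (cr j u) v = ip u (an j v) := by
  rw [← ip_conj, ← ip_an, ip_conj]

lemma ip_coeffMap [CompleteSpace E] (M : E →L[ℂ] E) (u v : (Fin k → ℕ) → E) :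
    ip (coeffMap M u) v = ip u (coeffMap (ContinuousLinearMap.adjoint M) v) := by
  unfold ip
  refine tsum_congr fun α => ?_
  rw [coeffMap_apply, coeffMap_apply, ContinuousLinearMap.adjoint_inner_right]

lemma summable_inner {s : ℤ} {u v : (Fin k → ℕ) → E} (hu : Mem s u) (hv : Mem (-s) v) :
    Summable (fun α => inner ℂ (u α) (v α)) := by
  refine Summable.of_norm_bounded (g := fun α => term s u α + term (-s) v α)
    (Summable.add hu hv) fun α => ?_
  refine (norm_inner_le_norm _ _).trans ?_
  have hw : 0 < wt α ^ s := by have := wt_pos α; positivity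
  have h1 : ‖u α‖ * ‖v α‖ ≤ (wt α ^ s * ‖u α‖) * ‖u α‖ + ((wt α ^ s)⁻¹ * ‖v α‖) * ‖v α‖ := by
    have := sq_nonneg (wt α ^ s * ‖u α‖ - ‖v α‖)
    have h2 : ‖u α‖ * ‖v α‖ * wt α ^ s ≤ ((wt α ^ s * ‖u α‖) * ‖u α‖ +
        ((wt α ^ s)⁻¹ * ‖v α‖) * ‖v α‖) * wt α ^ s := by
      field_simp
      nlinarith [norm_nonneg (u α), norm_nonneg (v α), mul_nonneg
        (mul_nonneg hw.le (norm_nonneg (u α))) (norm_nonneg (v α))]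
    exact le_of_mul_le_mul_right h2 hw
  simp only [term, zpow_neg]
  nlinarith

lemma summable_inner_zero {u v : (Fin k → ℕ) → E} (hu : Mem 0 u) (hv : Mem 0 v) :
    Summable (fun α => inner ℂ (u α) (v α)) := summable_inner hu (by simpa using hv)

lemma ip_add_left {u u' v : (Fin k → ℕ) → E} (hu : Mem 0 u) (hu' : Mem 0 u') (hv : Mem 0 v) :
    ip (u + u') v = ip u v + ip u' v := by
  unfold ip
  rw [← (summable_inner_zero hu hv).tsum_add (summable_inner_zero hu' hv)]
  exact tsum_congr fun α => inner_add_left _ _ _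

lemma ip_add_right {u v v' : (Fin k → ℕ) → E} (hu : Mem 0 u) (hv : Mem 0 v) (hv' : Mem 0 v') :
    ip u (v + v') = ip u v + ip u v' := by
  rw [← ip_conj, ip_add_left hv hv' hu, map_add, ip_conj, ip_conj]

@[simp] lemma ip_zero_left (v : (Fin k → ℕ) → E) : ip 0 v = 0 := by simp [ip]

@[simp] lemma ip_zero_right (v : (Fin k → ℕ) → E) : ip v 0 = 0 := by simp [ip]

lemma ip_sum_left {ι : Type*} (t : Finset ι) {u : ι → (Fin k → ℕ) → E} {v : (Fin k → ℕ) → E}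
    (hu : ∀ i ∈ t, Mem 0 (u i)) (hv : Mem 0 v) :
    ip (∑ i ∈ t, u i) v = ∑ i ∈ t, ip (u i) v := by
  classical
  induction t using Finset.induction_on with
  | empty => simp
  | insert i t hi ih =>
    rw [Finset.sum_insert hi, Finset.sum_insert hi, ip_add_left (hu i (by simp))
      (Mem.sum t fun j hj => hu j (by simp [hj])) hv, ih fun j hj => hu j (by simp [hj])]

lemma ip_sum_right {ι : Type*} (t : Finset ι) {u : ι → (Fin k → ℕ) → E} {v : (Fin k → ℕ) → E}
    (hu : ∀ i ∈ t, Mem 0 (u i)) (hv : Mem 0 v) :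
    ip v (∑ i ∈ t, u i) = ∑ i ∈ t, ip v (u i) := by
  rw [← ip_conj, ip_sum_left t hu hv, map_sum]
  simp only [ip_conj]

lemma ip_self (u : (Fin k → ℕ) → E) : ip u u = (nsq 0 u : ℂ) := by
  unfold ip nsq
  rw [Complex.ofReal_tsum]
  refine tsum_congr fun α => ?_
  rw [inner_self_eq_norm_sq_to_K]
  simp [term]

end Fock

namespace Fock

open Finset MeasureTheory

section Moments

lemma integrable_gaussian_moment_self (m : ℕ) :
    Integrable (fun z : ℂ => ‖z‖ ^ (2 * m) * Real.exp (-‖z‖ ^ 2)) ∧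
      ∫ z : ℂ, ‖z‖ ^ (2 * m) * Real.exp (-‖z‖ ^ 2) = Real.pi * (m.factorial : ℝ) := by
  have h := Complex.integral_rpow_mul_exp_neg_rpow (p := 2) (q := ((2 * m : ℕ) : ℝ))
    (by norm_num) (by have : (0 : ℝ) ≤ ((2 * m : ℕ) : ℝ) := Nat.cast_nonneg _; linarith)
  have h2 : (((2 * m : ℕ) : ℝ) + 2) / 2 = (m : ℝ) + 1 := by push_cast; ring
  simp only [Real.rpow_natCast, Real.rpow_two] at h
  rw [h2, Real.Gamma_nat_eq_factorial] at h
  have h3 : ∫ z : ℂ, ‖z‖ ^ (2 * m) * Real.exp (-‖z‖ ^ 2) = Real.pi * (m.factorial : ℝ) := by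
    rw [h]; ring
  refine ⟨?_, h3⟩
  by_contra hn
  rw [integral_undef hn] at h3
  have : 0 < Real.pi * (m.factorial : ℝ) := by positivity
  linarith

/-- One-variable monomial times Gaussian density. -/
noncomputable def moment (m n : ℕ) (z : ℂ) : ℂ :=
  (starRingEnd ℂ) z ^ m * z ^ n * ((Real.exp (-‖z‖ ^ 2) / Real.pi : ℝ) : ℂ)

lemma continuous_moment (m n : ℕ) : Continuous (moment m n) := by
  unfold moment
  have : Continuous (starRingEnd ℂ) := Complex.continuous_conj
  fun_prop

lemma norm_moment (m n : ℕ) (z : ℂ) :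
    ‖moment m n z‖ = ‖z‖ ^ (m + n) * (Real.exp (-‖z‖ ^ 2) / Real.pi) := by
  have : 0 ≤ Real.exp (-‖z‖ ^ 2) / Real.pi := by positivity
  rw [moment, norm_mul, norm_mul, norm_pow, norm_pow, RCLike.norm_conj, Complex.norm_real,
    Real.norm_eq_abs, abs_of_nonneg this, pow_add]

lemma integrable_moment (m n : ℕ) : Integrable (moment m n) := by
  have h := (((integrable_gaussian_moment_self m).1.add
    (integrable_gaussian_moment_self n).1).div_const Real.pi)
  refine h.mono' (continuous_moment m n).aestronglyMeasurable (Filter.Eventually.of_forall ?_)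
  intro z
  rw [norm_moment]
  have h1 : ‖z‖ ^ (m + n) ≤ ‖z‖ ^ (2 * m) + ‖z‖ ^ (2 * n) := by
    have := sq_nonneg (‖z‖ ^ m - ‖z‖ ^ n)
    have h0 : 0 ≤ ‖z‖ ^ m * ‖z‖ ^ n := by positivity
    rw [pow_add, mul_comm 2 m, mul_comm 2 n, pow_mul, pow_mul]
    nlinarith
  have h2 : 0 ≤ Real.exp (-‖z‖ ^ 2) / Real.pi := by positivity
  calc ‖z‖ ^ (m + n) * (Real.exp (-‖z‖ ^ 2) / Real.pi)
      ≤ (‖z‖ ^ (2 * m) + ‖z‖ ^ (2 * n)) * (Real.exp (-‖z‖ ^ 2) / Real.pi) := by gcongr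
    _ = _ := by simp only [Pi.add_apply]; ring

lemma integral_moment (m n : ℕ) :
    ∫ z, moment m n z = if m = n then (m.factorial : ℂ) else 0 := by
  split_ifs with h
  · subst h
    have h1 : ∀ z, moment m m z =
        ((‖z‖ ^ (2 * m) * Real.exp (-‖z‖ ^ 2) : ℝ) : ℂ) / (Real.pi : ℂ) := fun z => by
      have : (starRingEnd ℂ) z ^ m * z ^ m = ((‖z‖ ^ (2 * m) : ℝ) : ℂ) := by
        rw [← mul_pow, mul_comm, Complex.mul_conj, Complex.normSq_eq_norm_sq, pow_mul]
        push_cast; ring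
      rw [moment, this]; push_cast; ring
    simp_rw [h1]
    rw [integral_div, integral_complex_ofReal, (integrable_gaussian_moment_self m).2]
    have : (Real.pi : ℂ) ≠ 0 := by exact_mod_cast Real.pi_ne_zero
    push_cast
    field_simp
  · let ω : Circle := Circle.exp 1
    have hω : (ω : ℂ) ^ n * (starRingEnd ℂ) (ω : ℂ) ^ m ≠ 1 := by
      intro hc
      have h1 : (ω : ℂ) ^ n = (ω : ℂ) ^ m := by
        have h2 : (ω : ℂ) * (starRingEnd ℂ) (ω : ℂ) = 1 := by
          rw [Complex.mul_conj]; simp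
        calc (ω : ℂ) ^ n = ((ω : ℂ) ^ n * (starRingEnd ℂ) (ω : ℂ) ^ m) * (ω : ℂ) ^ m := by
              rw [mul_assoc, ← mul_pow, mul_comm _ (ω : ℂ), h2]; simp
          _ = (ω : ℂ) ^ m := by rw [hc, one_mul]
      have h3 : Complex.exp (n * Complex.I) = Complex.exp (m * Complex.I) := by
        simpa [ω, Circle.coe_exp, ← Complex.exp_nat_mul] using h1
      rw [Complex.exp_eq_exp_iff_exists_int] at h3
      obtain ⟨l, hl⟩ := h3
      have h4 := congrArg Complex.im hl
      simp at h4
      have hl0 : l ≠ 0 := by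
        rintro rfl
        simp at h4
        exact h h4.symm
      refine irrational_pi ⟨((n : ℚ) - m) / (2 * l), ?_⟩
      have : (l : ℝ) ≠ 0 := by exact_mod_cast hl0
      push_cast
      field_simp
      linarith
    have h5 := (rotation ω).measurePreserving.integral_comp
      (rotation ω).toHomeomorph.measurableEmbedding (moment m n)
    have h6 : ∀ z, moment m n (rotation ω z) =
        ((ω : ℂ) ^ n * (starRingEnd ℂ) (ω : ℂ) ^ m) * moment m n z := fun z => by
      simp only [moment, rotation_apply, map_mul, mul_pow, norm_mul, Circle.norm_coe,
        one_mul]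
      ring
    simp_rw [h6] at h5
    rw [integral_const_mul] at h5
    by_contra hI
    exact hω (mul_right_cancel₀ hI (by rw [h5, one_mul]))

end Moments

section Bargmann

variable {k : ℕ} {E : Type*} [NormedAddCommGroup E] [InnerProductSpace ℂ E]

/-- Normalised monomials. -/
noncomputable def mono (α : Fin k → ℕ) (z : Fin k → ℂ) : ℂ :=
  ∏ j, z j ^ α j / ((Real.sqrt (α j).factorial : ℝ) : ℂ)

/-- Gaussian density on `ℂ^k`. -/
noncomputable def gauss (z : Fin k → ℂ) : ℝ := ∏ j, Real.exp (-‖z j‖ ^ 2) / Real.pi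

lemma gauss_nonneg (z : Fin k → ℂ) : 0 ≤ gauss z :=
  Finset.prod_nonneg fun j _ => by positivity

lemma mono_up (j : Fin k) (α : Fin k → ℕ) (z : Fin k → ℂ) :
    ((Real.sqrt (α j + 1) : ℝ) : ℂ) * mono (up j α) z = z j * mono α z := by
  classical
  unfold mono
  rw [← Finset.mul_prod_erase univ
      (fun i => z i ^ up j α i / ((Real.sqrt (up j α i).factorial : ℝ) : ℂ)) (Finset.mem_univ j),
    ← Finset.mul_prod_erase univ
      (fun i => z i ^ α i / ((Real.sqrt (α i).factorial : ℝ) : ℂ)) (Finset.mem_univ j)]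
  have h1 : ∏ i ∈ univ.erase j, z i ^ (up j α i) / ((Real.sqrt (up j α i).factorial : ℝ) : ℂ) =
      ∏ i ∈ univ.erase j, z i ^ α i / ((Real.sqrt (α i).factorial : ℝ) : ℂ) :=
    Finset.prod_congr rfl fun i hi => by rw [up_ne (Finset.ne_of_mem_erase hi)]
  rw [h1, ← mul_assoc, ← mul_assoc]
  congr 1
  rw [up_same, Nat.factorial_succ, Nat.cast_mul, Real.sqrt_mul (by positivity)]
  have h2 : ((Real.sqrt (α j + 1) : ℝ) : ℂ) ≠ 0 := by
    exact_mod_cast (Real.sqrt_pos.2 (by positivity)).ne'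
  have h3 : ((Real.sqrt (α j).factorial : ℝ) : ℂ) ≠ 0 := by
    exact_mod_cast (Real.sqrt_pos.2 (by positivity)).ne'
  push_cast
  field_simp
  ring

lemma conj_mono_mul_mono (α β : Fin k → ℕ) (z : Fin k → ℂ) :
    (starRingEnd ℂ) (mono α z) * mono β z * (gauss z : ℂ) =
      ∏ j, (moment (α j) (β j) (z j) *
        (((Real.sqrt (α j).factorial : ℝ) : ℂ) * ((Real.sqrt (β j).factorial : ℝ) : ℂ))⁻¹) := by
  unfold mono gauss moment
  rw [map_prod, Complex.ofReal_prod, ← Finset.prod_mul_distrib, ← Finset.prod_mul_distrib]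
  refine Finset.prod_congr rfl fun j _ => ?_
  rw [map_div₀, map_pow, Complex.conj_ofReal]
  rw [mul_inv]
  ring

lemma integrable_mono (α β : Fin k → ℕ) :
    Integrable (fun z => (starRingEnd ℂ) (mono α z) * mono β z * (gauss z : ℂ)) := by
  simp_rw [conj_mono_mul_mono]
  exact Integrable.fintype_prod fun j => (integrable_moment (α j) (β j)).mul_const _

lemma integral_conj_mono (α β : Fin k → ℕ) :
    ∫ z, (starRingEnd ℂ) (mono α z) * mono β z * (gauss z : ℂ) = if α = β then 1 else 0 := by
  simp_rw [conj_mono_mul_mono]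
  rw [integral_fintype_prod_volume_eq_prod (f := fun j w => moment (α j) (β j) w *
    (((Real.sqrt (α j).factorial : ℝ) : ℂ) * ((Real.sqrt (β j).factorial : ℝ) : ℂ))⁻¹)]
  simp_rw [integral_mul_const, integral_moment]
  split_ifs with h
  · subst h
    refine Finset.prod_eq_one fun j _ => ?_
    rw [if_pos rfl, ← Complex.ofReal_mul, Real.mul_self_sqrt (by positivity)]
    have : ((α j).factorial : ℂ) ≠ 0 := by exact_mod_cast (α j).factorial_ne_zero
    push_cast
    field_simp
  · obtain ⟨j, hj⟩ := Function.ne_iff.1 h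
    exact Finset.prod_eq_zero (Finset.mem_univ j) (by rw [if_neg hj, zero_mul])

/-- The polynomial with coefficient sequence `u`. -/
noncomputable def poly (u : (Fin k → ℕ) → E) (z : Fin k → ℂ) : E := ∑' α, mono α z • u α

/-- Finitely supported sequences. -/
def FinSupp (u : (Fin k → ℕ) → E) : Prop := (Function.support u).Finite

lemma FinSupp.exists_finset {u v : (Fin k → ℕ) → E} (hu : FinSupp u) (hv : FinSupp v) :
    ∃ S : Finset (Fin k → ℕ), Function.support u ⊆ S ∧ Function.support v ⊆ S :=
  ⟨(hu.union hv).toFinset, by simp, by simp⟩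

lemma FinSupp.add {u v : (Fin k → ℕ) → E} (hu : FinSupp u) (hv : FinSupp v) :
    FinSupp (u + v) := (hu.union hv).subset (Function.support_add _ _)

lemma FinSupp.coeffMap {u : (Fin k → ℕ) → E} (hu : FinSupp u) (M : E →L[ℂ] E) :
    FinSupp (coeffMap M u) := hu.subset fun α h hc => h (by simp [coeffMap_apply, hc])

lemma FinSupp.cr {u : (Fin k → ℕ) → E} (hu : FinSupp u) (j : Fin k) : FinSupp (cr j u) := by
  refine (hu.image (up j)).subset fun α h => ?_
  have h0 : α j ≠ 0 := fun hc => h (cr_apply_of_eq_zero hc u)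
  exact ⟨down j α, fun hc => h (by simp [cr_apply, hc]), up_down h0⟩

lemma FinSupp.an {u : (Fin k → ℕ) → E} (hu : FinSupp u) (j : Fin k) : FinSupp (an j u) := by
  refine (hu.image (down j)).subset fun α h => ?_
  exact ⟨up j α, fun hc => h (by simp [an_apply, hc]), down_up j α⟩

lemma FinSupp.zero : FinSupp (0 : (Fin k → ℕ) → E) := by simp [FinSupp]

lemma FinSupp.sum {ι : Type*} (t : Finset ι) {u : ι → (Fin k → ℕ) → E}
    (hu : ∀ i ∈ t, FinSupp (u i)) : FinSupp (∑ i ∈ t, u i) := by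
  classical
  induction t using Finset.induction_on with
  | empty => simpa using FinSupp.zero
  | insert i t hi ih =>
    rw [Finset.sum_insert hi]
    exact (hu i (by simp)).add (ih fun j hj => hu j (by simp [hj]))

lemma FinSupp.mem {u : (Fin k → ℕ) → E} (hu : FinSupp u) (s : ℤ) : Mem s u :=
  summable_of_hasFiniteSupport (hu.subset fun α h hc => h (by simp [term, hc]))

lemma poly_eq_sum {u : (Fin k → ℕ) → E} {S : Finset (Fin k → ℕ)} (h : Function.support u ⊆ S)
    (z : Fin k → ℂ) : poly u z = ∑ α ∈ S, mono α z • u α :=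
  tsum_eq_sum fun α hα => by
    have : u α = 0 := by by_contra hc; exact hα (h hc)
    simp [this]

lemma poly_cr (j : Fin k) (u : (Fin k → ℕ) → E) (z : Fin k → ℂ) :
    poly (cr j u) z = z j • poly u z := by
  unfold poly
  have hsupp : Function.support (fun α => mono α z • cr j u α) ⊆ Set.range (up j) := by
    intro α hα
    rw [mem_range_up]
    intro h
    exact hα (by simp [cr_apply_of_eq_zero h])
  rw [← (up_injective j).tsum_eq hsupp, ← tsum_const_smul'']
  refine tsum_congr fun α => ?_
  rw [cr_apply_up, smul_smul, mul_comm, mono_up, mul_smul]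

lemma poly_add {u v : (Fin k → ℕ) → E} (hu : FinSupp u) (hv : FinSupp v) (z : Fin k → ℂ) :
    poly (u + v) z = poly u z + poly v z := by
  classical
  obtain ⟨S, h1, h2⟩ := hu.exists_finset hv
  have h3 : Function.support (u + v) ⊆ S :=
    (Function.support_add u v).trans (Set.union_subset h1 h2)
  rw [poly_eq_sum h1, poly_eq_sum h2, poly_eq_sum h3, ← Finset.sum_add_distrib]
  simp

lemma poly_sum {ι : Type*} (t : Finset ι) {u : ι → (Fin k → ℕ) → E}
    (hu : ∀ i ∈ t, FinSupp (u i)) (z : Fin k → ℂ) :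
    poly (∑ i ∈ t, u i) z = ∑ i ∈ t, poly (u i) z := by
  classical
  induction t using Finset.induction_on with
  | empty => simp [poly]
  | insert i t hi ih =>
    rw [Finset.sum_insert hi, Finset.sum_insert hi, poly_add (hu i (by simp))
      (FinSupp.sum t fun j hj => hu j (by simp [hj])), ih fun j hj => hu j (by simp [hj])]

lemma poly_coeffMap {u : (Fin k → ℕ) → E} (hu : FinSupp u) (M : E →L[ℂ] E) (z : Fin k → ℂ) :
    poly (coeffMap M u) z = M (poly u z) := by
  obtain ⟨S, h1, h2⟩ := hu.exists_finset (hu.coeffMap M)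
  rw [poly_eq_sum h1, poly_eq_sum h2, map_sum]
  simp [coeffMap_apply]

/-- The pointwise Gaussian pairing of two polynomials. -/
noncomputable def pairing (u v : (Fin k → ℕ) → E) (z : Fin k → ℂ) : ℂ :=
  inner ℂ (poly u z) (poly v z) * (gauss z : ℂ)

lemma pairing_eq_sum {u v : (Fin k → ℕ) → E} {S : Finset (Fin k → ℕ)}
    (hu : Function.support u ⊆ S) (hv : Function.support v ⊆ S) (z : Fin k → ℂ) :
    pairing u v z = ∑ α ∈ S, ∑ β ∈ S, inner ℂ (u α) (v β) *
      ((starRingEnd ℂ) (mono α z) * mono β z * (gauss z : ℂ)) := by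
  rw [pairing, poly_eq_sum hu, poly_eq_sum hv, sum_inner, Finset.sum_mul]
  refine Finset.sum_congr rfl fun α _ => ?_
  rw [inner_sum, Finset.sum_mul]
  refine Finset.sum_congr rfl fun β _ => ?_
  rw [inner_smul_left, inner_smul_right]
  ring

lemma integral_pairing {u v : (Fin k → ℕ) → E} (hu : FinSupp u) (hv : FinSupp v) :
    Integrable (pairing u v) ∧ ∫ z, pairing u v z = ip u v := by
  classical
  obtain ⟨S, h1, h2⟩ := hu.exists_finset hv
  have hI : ∀ α β, Integrable (fun z => inner ℂ (u α) (v β) *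
      ((starRingEnd ℂ) (mono α z) * mono β z * (gauss z : ℂ))) :=
    fun α β => (integrable_mono α β).const_mul _
  have he : pairing u v = fun z => ∑ α ∈ S, ∑ β ∈ S, inner ℂ (u α) (v β) *
      ((starRingEnd ℂ) (mono α z) * mono β z * (gauss z : ℂ)) :=
    funext fun z => pairing_eq_sum h1 h2 z
  rw [he]
  refine ⟨integrable_finsetSum _ fun α _ => integrable_finsetSum _ fun β _ => hI α β, ?_⟩
  rw [integral_finsetSum _ fun α _ => integrable_finsetSum _ fun β _ => hI α β]
  have hip : ip u v = ∑ α ∈ S, inner ℂ (u α) (v α) :=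
    tsum_eq_sum fun α hα => by
      have : u α = 0 := by by_contra hc; exact hα (h1 hc)
      simp [this]
  rw [hip]
  refine Finset.sum_congr rfl fun α hα => ?_
  rw [integral_finsetSum _ fun β _ => hI α β]
  simp_rw [integral_const_mul, integral_conj_mono]
  simp [hα]

end Bargmann

end Fock

namespace Fock

open Finset MeasureTheory

section Garding

variable {k : ℕ} {E : Type*} [NormedAddCommGroup E] [InnerProductSpace ℂ E] [CompleteSpace E]

open ContinuousLinearMap (adjoint)

/-- The creation part of the Dirac-type operator. -/
noncomputable def dirCr (B : Fin k → E →L[ℂ] E) :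
    ((Fin k → ℕ) → E) →ₗ[ℂ] ((Fin k → ℕ) → E) :=
  ∑ j, coeffMap (B j) ∘ₗ cr j

/-- The annihilation part of the Dirac-type operator. -/
noncomputable def dirAn (B : Fin k → E →L[ℂ] E) :
    ((Fin k → ℕ) → E) →ₗ[ℂ] ((Fin k → ℕ) → E) :=
  ∑ j, coeffMap (adjoint (B j)) ∘ₗ an j

/-- The Dirac-type operator with symbol `∑ z_j B_j + conj z_j B_j*`. -/
noncomputable def dir (B : Fin k → E →L[ℂ] E) :
    ((Fin k → ℕ) → E) →ₗ[ℂ] ((Fin k → ℕ) → E) := dirCr B + dirAn B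

lemma dirCr_apply (B : Fin k → E →L[ℂ] E) (u : (Fin k → ℕ) → E) :
    dirCr B u = ∑ j, coeffMap (B j) (cr j u) := by simp [dirCr]

lemma dirAn_apply (B : Fin k → E →L[ℂ] E) (u : (Fin k → ℕ) → E) :
    dirAn B u = ∑ j, coeffMap (adjoint (B j)) (an j u) := by simp [dirAn]

lemma dir_apply (B : Fin k → E →L[ℂ] E) (u : (Fin k → ℕ) → E) :
    dir B u = dirCr B u + dirAn B u := rfl

lemma order_dirCr (B : Fin k → E →L[ℂ] E) : Order 1 (dirCr B) :=
  Order.sum _ fun j _ => by simpa only [zero_add] using (order_coeffMap (B j)).comp (order_cr j)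

lemma order_dirAn (B : Fin k → E →L[ℂ] E) : Order 1 (dirAn B) :=
  Order.sum _ fun j _ => by
    simpa only [zero_add] using (order_coeffMap (adjoint (B j))).comp (order_an j)

lemma order_dir (B : Fin k → E →L[ℂ] E) : Order 1 (dir B) := (order_dirCr B).add (order_dirAn B)

lemma Order.mem {r : ℤ} {T : ((Fin k → ℕ) → E) →ₗ[ℂ] ((Fin k → ℕ) → E)} (h : Order r T)
    {s : ℤ} {u : (Fin k → ℕ) → E} (hu : Mem (s + r) u) : Mem s (T u) := by
  obtain ⟨C, -, hC⟩ := h s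
  exact (hC u hu).1

lemma FinSupp.dirCr {u : (Fin k → ℕ) → E} (hu : FinSupp u) (B : Fin k → E →L[ℂ] E) :
    FinSupp (dirCr B u) := by
  rw [dirCr_apply]
  exact FinSupp.sum _ fun j _ => (hu.cr j).coeffMap _

lemma FinSupp.dirAn {u : (Fin k → ℕ) → E} (hu : FinSupp u) (B : Fin k → E →L[ℂ] E) :
    FinSupp (dirAn B u) := by
  rw [dirAn_apply]
  exact FinSupp.sum _ fun j _ => (hu.an j).coeffMap _

lemma FinSupp.dir {u : (Fin k → ℕ) → E} (hu : FinSupp u) (B : Fin k → E →L[ℂ] E) :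
    FinSupp (dir B u) := (hu.dirCr B).add (hu.dirAn B)

/-- Ellipticity of the symbol. -/
def Elliptic (B : Fin k → E →L[ℂ] E) : Prop :=
  ∃ c : ℝ, 0 < c ∧ ∀ (z : Fin k → ℂ) (v : E), c * ((∑ j, ‖z j‖ ^ 2) * ‖v‖ ^ 2) ≤
    ‖∑ j, z j • B j v + ∑ j, (starRingEnd ℂ) (z j) • adjoint (B j) v‖ ^ 2

lemma nsq_cr (j : Fin k) (u : (Fin k → ℕ) → E) :
    nsq 0 (cr j u) = ∑' α, (α j + 1 : ℝ) * ‖u α‖ ^ 2 := by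
  unfold nsq
  rw [← (up_injective j).tsum_eq (support_term_cr 0 j u)]
  refine tsum_congr fun α => ?_
  have h : (0 : ℝ) ≤ α j + 1 := by positivity
  simp only [term, cr_apply_up, norm_smul, Complex.norm_real, Real.norm_eq_abs,
      abs_of_nonneg (Real.sqrt_nonneg _), mul_pow, zpow_zero, one_mul, Real.sq_sqrt h]

lemma nsq_one_le_sum_cr {u : (Fin k → ℕ) → E} (hu : Mem 1 u) :
    nsq 1 u ≤ ∑ j, nsq 0 (cr j u) + nsq 0 u := by
  have hs : ∀ j, Summable (fun α => (α j + 1 : ℝ) * ‖u α‖ ^ 2) := fun j => by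
    refine Summable.of_nonneg_of_le (fun α => by positivity) (fun α => ?_) hu
    have : (α j : ℝ) ≤ deg α := by exact_mod_cast le_deg j α
    simp only [term, wt, zpow_one]
    gcongr ?_ * _
    linarith
  have h0 : Mem 0 u := (hu.mono (by norm_num)).1
  simp_rw [nsq_cr]
  unfold nsq
  rw [← Summable.tsum_finsetSum fun j _ => hs j,
    ← (summable_sum fun j _ => hs j).tsum_add h0]
  refine hu.tsum_le_tsum (fun α => ?_) ((summable_sum fun j _ => hs j).add h0)
  simp only [term, wt, zpow_one, zpow_zero, one_mul, ← Finset.sum_mul, ← add_one_mul]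
  refine mul_le_mul_of_nonneg_right ?_ (by positivity)
  rw [Finset.sum_add_distrib]
  have hd : ((deg α : ℕ) : ℝ) = ∑ j, (α j : ℝ) := by simp [deg]
  rw [hd]
  have : (0 : ℝ) ≤ ∑ _j : Fin k, 1 := by positivity
  linarith

lemma sum_cr_le_dir (B : Fin k → E →L[ℂ] E) {c : ℝ}
    (hc : ∀ (z : Fin k → ℂ) (v : E), c * ((∑ j, ‖z j‖ ^ 2) * ‖v‖ ^ 2) ≤
    ‖∑ j, z j • B j v + ∑ j, (starRingEnd ℂ) (z j) • adjoint (B j) v‖ ^ 2)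
    {u : (Fin k → ℕ) → E} (hu : FinSupp u) :
    c * ∑ j, nsq 0 (cr j u) ≤
      nsq 0 (dir B u) + ∑ j, nsq 0 (coeffMap (adjoint (B j)) u) := by
  set X := dirCr B u with hX
  set W := dirAn B u with hW
  have fX : FinSupp X := hu.dirCr B
  have fW : FinSupp W := hu.dirAn B
  have fC : ∀ j, FinSupp (coeffMap (adjoint (B j)) u) := fun j => hu.coeffMap _
  -- the pointwise inequality
  have hpt : ∀ z, c * ∑ j, (pairing (cr j u) (cr j u) z).re ≤
      (pairing X X z).re + 2 * ∑ j, (pairing (cr j X) (coeffMap (adjoint (B j)) u) z).re +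
      ∑ i, ∑ j, (pairing (cr j (coeffMap (adjoint (B i)) u))
        (cr i (coeffMap (adjoint (B j)) u)) z).re := fun z => by
    have hXz : poly X z = ∑ j, z j • B j (poly u z) := by
      rw [hX, dirCr_apply, poly_sum _ fun j _ => (hu.cr j).coeffMap _]
      refine Finset.sum_congr rfl fun j _ => ?_
      rw [poly_coeffMap (hu.cr j), poly_cr, map_smul]
    set Y := ∑ j, (starRingEnd ℂ) (z j) • adjoint (B j) (poly u z) with hY
    have h := hc z (poly u z)
    rw [← hXz, ← hY, norm_add_sq (𝕜 := ℂ)] at h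
    have h1 : ∑ j, (pairing (cr j X) (coeffMap (adjoint (B j)) u) z).re =
        RCLike.re (inner ℂ (poly X z) Y) * gauss z := by
      rw [hY, inner_sum, map_sum, Finset.sum_mul]
      refine Finset.sum_congr rfl fun j _ => ?_
      rw [pairing, poly_cr, poly_coeffMap hu, inner_smul_left, inner_smul_right]
      simp [Complex.mul_re]
    have h2 : ∑ i, ∑ j, (pairing (cr j (coeffMap (adjoint (B i)) u))
        (cr i (coeffMap (adjoint (B j)) u)) z).re = ‖Y‖ ^ 2 * gauss z := by
      rw [← inner_self_eq_norm_sq (𝕜 := ℂ), hY, sum_inner, map_sum, Finset.sum_mul]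
      refine Finset.sum_congr rfl fun i _ => ?_
      rw [inner_sum, map_sum, Finset.sum_mul]
      refine Finset.sum_congr rfl fun j _ => ?_
      rw [pairing, poly_cr, poly_coeffMap hu, poly_cr, poly_coeffMap hu, inner_smul_left,
        inner_smul_right, inner_smul_left, inner_smul_right, Complex.conj_conj, Complex.re_mul_ofReal]
      congr 1
      change _ = Complex.re _
      congr 1
      ring
    have h3 : (pairing X X z).re = ‖poly X z‖ ^ 2 * gauss z := by
      rw [pairing, Complex.re_mul_ofReal, ← inner_self_eq_norm_sq (𝕜 := ℂ)]
      rfl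
    have h4 : ∑ j, (pairing (cr j u) (cr j u) z).re =
        ((∑ j, ‖z j‖ ^ 2) * ‖poly u z‖ ^ 2) * gauss z := by
      rw [Finset.sum_mul, Finset.sum_mul]
      refine Finset.sum_congr rfl fun j _ => ?_
      rw [pairing, poly_cr, Complex.re_mul_ofReal, ← mul_pow, ← norm_smul,
        ← inner_self_eq_norm_sq (𝕜 := ℂ)]
      rfl
    rw [h1, h2, h3, h4]
    have := mul_le_mul_of_nonneg_right h (gauss_nonneg z)
    linarith
  have hI : ∀ {a b : (Fin k → ℕ) → E}, FinSupp a → FinSupp b →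
      Integrable (fun z => (pairing a b z).re) ∧ ∫ z, (pairing a b z).re = (ip a b).re :=
    fun ha hb => by
      have := integral_pairing ha hb
      refine ⟨this.1.re, ?_⟩
      rw [← this.2]
      exact integral_re this.1
  have i1 := fun j => hI (hu.cr j) (hu.cr j)
  have i2 := hI fX fX
  have i3 := fun j => hI (fX.cr j) (fC j)
  have i4 := fun i j => hI ((fC i).cr j) ((fC j).cr i)
  have iR := (integrable_finsetSum univ fun j _ => (i3 j).1).const_mul 2
  have iS := integrable_finsetSum univ fun i _ => integrable_finsetSum univ fun j _ => (i4 i j).1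
  have key := MeasureTheory.integral_mono ((integrable_finsetSum univ fun j _ => (i1 j).1).const_mul c)
    ((i2.1.add iR).add iS) hpt
  have iP : Integrable (fun z => (pairing X X z).re +
      2 * ∑ j, (pairing (cr j X) (coeffMap (adjoint (B j)) u) z).re) := i2.1.add iR
  simp only [Pi.add_apply] at key
  rw [integral_const_mul, integral_finsetSum univ fun j _ => (i1 j).1,
    integral_add iP iS, integral_add i2.1 iR, integral_const_mul,
    integral_finsetSum univ fun j _ => (i3 j).1,
    integral_finsetSum univ fun i _ => integrable_finsetSum univ fun j _ => (i4 i j).1] at key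
  simp_rw [fun i => integral_finsetSum univ fun j _ => (i4 i j).1] at key
  simp only [(i1 _).2, i2.2, (i3 _).2, (i4 _ _).2] at key
  have m0 : ∀ {a : (Fin k → ℕ) → E}, FinSupp a → Mem 0 a := fun h => h.mem 0
  have hWs : W = ∑ j, an j (coeffMap (adjoint (B j)) u) := by
    rw [hW, dirAn_apply]
    exact Finset.sum_congr rfl fun j _ => (an_coeffMap _ _ _).symm
  have t2 : ∑ j, (ip (cr j X) (coeffMap (adjoint (B j)) u)).re = (ip X W).re := by
    rw [hWs, ip_sum_right _ (fun j _ => m0 ((fC j).an j)) (m0 fX), Complex.re_sum]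
    exact Finset.sum_congr rfl fun j _ => by rw [ip_cr]
  have t3 : ∑ i, ∑ j, (ip (cr j (coeffMap (adjoint (B i)) u))
      (cr i (coeffMap (adjoint (B j)) u))).re =
      (ip W W).re + ∑ j, nsq 0 (coeffMap (adjoint (B j)) u) := by
    have h1 : ∀ i j, ip (cr j (coeffMap (adjoint (B i)) u)) (cr i (coeffMap (adjoint (B j)) u)) =
        ip (an i (coeffMap (adjoint (B i)) u)) (an j (coeffMap (adjoint (B j)) u)) +
        if i = j then (nsq 0 (coeffMap (adjoint (B i)) u) : ℂ) else 0 := fun i j => by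
      rw [ip_cr]
      split_ifs with hij
      · subst hij
        rw [an_cr_same, ip_add_right (m0 (fC i)) (m0 (((fC i).an i).cr i)) (m0 (fC i)), ip_self,
          ← ip_an]
      · rw [an_cr_ne (Ne.symm hij), ← ip_an, add_zero]
    have h2 : ip W W = ∑ i, ∑ j,
        ip (an i (coeffMap (adjoint (B i)) u)) (an j (coeffMap (adjoint (B j)) u)) := by
      rw [hWs, ip_sum_left _ (fun j _ => m0 ((fC j).an j)) (m0 (hWs ▸ fW))]
      refine Finset.sum_congr rfl fun i _ => ?_
      rw [ip_sum_right _ (fun j _ => m0 ((fC j).an j)) (m0 ((fC i).an i))]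
    rw [h2]
    simp only [h1, Complex.add_re, Finset.sum_add_distrib, Complex.re_sum]
    congr 1
    refine Finset.sum_congr rfl fun i _ => ?_
    rw [← Complex.re_sum, Finset.sum_ite_eq]
    simp
  have t4 : nsq 0 (dir B u) = (ip X X).re + 2 * (ip X W).re + (ip W W).re := by
    have : dir B u = X + W := rfl
    have hr : (nsq 0 (dir B u) : ℝ) = (ip (dir B u) (dir B u)).re := by rw [ip_self]; simp
    rw [hr, this, ip_add_left (m0 fX) (m0 fW) (m0 (fX.add fW)),
      ip_add_right (m0 fX) (m0 fX) (m0 fW), ip_add_right (m0 fW) (m0 fX) (m0 fW),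
      ← ip_conj X W]
    simp only [Complex.add_re, Complex.conj_re]
    ring
  rw [t2, t3] at key
  simp only [ip_self _, Complex.ofReal_re] at key t4
  rw [t4]
  linarith

/-- Gårding's inequality for finitely supported sequences. -/
lemma garding {B : Fin k → E →L[ℂ] E} (hB : Elliptic B) : ∃ C : ℝ, 0 ≤ C ∧
    ∀ u, FinSupp u → nsq 1 u ≤ C * (nsq 0 (dir B u) + nsq 0 u) := by
  obtain ⟨c, hc0, hc⟩ := hB
  choose D hD0 hD using fun j => order_coeffMap (k := k) (adjoint (B j)) 0
  have hD0' : 0 ≤ ∑ j, D j := Finset.sum_nonneg fun j _ => hD0 j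
  refine ⟨c⁻¹ * (1 + ∑ j, D j) + 1, by positivity, fun u hu => ?_⟩
  have h1 := sum_cr_le_dir B hc hu
  have h2 : ∑ j, nsq 0 (coeffMap (adjoint (B j)) u) ≤ (∑ j, D j) * nsq 0 u := by
    rw [Finset.sum_mul]
    exact Finset.sum_le_sum fun j _ => (hD j u (hu.mem _)).2
  have h3 := nsq_one_le_sum_cr (hu.mem 1)
  have h4 := nsq_nonneg 0 u
  have h5 := nsq_nonneg 0 (dir B u)
  have h6 : ∑ j, nsq 0 (cr j u) ≤ c⁻¹ * (nsq 0 (dir B u) + (∑ j, D j) * nsq 0 u) := by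
    rw [← div_eq_inv_mul, le_div_iff₀ hc0]
    linarith
  have h7 : nsq 0 (dir B u) + (∑ j, D j) * nsq 0 u ≤
      (1 + ∑ j, D j) * (nsq 0 (dir B u) + nsq 0 u) := by
    nlinarith [mul_nonneg hD0' h5]
  have h8 := mul_le_mul_of_nonneg_left h7 (inv_pos.2 hc0).le
  linarith

end Garding

end Fock

namespace Fock

open Finset

section Regularity

variable {k : ℕ} {E : Type*} [NormedAddCommGroup E] [InnerProductSpace ℂ E] [CompleteSpace E]

open ContinuousLinearMap (adjoint)

lemma an_dir (j : Fin k) (B : Fin k → E →L[ℂ] E) (u : (Fin k → ℕ) → E) :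
    an j (dir B u) = dir B (an j u) + coeffMap (B j) u := by
  have h1 : ∀ i, an j (coeffMap (B i) (cr i u)) =
      coeffMap (B i) (cr i (an j u)) + if i = j then coeffMap (B j) u else 0 := fun i => by
    rw [an_coeffMap]
    split_ifs with h
    · subst h; rw [an_cr_same, map_add]
    · rw [an_cr_ne (Ne.symm h), add_zero]
  have h2 : ∀ i, an j (coeffMap (adjoint (B i)) (an i u)) =
      coeffMap (adjoint (B i)) (an i (an j u)) := fun i => by rw [an_coeffMap, an_an]
  simp only [dir_apply, dirCr_apply, dirAn_apply, map_add, map_sum, h1, h2,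
    Finset.sum_add_distrib, Finset.sum_ite_eq', Finset.mem_univ, if_true]
  abel

lemma nsq_sum_le {s : ℤ} {ι : Type*} (t : Finset ι) {u : ι → (Fin k → ℕ) → E}
    (hu : ∀ i ∈ t, Mem s (u i)) :
    nsq s (∑ i ∈ t, u i) ≤ 2 ^ t.card * ∑ i ∈ t, nsq s (u i) := by
  classical
  induction t using Finset.induction_on with
  | empty => simp
  | insert i t hi ih =>
    have h1 := ih fun j hj => hu j (by simp [hj])
    have h2 := ((hu i (by simp)).add (Mem.sum t fun j hj => hu j (by simp [hj]))).2
    rw [Finset.sum_insert hi, Finset.sum_insert hi, Finset.card_insert_of_notMem hi, pow_succ]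
    have h3 := nsq_nonneg s (u i)
    have h4 : (1 : ℝ) ≤ 2 ^ t.card := one_le_pow₀ (by norm_num)
    nlinarith

lemma Mem.neg {s : ℤ} {u : (Fin k → ℕ) → E} (hu : Mem s u) :
    Mem s (-u) ∧ nsq s (-u) = nsq s u := by
  have : term s (-u) = term s u := by funext α; simp [term]
  unfold Mem nsq
  rw [this]
  exact ⟨hu, rfl⟩

lemma Mem.sub {s : ℤ} {u v : (Fin k → ℕ) → E} (hu : Mem s u) (hv : Mem s v) :
    Mem s (u - v) ∧ nsq s (u - v) ≤ 2 * (nsq s u + nsq s v) := by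
  have := hu.add hv.neg.1
  rwa [hv.neg.2, ← sub_eq_add_neg] at this

/-- Multiplication of coefficients by a real function. -/
noncomputable def dg (f : (Fin k → ℕ) → ℝ) : ((Fin k → ℕ) → E) →ₗ[ℂ] ((Fin k → ℕ) → E) where
  toFun u := fun α => ((f α : ℝ) : ℂ) • u α
  map_add' u v := by funext α; simp
  map_smul' c u := by funext α; simp [smul_comm c]

lemma dg_apply (f : (Fin k → ℕ) → ℝ) (u : (Fin k → ℕ) → E) (α : Fin k → ℕ) :
    dg f u α = ((f α : ℝ) : ℂ) • u α := rfl

lemma term_dg (s : ℤ) (f : (Fin k → ℕ) → ℝ) (u : (Fin k → ℕ) → E) (α : Fin k → ℕ) :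
    term s (dg f u) α = f α ^ 2 * term s u α := by
  simp only [term, dg_apply, norm_smul, Complex.norm_real, Real.norm_eq_abs, mul_pow, sq_abs]
  ring

lemma dg_coeffMap (f : (Fin k → ℕ) → ℝ) (M : E →L[ℂ] E) (u : (Fin k → ℕ) → E) :
    dg f (coeffMap M u) = coeffMap M (dg f u) := by
  funext α; simp [dg_apply, coeffMap_apply]

/-- The cutoff function in the degree. -/
noncomputable def cutoff (R : ℕ) (α : Fin k → ℕ) : ℝ := max 0 (1 - deg α / (R + 1))

lemma cutoff_nonneg (R : ℕ) (α : Fin k → ℕ) : 0 ≤ cutoff R α := le_max_left _ _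

lemma cutoff_le_one (R : ℕ) (α : Fin k → ℕ) : cutoff R α ≤ 1 :=
  max_le (by norm_num) (by have : (0 : ℝ) ≤ deg α / (R + 1) := by positivity
                           linarith)

lemma cutoff_sub_up (R : ℕ) (j : Fin k) (α : Fin k → ℕ) :
    (cutoff R (up j α) - cutoff R α) ^ 2 * (α j + 1) ≤ 1 := by
  have hR : (0 : ℝ) < R + 1 := by positivity
  have hj : (α j : ℝ) ≤ deg α := by exact_mod_cast le_deg j α
  simp only [cutoff, deg_up]
  by_cases h : deg α ≤ R
  · have h' : (deg α : ℝ) ≤ R := by exact_mod_cast h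
    have h1 : (0 : ℝ) ≤ 1 - ((deg α + 1 : ℕ) : ℝ) / (R + 1) := by
      rw [sub_nonneg, div_le_one hR]; push_cast; linarith
    have h2 : (0 : ℝ) ≤ 1 - (deg α : ℝ) / (R + 1) := by
      rw [sub_nonneg, div_le_one hR]; linarith
    rw [max_eq_right h1, max_eq_right h2]
    push_cast
    have : (1 - ((deg α : ℝ) + 1) / (R + 1) - (1 - (deg α : ℝ) / (R + 1))) ^ 2 * ((α j : ℝ) + 1)
        = ((α j : ℝ) + 1) / (R + 1) ^ 2 := by field_simp; ring
    rw [this, div_le_one (by positivity)]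
    nlinarith [Nat.cast_nonneg (α := ℝ) R]
  · have h' : (R : ℝ) + 1 ≤ deg α := by exact_mod_cast Nat.lt_of_not_le h
    have h1 : 1 - ((deg α + 1 : ℕ) : ℝ) / (R + 1) ≤ 0 := by
      rw [sub_nonpos, one_le_div hR]; push_cast; linarith
    have h2 : 1 - (deg α : ℝ) / (R + 1) ≤ 0 := by
      rw [sub_nonpos, one_le_div hR]; linarith
    rw [max_eq_left h1, max_eq_left h2]
    norm_num

lemma finite_deg_le (R : ℕ) : {α : Fin k → ℕ | deg α ≤ R}.Finite :=
  (Set.finite_Iic (fun _ : Fin k => R)).subset fun α h j => (le_deg j α).trans h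

lemma FinSupp.of_deg {u : (Fin k → ℕ) → E} {R : ℕ} (h : ∀ α, R < deg α → u α = 0) : FinSupp u :=
  (finite_deg_le R).subset fun α hα => by
    by_contra hc
    exact hα (h α (by simpa using hc))

lemma FinSupp.cutoff (R : ℕ) (u : (Fin k → ℕ) → E) : FinSupp (dg (cutoff R) u) :=
  FinSupp.of_deg (R := R) fun α h => by
    have h' : (R : ℝ) + 1 ≤ deg α := by exact_mod_cast h
    have h2 : 1 - (deg α : ℝ) / (R + 1) ≤ 0 := by
      rw [sub_nonpos, one_le_div (by positivity)]; linarith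
    simp [dg_apply, Fock.cutoff, max_eq_left h2]

lemma Mem.cutoff {s : ℤ} {u : (Fin k → ℕ) → E} (hu : Mem s u) (R : ℕ) :
    Mem s (dg (cutoff R) u) ∧ nsq s (dg (Fock.cutoff R) u) ≤ nsq s u := by
  have := Mem.of_le (s := s) (v := dg (Fock.cutoff R) u) (C := 1) (fun α => ?_) hu
  · simpa using this
  · rw [term_dg]
    refine mul_le_mul_of_nonneg_right ?_ (term_nonneg _ _ _)
    nlinarith [cutoff_nonneg R α, cutoff_le_one R α]

lemma cutoff_comm_an {u : (Fin k → ℕ) → E} (hu : Mem 0 u) (j : Fin k) (R : ℕ) :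
    Mem 0 (an j (dg (cutoff R) u) - dg (cutoff R) (an j u)) ∧
      nsq 0 (an j (dg (cutoff R) u) - dg (cutoff R) (an j u)) ≤ nsq 0 u := by
  have hle : ∀ α, term 0 (an j (dg (cutoff R) u) - dg (cutoff R) (an j u)) α ≤
      term 0 u (up j α) := fun α => by
    have h : (an j (dg (cutoff R) u) - dg (cutoff R) (an j u)) α =
        (((cutoff R (up j α) - cutoff R α) * Real.sqrt (α j + 1) : ℝ) : ℂ) • u (up j α) := by
      rw [Pi.sub_apply, an_apply, dg_apply, dg_apply, an_apply, smul_smul, smul_smul, ← sub_smul]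
      congr 1
      push_cast; ring
    simp only [term, h, norm_smul, Complex.norm_real, Real.norm_eq_abs, mul_pow, sq_abs,
      zpow_zero, one_mul]
    rw [Real.sq_sqrt (by positivity)]
    have := mul_le_mul_of_nonneg_right (cutoff_sub_up R j α) (sq_nonneg ‖u (up j α)‖)
    linarith
  have hs := hu.comp_injective (up_injective j)
  have hm : Mem 0 (an j (dg (cutoff R) u) - dg (cutoff R) (an j u)) :=
    Summable.of_nonneg_of_le (term_nonneg _ _) hle hs
  exact ⟨hm, (hm.tsum_le_tsum hle hs).trans
    (tsum_comp_le_tsum_of_inj hu (term_nonneg _ _) (up_injective j))⟩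

lemma cutoff_comm_cr {u : (Fin k → ℕ) → E} (hu : Mem 0 u) (j : Fin k) (R : ℕ) :
    Mem 0 (cr j (dg (cutoff R) u) - dg (cutoff R) (cr j u)) ∧
      nsq 0 (cr j (dg (cutoff R) u) - dg (cutoff R) (cr j u)) ≤ nsq 0 u := by
  set w := cr j (dg (cutoff R) u) - dg (cutoff R) (cr j u) with hw
  have hle : ∀ α, term 0 w (up j α) ≤ term 0 u α := fun α => by
    have h : w (up j α) =
        (((cutoff R α - cutoff R (up j α)) * Real.sqrt (α j + 1) : ℝ) : ℂ) • u α := by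
      rw [hw, Pi.sub_apply, cr_apply_up, dg_apply, dg_apply, cr_apply_up, smul_smul, smul_smul,
        ← sub_smul]
      congr 1
      push_cast; ring
    simp only [term, h, norm_smul, Complex.norm_real, Real.norm_eq_abs, mul_pow, sq_abs,
      zpow_zero, one_mul]
    rw [Real.sq_sqrt (by positivity)]
    have := mul_le_mul_of_nonneg_right (cutoff_sub_up R j α) (sq_nonneg ‖u α‖)
    nlinarith
  have hsupp : Function.support (term 0 w) ⊆ Set.range (up j) := by
    intro α hα
    rw [mem_range_up]
    intro h
    exact hα (by simp [term, hw, cr_apply_of_eq_zero h, dg_apply])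
  have hs' : Summable (term 0 w ∘ up j) :=
    Summable.of_nonneg_of_le (fun _ => term_nonneg _ _ _) hle hu
  have hm : Mem 0 w :=
    ((up_injective j).summable_iff (fun x hx => by
      by_contra h; exact hx (hsupp h))).1 hs'
  refine ⟨hm, ?_⟩
  calc nsq 0 w = ∑' α, term 0 w (up j α) := ((up_injective j).tsum_eq hsupp).symm
    _ ≤ ∑' α, term 0 u α := hs'.tsum_le_tsum hle hu

lemma cutoff_comm_dir (B : Fin k → E →L[ℂ] E) : ∃ C : ℝ, 0 ≤ C ∧ ∀ u, Mem 0 u →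
    Mem 0 (dir B u) → ∀ R, nsq 0 (dir B (dg (cutoff R) u)) ≤
      C * (nsq 0 (dir B u) + nsq 0 u) := by
  choose D hD0 hD using fun j => order_coeffMap (k := k) (B j) 0
  choose F hF0 hF using fun j => order_coeffMap (k := k) (adjoint (B j)) 0
  have hDs : 0 ≤ ∑ j, D j := Finset.sum_nonneg fun j _ => hD0 j
  have hFs : 0 ≤ ∑ j, F j := Finset.sum_nonneg fun j _ => hF0 j
  refine ⟨2 * (1 + 2 * (2 ^ k * ∑ j, D j + 2 ^ k * ∑ j, F j)), by positivity,
    fun u hu hdu R => ?_⟩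
  have hcr := fun j => hD j _ (cutoff_comm_cr hu j R).1
  have han := fun j => hF j _ (cutoff_comm_an hu j R).1
  have hcr' : nsq 0 (∑ j, coeffMap (B j) (cr j (dg (cutoff R) u) - dg (cutoff R) (cr j u))) ≤
      2 ^ k * ((∑ j, D j) * nsq 0 u) := by
    refine (nsq_sum_le _ fun j _ => (hcr j).1).trans ?_
    rw [Finset.card_univ, Fintype.card_fin, Finset.sum_mul]
    gcongr with j
    exact (hcr j).2.trans (mul_le_mul_of_nonneg_left (cutoff_comm_cr hu j R).2 (hD0 j))
  have han' : nsq 0 (∑ j, coeffMap (adjoint (B j))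
      (an j (dg (cutoff R) u) - dg (cutoff R) (an j u))) ≤ 2 ^ k * ((∑ j, F j) * nsq 0 u) := by
    refine (nsq_sum_le _ fun j _ => (han j).1).trans ?_
    rw [Finset.card_univ, Fintype.card_fin, Finset.sum_mul]
    gcongr with j
    exact (han j).2.trans (mul_le_mul_of_nonneg_left (cutoff_comm_an hu j R).2 (hF0 j))
  have he : dir B (dg (cutoff R) u) = dg (cutoff R) (dir B u) +
      (∑ j, coeffMap (B j) (cr j (dg (cutoff R) u) - dg (cutoff R) (cr j u)) +
      ∑ j, coeffMap (adjoint (B j)) (an j (dg (cutoff R) u) - dg (cutoff R) (an j u))) := by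
    simp only [dir_apply, dirCr_apply, dirAn_apply, map_add, map_sum, map_sub, dg_coeffMap,
      Finset.sum_sub_distrib]
    abel
  have mcr := Mem.sum univ fun j _ => (hcr j).1
  have man := Mem.sum univ fun j _ => (han j).1
  have h1 := (mcr.add man).2
  have h2 := ((hdu.cutoff R).1.add (mcr.add man).1).2
  have h3 := (hdu.cutoff R).2
  have h4 := nsq_nonneg 0 u
  have h5 := nsq_nonneg 0 (dir B u)
  rw [he]
  set d := ∑ j, D j
  set f := ∑ j, F j
  have h6 : 0 ≤ 2 ^ k * d * nsq 0 (dir B u) := by positivity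
  have h7 : 0 ≤ 2 ^ k * f * nsq 0 (dir B u) := by positivity
  nlinarith

lemma regularity_zero {B : Fin k → E →L[ℂ] E} (hB : Elliptic B) : ∃ C : ℝ, 0 ≤ C ∧
    ∀ u, Mem 0 u → Mem 0 (dir B u) →
      Mem 1 u ∧ nsq 1 u ≤ C * (nsq 0 (dir B u) + nsq 0 u) := by
  obtain ⟨C, hC, hG⟩ := garding hB
  obtain ⟨D, hD, hK⟩ := cutoff_comm_dir B
  refine ⟨C * (D + 1), by positivity, fun u hu hdu => ?_⟩
  have hb : ∀ R, nsq 1 (dg (cutoff R) u) ≤ C * (D + 1) * (nsq 0 (dir B u) + nsq 0 u) := fun R => by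
    have h1 := hG _ (FinSupp.cutoff R u)
    have h2 := hK u hu hdu R
    have h3 := (hu.cutoff R).2
    have h4 := nsq_nonneg 0 (dir B u)
    refine h1.trans ?_
    rw [mul_assoc]
    refine mul_le_mul_of_nonneg_left ?_ hC
    linarith
  have hfin : ∀ S : Finset (Fin k → ℕ),
      ∑ α ∈ S, term 1 u α ≤ C * (D + 1) * (nsq 0 (dir B u) + nsq 0 u) := fun S => by
    have hlim : Filter.Tendsto (fun R : ℕ => ∑ α ∈ S, term 1 (dg (cutoff R) u) α) Filter.atTop
        (nhds (∑ α ∈ S, term 1 u α)) := by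
      refine tendsto_finsetSum _ fun α _ => ?_
      simp_rw [term_dg]
      have h1 : Filter.Tendsto (fun R : ℕ => cutoff R α) Filter.atTop (nhds 1) := by
        have h2 : Filter.Tendsto (fun R : ℕ => (deg α : ℝ) / ((R : ℝ) + 1)) Filter.atTop
            (nhds 0) := by
          have := (tendsto_one_div_add_atTop_nhds_zero_nat (𝕜 := ℝ)).const_mul (deg α : ℝ)
          simpa [div_eq_mul_inv] using this
        have h3 := (tendsto_const_nhds (x := (0 : ℝ))).max (h2.const_sub 1)
        simpa [cutoff] using h3
      have h4 := (h1.pow 2).mul_const (term 1 u α)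
      simpa using h4
    refine le_of_tendsto hlim (Filter.Eventually.of_forall fun R => ?_)
    refine le_trans ?_ (hb R)
    exact ((FinSupp.cutoff R u).mem 1).sum_le_tsum S fun α _ => term_nonneg _ _ _
  have hm : Mem 1 u := summable_of_sum_le (term_nonneg 1 u) hfin
  exact ⟨hm, hm.tsum_le_of_sum_le hfin⟩

lemma Mem.of_an (s : ℤ) : ∃ C : ℝ, 0 ≤ C ∧ ∀ u : (Fin k → ℕ) → E, Mem s u →
    (∀ j, Mem s (an j u)) → Mem (s + 1) u ∧
      nsq (s + 1) u ≤ C * (∑ j, nsq s (an j u) + nsq s u) := by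
  obtain ⟨C, hC, hz⟩ := zpow_le_of_comparable s
  refine ⟨C + 1, by positivity, fun u hu han => ?_⟩
  let g : Fin k → (Fin k → ℕ) → ℝ := fun j α => wt α ^ s * (α j * ‖u α‖ ^ 2)
  have hg0 : ∀ j α, 0 ≤ g j α := fun j α => by have := wt_pos α; positivity
  have hsupp : ∀ j, Function.support (g j) ⊆ Set.range (up j) := fun j α hα => by
    rw [mem_range_up]
    intro h
    exact hα (by simp [g, h])
  have hle : ∀ j α, g j (up j α) ≤ C * term s (an j u) α := fun j α => by
    have hw := wt_pos α
    have h1 := hz (wt α + 1) (wt α) (by linarith) hw (by linarith [one_le_wt α]) (by linarith)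
    simp only [g, term, an_apply, norm_smul, wt_up, Complex.norm_real, Real.norm_eq_abs,
      abs_of_nonneg (Real.sqrt_nonneg _), mul_pow, up_same]
    rw [Real.sq_sqrt (by positivity), ← mul_assoc C]
    push_cast
    gcongr
  have hs : ∀ j, Summable (g j ∘ up j) := fun j =>
    Summable.of_nonneg_of_le (fun _ => hg0 _ _) (hle j) ((han j).mul_left C)
  have hsg : ∀ j, Summable (g j) := fun j =>
    ((up_injective j).summable_iff (fun x hx => by
      by_contra h; exact hx (hsupp j h))).1 (hs j)
  have ht : ∀ j, ∑' α, g j α ≤ C * nsq s (an j u) := fun j => by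
    rw [← (up_injective j).tsum_eq (hsupp j), nsq, ← tsum_mul_left]
    exact (hs j).tsum_le_tsum (hle j) ((han j).mul_left C)
  have he : term (s + 1) u = fun α => ∑ j, g j α + term s u α := by
    funext α
    have hd : wt α = 1 + ∑ j, (α j : ℝ) := by simp [wt, deg]
    simp only [g, term, ← Finset.mul_sum, ← Finset.sum_mul]
    rw [zpow_add_one₀ (wt_pos α).ne']
    nth_rewrite 2 [hd]
    ring
  have hS := summable_sum (s := univ) fun j _ => hsg j
  have hm : Mem (s + 1) u := by
    unfold Mem
    rw [he]
    exact hS.add hu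
  refine ⟨hm, ?_⟩
  have h1 : nsq (s + 1) u = ∑ j, ∑' α, g j α + nsq s u := by
    unfold nsq
    rw [he, hS.tsum_add hu, Summable.tsum_finsetSum fun j _ => hsg j]
  have h2 : ∑ j, ∑' α, g j α ≤ C * ∑ j, nsq s (an j u) := by
    rw [Finset.mul_sum]
    exact Finset.sum_le_sum fun j _ => ht j
  have h3 := nsq_nonneg s u
  have h4 : 0 ≤ ∑ j, nsq s (an j u) := Finset.sum_nonneg fun j _ => nsq_nonneg _ _
  have h5 := mul_nonneg hC h3
  rw [h1]
  linarith

/-- Elliptic regularity. -/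
lemma regularity {B : Fin k → E →L[ℂ] E} (hB : Elliptic B) (s : ℕ) : ∃ C : ℝ, 0 ≤ C ∧
    ∀ u, Mem s u → Mem s (dir B u) →
      Mem (s + 1) u ∧ nsq (s + 1) u ≤ C * (nsq s (dir B u) + nsq s u) := by
  induction s with
  | zero => simpa using regularity_zero hB
  | succ s ih =>
    obtain ⟨C, hC, hr⟩ := ih
    choose D hD0 hD using fun j => order_coeffMap (k := k) (B j) s
    choose A hA0 hA using fun j => order_an (E := E) j (s : ℤ)
    obtain ⟨F, hF, hFr⟩ := Mem.of_an (k := k) (E := E) ((s : ℤ) + 1)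
    have key : ∀ j u, Mem (s + 1) u → Mem (s + 1) (dir B u) → Mem (s + 1) (an j u) ∧
        nsq (s + 1) (an j u) ≤ (C * (2 * (A j + D j) + A j)) *
          (nsq (s + 1) (dir B u) + nsq (s + 1) u) := fun j u hu hdu => by
      have e : dir B (an j u) = an j (dir B u) - coeffMap (B j) u := by rw [an_dir]; abel
      have h1 := hA j u hu
      have h2 := hA j _ hdu
      have hus := hu.mono (s := s) (by linarith)
      have h3 := hD j u (by simpa using hus.1)
      have h4 := h2.1.sub h3.1
      rw [← e] at h4
      have h5 := hr _ h1.1 h4.1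
      refine ⟨h5.1, h5.2.trans ?_⟩
      rw [add_zero] at h3
      have n1 := nsq_nonneg (s + 1 : ℤ) u
      have n2 := nsq_nonneg (s + 1 : ℤ) (dir B u)
      rw [mul_assoc]
      refine mul_le_mul_of_nonneg_left ?_ hC
      have q1 := mul_le_mul_of_nonneg_left hus.2 (hD0 j)
      have q2 := mul_nonneg (hD0 j) n2
      have q3 := mul_nonneg (hA0 j) n2
      have q4 := mul_nonneg (hA0 j) n1
      nlinarith
    have hK0 : 0 ≤ ∑ j, C * (2 * (A j + D j) + A j) := Finset.sum_nonneg fun j _ => by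
      have := hA0 j
      have := hD0 j
      positivity
    refine ⟨F * (∑ j, C * (2 * (A j + D j) + A j) + 1), by positivity, fun u hu hdu => ?_⟩
    push_cast at hu hdu ⊢
    have h1 := hFr u hu fun j => (key j u hu hdu).1
    refine ⟨h1.1, h1.2.trans ?_⟩
    rw [mul_assoc]
    refine mul_le_mul_of_nonneg_left ?_ hF
    have h2 : ∑ j, nsq (s + 1) (an j u) ≤ (∑ j, C * (2 * (A j + D j) + A j)) *
        (nsq (s + 1) (dir B u) + nsq (s + 1) u) := by
      rw [Finset.sum_mul]
      exact Finset.sum_le_sum fun j _ => (key j u hu hdu).2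
    have n2 := nsq_nonneg (s + 1 : ℤ) (dir B u)
    linarith

end Regularity

end Fock

namespace Fock

open Finset

section Hilbert

variable {k : ℕ} {E : Type*} [NormedAddCommGroup E] [InnerProductSpace ℂ E] [CompleteSpace E]

open ContinuousLinearMap (adjoint)

lemma ip_add_left_of_mem {s : ℤ} {u u' v : (Fin k → ℕ) → E} (hu : Mem s u) (hu' : Mem s u')
    (hv : Mem (-s) v) : ip (u + u') v = ip u v + ip u' v := by
  unfold ip
  rw [← (summable_inner hu hv).tsum_add (summable_inner hu' hv)]
  exact tsum_congr fun α => inner_add_left _ _ _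

lemma ip_add_right_of_mem {s : ℤ} {u v v' : (Fin k → ℕ) → E} (hu : Mem s u) (hv : Mem (-s) v)
    (hv' : Mem (-s) v') : ip u (v + v') = ip u v + ip u v' := by
  unfold ip
  rw [← (summable_inner hu hv).tsum_add (summable_inner hu hv')]
  exact tsum_congr fun α => inner_add_right _ _ _

lemma ip_sum_left_of_mem {s : ℤ} {ι : Type*} (t : Finset ι) {u : ι → (Fin k → ℕ) → E}
    {v : (Fin k → ℕ) → E} (hu : ∀ i ∈ t, Mem s (u i)) (hv : Mem (-s) v) :
    ip (∑ i ∈ t, u i) v = ∑ i ∈ t, ip (u i) v := by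
  classical
  induction t using Finset.induction_on with
  | empty => simp
  | insert i t hi ih =>
    rw [Finset.sum_insert hi, Finset.sum_insert hi, ip_add_left_of_mem (hu i (by simp))
      (Mem.sum t fun j hj => hu j (by simp [hj])) hv, ih fun j hj => hu j (by simp [hj])]

lemma ip_sum_right_of_mem {s : ℤ} {ι : Type*} (t : Finset ι) {u : ι → (Fin k → ℕ) → E}
    {v : (Fin k → ℕ) → E} (hv : Mem s v) (hu : ∀ i ∈ t, Mem (-s) (u i)) :
    ip v (∑ i ∈ t, u i) = ∑ i ∈ t, ip v (u i) := by
  rw [← ip_conj, ip_sum_left_of_mem t hu (by simpa using hv), map_sum]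
  simp only [ip_conj]

/-- Formal symmetry of the Dirac-type operator. -/
lemma ip_dir (B : Fin k → E →L[ℂ] E) {u w : (Fin k → ℕ) → E} (hu : Mem 1 u) (hw : Mem 0 w) :
    ip (dir B u) w = ip u (dir B w) := by
  have c0 : ∀ (M : E →L[ℂ] E) {s : ℤ} {v : (Fin k → ℕ) → E}, Mem s v → Mem s (coeffMap M v) :=
    fun M s v hv => (order_coeffMap M).mem (by simpa using hv)
  have hcr : ∀ j, Mem 0 (coeffMap (B j) (cr j u)) := fun j => c0 _ ((order_cr j).mem hu)
  have han : ∀ j, Mem 0 (coeffMap (adjoint (B j)) (an j u)) :=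
    fun j => c0 _ ((order_an j).mem hu)
  have hcr' : ∀ j, Mem (-1) (coeffMap (B j) (cr j w)) :=
    fun j => c0 _ ((order_cr j).mem (by simpa using hw))
  have han' : ∀ j, Mem (-1) (coeffMap (adjoint (B j)) (an j w)) :=
    fun j => c0 _ ((order_an j).mem (by simpa using hw))
  rw [dir_apply, dir_apply, dirCr_apply, dirAn_apply, dirCr_apply, dirAn_apply,
    ip_add_left (Mem.sum _ fun j _ => hcr j) (Mem.sum _ fun j _ => han j) hw,
    ip_add_right_of_mem hu (Mem.sum _ fun j _ => hcr' j) (Mem.sum _ fun j _ => han' j),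
    ip_sum_left _ (fun j _ => hcr j) hw, ip_sum_left _ (fun j _ => han j) hw,
    ip_sum_right_of_mem _ hu (fun j _ => hcr' j), ip_sum_right_of_mem _ hu (fun j _ => han' j),
    add_comm]
  congr 1
  · refine Finset.sum_congr rfl fun j _ => ?_
    rw [ip_coeffMap, ContinuousLinearMap.adjoint_adjoint, ip_an, cr_coeffMap]
  · refine Finset.sum_congr rfl fun j _ => ?_
    rw [ip_coeffMap, ip_cr, an_coeffMap]

variable (k E) in
/-- The Hilbert space of square-summable sequences. -/
abbrev Hil := lp (fun _ : Fin k → ℕ => E) 2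

lemma mem_zero_iff {u : (Fin k → ℕ) → E} : Mem 0 u ↔ Memℓp u 2 := by
  rw [memℓp_gen_iff (by norm_num)]
  have h : term 0 u = fun α => ‖u α‖ ^ (2 : ENNReal).toReal := by funext α; simp [term]
  rw [Mem, h]

lemma Hil.mem (v : Hil k E) : Mem 0 (v : (Fin k → ℕ) → E) := mem_zero_iff.2 (lp.memℓp v)

/-- The element of the Hilbert space defined by a sequence. -/
def toHil (u : (Fin k → ℕ) → E) (h : Mem 0 u) : Hil k E := ⟨u, mem_zero_iff.1 h⟩

@[simp] lemma coe_toHil (u : (Fin k → ℕ) → E) (h : Mem 0 u) :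
    (toHil u h : (Fin k → ℕ) → E) = u := rfl

lemma Hil.inner_eq (u v : Hil k E) : inner ℂ u v = ip (u : (Fin k → ℕ) → E) v :=
  lp.inner_eq_tsum u v

lemma Hil.norm_sq (u : Hil k E) : ‖u‖ ^ 2 = nsq 0 (u : (Fin k → ℕ) → E) := by
  have h := inner_self_eq_norm_sq_to_K (𝕜 := ℂ) u
  rw [Hil.inner_eq, ip_self] at h
  have h' : ((nsq 0 (u : (Fin k → ℕ) → E) : ℝ) : ℂ) = ((‖u‖ ^ 2 : ℝ) : ℂ) := by
    rw [h]; simp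
  exact_mod_cast h'.symm

lemma exists_norm_bound {Q : ((Fin k → ℕ) → E) →ₗ[ℂ] ((Fin k → ℕ) → E)} {C : ℝ} (hC : 0 ≤ C)
    (hQ : ∀ u, Mem 0 u → Mem 0 (Q u) ∧ nsq 0 (Q u) ≤ C * nsq 0 u) (v : Hil k E) :
    ‖toHil (Q v) (hQ v (Hil.mem v)).1‖ ≤ Real.sqrt C * ‖v‖ := by
  refine le_of_sq_le_sq ?_ (by positivity)
  rw [mul_pow, Real.sq_sqrt hC, Hil.norm_sq, Hil.norm_sq]
  exact (hQ v (Hil.mem v)).2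

/-- Bounded operators from sequence operators. -/
noncomputable def bdd (Q : ((Fin k → ℕ) → E) →ₗ[ℂ] ((Fin k → ℕ) → E))
    (hQ : ∃ C : ℝ, 0 ≤ C ∧ ∀ u, Mem 0 u → Mem 0 (Q u) ∧ nsq 0 (Q u) ≤ C * nsq 0 u) :
    Hil k E →L[ℂ] Hil k E :=
  LinearMap.mkContinuous
    { toFun := fun v => toHil (Q v) (hQ.choose_spec.2 v (Hil.mem v)).1
      map_add' := fun u v => by ext1; exact map_add Q _ _
      map_smul' := fun c v => by ext1; exact map_smul Q _ _ }
    (Real.sqrt hQ.choose) (fun v => exists_norm_bound hQ.choose_spec.1 hQ.choose_spec.2 v)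

@[simp] lemma coe_bdd (Q : ((Fin k → ℕ) → E) →ₗ[ℂ] ((Fin k → ℕ) → E))
    (hQ : ∃ C : ℝ, 0 ≤ C ∧ ∀ u, Mem 0 u → Mem 0 (Q u) ∧ nsq 0 (Q u) ≤ C * nsq 0 u)
    (v : Hil k E) : (bdd Q hQ v : (Fin k → ℕ) → E) = Q v := rfl

/-- The coercion to sequences as a linear map. -/
def Hil.coeₗ : Hil k E →ₗ[ℂ] ((Fin k → ℕ) → E) where
  toFun v := v
  map_add' _ _ := rfl
  map_smul' _ _ := rfl

@[simp] lemma Hil.coeₗ_apply (v : Hil k E) : Hil.coeₗ v = (v : (Fin k → ℕ) → E) := rfl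

/-- The kernel of the Dirac-type operator. -/
noncomputable def dirKer (B : Fin k → E →L[ℂ] E) : Submodule ℂ (Hil k E) :=
  LinearMap.ker (dir B ∘ₗ Hil.coeₗ)

lemma mem_dirKer {B : Fin k → E →L[ℂ] E} {v : Hil k E} : v ∈ dirKer B ↔ dir B v = 0 := by
  simp [dirKer]

/-- Rapidly decreasing sequences. -/
def Smooth (u : (Fin k → ℕ) → E) : Prop := ∀ s : ℤ, Mem s u

lemma Smooth.of_nat {u : (Fin k → ℕ) → E} (h : ∀ s : ℕ, Mem s u) : Smooth u := fun s =>
  ((h s.toNat).mono (Int.self_le_toNat s)).1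

lemma smooth_of_dir {B : Fin k → E →L[ℂ] E} (hB : Elliptic B) {u : (Fin k → ℕ) → E}
    (hu : Mem 0 u) (hdu : Smooth (dir B u)) : Smooth u := by
  refine Smooth.of_nat fun s => ?_
  induction s with
  | zero => exact hu
  | succ s ih =>
    obtain ⟨C, -, hC⟩ := regularity hB s
    simpa using (hC u ih (hdu s)).1

lemma Smooth.zero : Smooth (0 : (Fin k → ℕ) → E) := fun s => Mem.zero s

lemma dirKer_smooth {B : Fin k → E →L[ℂ] E} (hB : Elliptic B) {v : Hil k E} (hv : v ∈ dirKer B) :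
    Smooth (v : (Fin k → ℕ) → E) :=
  smooth_of_dir hB (Hil.mem v) (by rw [mem_dirKer.1 hv]; exact Smooth.zero)

lemma dirKer_nsq_le {B : Fin k → E →L[ℂ] E} (hB : Elliptic B) (s : ℕ) : ∃ C : ℝ, 0 ≤ C ∧
    ∀ v ∈ dirKer B, nsq s (v : (Fin k → ℕ) → E) ≤ C * nsq 0 (v : (Fin k → ℕ) → E) := by
  induction s with
  | zero => exact ⟨1, by norm_num, fun v _ => by simp⟩
  | succ s ih =>
    obtain ⟨C, hC, h⟩ := ih
    obtain ⟨D, hD, h'⟩ := regularity hB s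
    refine ⟨D * C, by positivity, fun v hv => ?_⟩
    have hs := dirKer_smooth hB hv
    have h1 := (h' v (hs s) (by rw [mem_dirKer.1 hv]; exact Mem.zero s)).2
    rw [mem_dirKer.1 hv, nsq_zero, zero_add] at h1
    push_cast
    rw [mul_assoc]
    exact h1.trans (mul_le_mul_of_nonneg_left (h v hv) hD)

/-- Restriction to low degrees. -/
noncomputable def lowCLM (R : ℕ) : Hil k E →L[ℂ] ({α : Fin k → ℕ // deg α ≤ R} → E) :=
  ContinuousLinearMap.pi fun α => lp.evalCLM ℂ (fun _ : Fin k → ℕ => E) 2 α.1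

lemma lowCLM_apply (R : ℕ) (v : Hil k E) (α : {α : Fin k → ℕ // deg α ≤ R}) :
    lowCLM R v α = v α.1 := rfl

instance (R : ℕ) : Finite {α : Fin k → ℕ // deg α ≤ R} := finite_deg_le R

lemma nsq_one_ge_of_low {R : ℕ} {v : (Fin k → ℕ) → E} (h : ∀ α, deg α ≤ R → v α = 0)
    (hv : Mem 1 v) : ((R : ℝ) + 1) * nsq 0 v ≤ nsq 1 v := by
  unfold nsq
  rw [← tsum_mul_left]
  refine Summable.tsum_le_tsum (fun α => ?_) ((hv.mono (s := 0) (by norm_num)).1.mul_left _) hv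
  by_cases hα : deg α ≤ R
  · simp [term, h α hα]
  · have : (R : ℝ) + 1 ≤ deg α := by exact_mod_cast Nat.lt_of_not_le hα
    simp only [term, zpow_zero, one_mul, zpow_one, wt]
    refine mul_le_mul_of_nonneg_right ?_ (by positivity)
    linarith

lemma eq_zero_of_nsq {v : (Fin k → ℕ) → E} (hv : Mem 0 v) (h : nsq 0 v ≤ 0) : v = 0 := by
  funext α
  have h1 := (term_le_nsq hv α).trans h
  simp only [term, zpow_zero, one_mul] at h1
  have : ‖v α‖ = 0 := by nlinarith [norm_nonneg (v α)]
  simpa using this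

lemma finiteDimensional_dirKer [FiniteDimensional ℂ E] {B : Fin k → E →L[ℂ] E}
    (hB : Elliptic B) : FiniteDimensional ℂ (dirKer B) := by
  obtain ⟨C, hC, h⟩ := dirKer_nsq_le hB 1
  obtain ⟨R, hR⟩ := exists_nat_gt C
  have := Fintype.ofFinite {α : Fin k → ℕ // deg α ≤ R}
  refine FiniteDimensional.of_injective
    ((lowCLM (k := k) (E := E) R).toLinearMap ∘ₗ (dirKer B).subtype) ?_
  rw [← LinearMap.ker_eq_bot, LinearMap.ker_eq_bot']
  rintro ⟨v, hv⟩ hv0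
  have hlow : ∀ α, deg α ≤ R → (v : (Fin k → ℕ) → E) α = 0 := fun α hα =>
    congrFun hv0 ⟨α, hα⟩
  have h1 := nsq_one_ge_of_low hlow (dirKer_smooth hB hv 1)
  have h2 := h v hv
  have h3 := nsq_nonneg 0 (v : (Fin k → ℕ) → E)
  have h4 : nsq 0 (v : (Fin k → ℕ) → E) ≤ 0 := by
    by_contra hc
    push Not at hc
    have : C * nsq 0 (v : (Fin k → ℕ) → E) < ((R : ℝ) + 1) * nsq 0 (v : (Fin k → ℕ) → E) := by
      gcongr; linarith
    push_cast at h2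
    linarith
  have := eq_zero_of_nsq (Hil.mem v) h4
  ext1
  ext1
  exact this

end Hilbert

section Solve

variable {k : ℕ} {E : Type*} [NormedAddCommGroup E] [InnerProductSpace ℂ E]
  [CompleteSpace E] [FiniteDimensional ℂ E]

/-- The inverse square root of the weight. -/
noncomputable def lam : ((Fin k → ℕ) → E) →ₗ[ℂ] ((Fin k → ℕ) → E) :=
  dg fun α => (Real.sqrt (wt α))⁻¹

lemma term_lam (v : (Fin k → ℕ) → E) : term 1 (lam v) = term 0 v := by
  funext α
  have := wt_pos α
  rw [lam, term_dg, inv_pow, Real.sq_sqrt this.le]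
  simp only [term, zpow_one, zpow_zero, one_mul]
  field_simp

lemma mem_lam {v : (Fin k → ℕ) → E} (hv : Mem 0 v) : Mem 1 (lam v) := by
  unfold Mem; rw [term_lam]; exact hv

lemma nsq_lam (v : (Fin k → ℕ) → E) : nsq 1 (lam v) = nsq 0 v := by
  unfold nsq; rw [term_lam]

lemma exists_lam {u : (Fin k → ℕ) → E} (hu : Mem 1 u) :
    ∃ v, Mem 0 v ∧ lam v = u := by
  have h : lam (dg (fun α => Real.sqrt (wt α)) u) = u := by
    funext α
    have := Real.sqrt_pos.2 (wt_pos α)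
    rw [lam, dg_apply, dg_apply, smul_smul, ← Complex.ofReal_mul, inv_mul_cancel₀ this.ne']
    simp
  refine ⟨_, ?_, h⟩
  unfold Mem
  rw [← term_lam, h]
  exact hu

lemma lam_bound : ∃ C : ℝ, 0 ≤ C ∧ ∀ u : (Fin k → ℕ) → E, Mem 0 u →
    Mem 0 (lam u) ∧ nsq 0 (lam u) ≤ C * nsq 0 u :=
  ⟨1, by norm_num, fun u hu => by
    have := (mem_lam hu).mono (s := 0) (by norm_num)
    rw [nsq_lam] at this
    simpa using this⟩

lemma dir_lam_bound (B : Fin k → E →L[ℂ] E) : ∃ C : ℝ, 0 ≤ C ∧ ∀ u, Mem 0 u →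
    Mem 0 ((dir B ∘ₗ lam) u) ∧ nsq 0 ((dir B ∘ₗ lam) u) ≤ C * nsq 0 u := by
  obtain ⟨C, hC, h⟩ := order_dir B 0
  refine ⟨C, hC, fun u hu => ?_⟩
  have := h (lam u) (by simpa using mem_lam hu)
  simpa [nsq_lam] using this

/-- The bounded realisation of the perturbed Dirac-type operator. -/
noncomputable def pert (B : Fin k → E →L[ℂ] E) [(dirKer B).HasOrthogonalProjection] :
    Hil k E →L[ℂ] Hil k E :=
  bdd _ (dir_lam_bound B) + (dirKer B).starProjection ∘L bdd _ lam_bound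

lemma coe_pert (B : Fin k → E →L[ℂ] E) [(dirKer B).HasOrthogonalProjection] (v : Hil k E) :
    (pert B v : (Fin k → ℕ) → E) = dir B (lam v) +
      ((dirKer B).starProjection (bdd _ lam_bound v) : Hil k E) := rfl

variable {B : Fin k → E →L[ℂ] E} [(dirKer B).HasOrthogonalProjection]

lemma Hil.norm_starProjection_le (v : Hil k E) : ‖(dirKer B).starProjection v‖ ≤ ‖v‖ := by
  simpa using ((dirKer B).starProjection.le_of_opNorm_le (dirKer B).starProjection_norm_le v)

lemma ip_dir_dirKer {u : (Fin k → ℕ) → E} (hu : Mem 1 u) (w : dirKer B) :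
    ip (dir B u) (w.1 : (Fin k → ℕ) → E) = 0 := by
  rw [ip_dir B hu (Hil.mem w.1), mem_dirKer.1 w.2, ip_zero_right]

/-- If `𝔇u + Pu'` vanishes then both summands vanish. -/
lemma eq_zero_of_pert_eq_zero {u : (Fin k → ℕ) → E} (hu : Mem 1 u) {w : Hil k E}
    (hw : w ∈ dirKer B) (h : dir B u + w = 0) : dir B u = 0 ∧ w = 0 := by
  have h1 := ip_dir_dirKer hu ⟨w, hw⟩
  have h2 : dir B u = (-w : Hil k E) := by rw [eq_neg_of_add_eq_zero_left h]; rfl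
  rw [h2, ← Hil.inner_eq, inner_neg_left, neg_eq_zero, inner_self_eq_zero] at h1
  rw [h2, h1, neg_zero]
  exact ⟨rfl, rfl⟩

lemma pert_injective (B : Fin k → E →L[ℂ] E) [(dirKer B).HasOrthogonalProjection] :
    Function.Injective (pert B) := by
  rw [injective_iff_map_eq_zero]
  intro v hv
  have h0 : dir B (lam v) + ((dirKer B).starProjection (bdd _ lam_bound v) : Hil k E) =
      (0 : (Fin k → ℕ) → E) := by rw [← coe_pert, hv]; rfl
  have h1 := eq_zero_of_pert_eq_zero (mem_lam (Hil.mem v)) (Submodule.starProjection_apply_mem _ _) h0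
  have h2 : bdd _ lam_bound v ∈ dirKer B := mem_dirKer.2 h1.1
  rw [(dirKer B).starProjection_eq_self_iff.2 h2] at h1
  have h3 : lam (v : (Fin k → ℕ) → E) = 0 := by rw [← coe_bdd lam lam_bound, h1.2]; rfl
  have h4 : nsq 0 (v : (Fin k → ℕ) → E) ≤ 0 := by rw [← nsq_lam, h3, nsq_zero]
  ext1
  exact eq_zero_of_nsq (Hil.mem v) h4

lemma pert_estimate (hB : Elliptic B) : ∃ C : ℝ, 0 < C ∧ ∀ v : Hil k E,
    ‖v‖ ^ 2 ≤ C * (‖pert B v‖ ^ 2 + ‖bdd _ lam_bound v‖ ^ 2) := by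
  obtain ⟨C, hC, h⟩ := regularity_zero hB
  refine ⟨3 * C + 1, by positivity, fun v => ?_⟩
  have h1 := (h _ (Hil.mem (bdd lam lam_bound v)) (Hil.mem (bdd _ (dir_lam_bound B) v))).2
  rw [coe_bdd, nsq_lam, ← Hil.norm_sq, ← coe_bdd lam lam_bound, ← Hil.norm_sq] at h1
  have h2 : nsq 0 (dir B (bdd lam lam_bound v : Hil k E)) = ‖bdd _ (dir_lam_bound B) v‖ ^ 2 := by
    rw [Hil.norm_sq]; rfl
  rw [h2] at h1
  have h3 : bdd _ (dir_lam_bound B) v = pert B v +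
      -((dirKer B).starProjection (bdd _ lam_bound v)) := by
    simp [pert]
  have h4 := norm_add_sq_le (pert B v) (-((dirKer B).starProjection (bdd _ lam_bound v)))
  rw [← h3, norm_neg] at h4
  have h5 := Hil.norm_starProjection_le (B := B) (bdd _ lam_bound v)
  have h6 : ‖(dirKer B).starProjection (bdd lam lam_bound v)‖ ^ 2 ≤ ‖bdd lam lam_bound v‖ ^ 2 := by
    gcongr
  have h7 := norm_nonneg (pert B v)
  have h8 : C * (‖bdd _ (dir_lam_bound B) v‖ ^ 2 + ‖bdd lam lam_bound v‖ ^ 2) ≤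
      C * (2 * (‖pert B v‖ ^ 2 + ‖bdd lam lam_bound v‖ ^ 2) + ‖bdd lam lam_bound v‖ ^ 2) := by
    gcongr
    linarith
  nlinarith [sq_nonneg ‖pert B v‖, sq_nonneg ‖bdd lam lam_bound v‖,
    mul_nonneg hC (sq_nonneg ‖pert B v‖)]

end Solve

end Fock

namespace Fock

open Finset

section Invert

variable {k : ℕ} {E : Type*} [NormedAddCommGroup E] [InnerProductSpace ℂ E]
  [CompleteSpace E] [FiniteDimensional ℂ E]
  {B : Fin k → E →L[ℂ] E} [(dirKer B).HasOrthogonalProjection]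

lemma norm_lam_le_of_low {R : ℕ} {v : Hil k E} (h : lowCLM R v = 0) :
    ((R : ℝ) + 1) * ‖bdd (k := k) (E := E) lam lam_bound v‖ ^ 2 ≤ ‖v‖ ^ 2 := by
  rw [Hil.norm_sq, Hil.norm_sq, coe_bdd, ← nsq_lam (v : (Fin k → ℕ) → E)]
  refine nsq_one_ge_of_low (fun α hα => ?_) (mem_lam (Hil.mem v))
  have := congrFun h ⟨α, hα⟩
  rw [lowCLM_apply] at this
  rw [lam, dg_apply, this]
  simp

lemma isClosed_range_pert (hB : Elliptic B) : IsClosed (Set.range (pert B)) := by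
  obtain ⟨C, hC, h⟩ := pert_estimate hB
  obtain ⟨R, hR⟩ := exists_nat_gt (2 * C)
  have := Fintype.ofFinite {α : Fin k → ℕ // deg α ≤ R}
  set W : Submodule ℂ (Hil k E) := LinearMap.ker (lowCLM (k := k) (E := E) R).toLinearMap with hW
  have hWc : IsClosed (W : Set (Hil k E)) := (lowCLM (k := k) (E := E) R).isClosed_ker
  have : W.CoFG := Submodule.CoFG.ker _
  have hcomp : CompleteSpace W := hWc.completeSpace_coe
  have hbound : ∀ v : W, ‖v‖ ≤ (Real.sqrt (2 * C)).toNNReal * ‖(pert B ∘L W.subtypeL) v‖ := by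
    intro v
    refine le_of_sq_le_sq ?_ (by positivity)
    rw [mul_pow, Real.coe_toNNReal _ (Real.sqrt_nonneg _), Real.sq_sqrt (by positivity)]
    have h1 := h v.1
    have h2 := norm_lam_le_of_low (v := v.1) (R := R) v.2
    have h3 : 2 * C * ‖bdd (k := k) (E := E) lam lam_bound v.1‖ ^ 2 ≤ ‖v.1‖ ^ 2 :=
      (mul_le_mul_of_nonneg_right (by linarith) (by positivity)).trans h2
    have h4 : ‖v‖ = ‖v.1‖ := rfl
    have h5 : (pert B ∘L W.subtypeL) v = pert B v.1 := rfl
    rw [h4, h5]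
    linarith
  have hanti := (pert B ∘L W.subtypeL).antilipschitz_of_bound hbound
  have hcl : IsClosed (Set.range (pert B ∘L W.subtypeL)) :=
    hanti.isClosed_range (pert B ∘L W.subtypeL).uniformContinuous
  have hmap : IsClosed ((W.map (pert B).toLinearMap : Submodule ℂ (Hil k E)) : Set (Hil k E)) := by
    convert hcl using 1
    ext x
    simp
  have := LinearMap.isClosed_range_of_isClosed_map_of_finiteDimensional_quotient hmap
  exact this

lemma ip_single (α : Fin k → ℕ) (e : E) (f : (Fin k → ℕ) → E) :
    ip (Pi.single α e) f = inner ℂ e (f α) := by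
  unfold ip
  rw [tsum_eq_single α]
  · simp
  · intro β hβ
    simp [Pi.single_eq_of_ne hβ]

lemma finSupp_single (α : Fin k → ℕ) (e : E) : FinSupp (Pi.single α e) :=
  (Set.finite_singleton α).subset Pi.support_single_subset

lemma pert_apply_of_lam {v : Hil k E} {u : (Fin k → ℕ) → E} (hu : Mem 0 u)
    (h : lam (v : (Fin k → ℕ) → E) = u) : (pert B v : (Fin k → ℕ) → E) =
      dir B u + ((dirKer B).starProjection (toHil u hu) : Hil k E) := by
  rw [coe_pert]
  subst h
  rfl

lemma pert_surjective (hB : Elliptic B) : Function.Surjective (pert B) := by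
  have hcl := isClosed_range_pert hB
  set W : Submodule ℂ (Hil k E) := LinearMap.range (pert B).toLinearMap with hW
  have hWs : (W : Set (Hil k E)) = Set.range (pert B) := rfl
  have hWc : W.topologicalClosure = W := IsClosed.submodule_topologicalClosure_eq (by rwa [hWs])
  have hperp : Wᗮ = ⊥ := by
    rw [Submodule.eq_bot_iff]
    intro w hw
    have hin : ∀ v, inner ℂ (pert B v) w = 0 := fun v =>
      (Submodule.mem_orthogonal W w).1 hw _ ⟨v, rfl⟩
    set pw : Hil k E := (dirKer B).starProjection w with hpw
    have key : dir B (w : (Fin k → ℕ) → E) + pw = 0 := by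
      funext α
      refine ext_inner_left ℂ fun e => ?_
      rw [Pi.zero_apply, inner_zero_right, ← ip_single]
      have hf := finSupp_single (k := k) α e
      set u : (Fin k → ℕ) → E := Pi.single α e
      obtain ⟨v, hv, hvu⟩ := exists_lam (hf.mem 1)
      have h1 := hin (toHil v hv)
      have h2 := pert_apply_of_lam (B := B) (v := toHil v hv) (hf.mem 0) hvu
      rw [Hil.inner_eq, h2, ip_add_left ((order_dir B).mem (hf.mem _)) (Hil.mem _) (Hil.mem w),
        ip_dir B (hf.mem 1) (Hil.mem w), ← Hil.inner_eq,
        Submodule.inner_starProjection_left_eq_right, Hil.inner_eq, coe_toHil] at h1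
      rw [ip_add_right_of_mem (s := 1) (hf.mem 1) ((order_dir B).mem (by simpa using Hil.mem w))
        ((Hil.mem pw).mono (by norm_num)).1]
      exact h1
    have hsm : Smooth (dir B (w : (Fin k → ℕ) → E)) := fun s => by
      rw [eq_neg_of_add_eq_zero_left key]
      exact (Mem.neg (dirKer_smooth hB (Submodule.starProjection_apply_mem _ _) s)).1
    have hws : Smooth (w : (Fin k → ℕ) → E) := smooth_of_dir hB (Hil.mem w) hsm
    obtain ⟨h1, h2⟩ := eq_zero_of_pert_eq_zero (hws 1)
      (Submodule.starProjection_apply_mem _ _) key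
    rw [(dirKer B).starProjection_eq_self_iff.2 (mem_dirKer.2 h1)] at h2
    exact h2
  have htop := (Submodule.topologicalClosure_eq_top_iff (K := W)).2 hperp
  rw [hWc] at htop
  exact LinearMap.range_eq_top.1 htop

lemma exists_nsq_le (hB : Elliptic B) : ∃ C : ℝ, 0 ≤ C ∧ ∀ (u : (Fin k → ℕ) → E) (_ : Mem 1 u)
    (hu : Mem 0 u), nsq 1 u ≤
      C * nsq 0 (dir B u + (((dirKer B).starProjection (toHil u hu) : Hil k E) : (Fin k → ℕ) → E)) := by
  obtain ⟨K, hK⟩ := (pert B).antilipschitz_of_injective_of_isClosed_range (pert_injective B)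
    (isClosed_range_pert hB)
  refine ⟨(K : ℝ) ^ 2, by positivity, fun u hu1 hu => ?_⟩
  obtain ⟨v, hv, hvu⟩ := exists_lam hu1
  have h1 := hK.le_mul_dist (toHil v hv) 0
  rw [map_zero, dist_zero_right, dist_zero_right] at h1
  rw [← pert_apply_of_lam (v := toHil v hv) hu hvu, ← Hil.norm_sq, ← hvu, nsq_lam, ← mul_pow]
  calc nsq 0 v = ‖toHil v hv‖ ^ 2 := by rw [Hil.norm_sq]; rfl
    _ ≤ _ := by gcongr

variable (k E) in
/-- The space of rapidly decreasing sequences. -/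
def Sm : Submodule ℂ ((Fin k → ℕ) → E) where
  carrier := {u | Smooth u}
  add_mem' := fun hu hv s => ((hu s).add (hv s)).1
  zero_mem' := Smooth.zero
  smul_mem' := fun c _ hu s => ((hu s).smul c).1

instance : AddCommGroup (Sm k E) := Submodule.addCommGroup _

instance : AddCommMonoid (Sm k E) := AddCommGroup.toAddCommMonoid

instance : Module ℂ (Sm k E) := Submodule.module _

lemma Sm.mem (u : Sm k E) (s : ℤ) : Mem s (u : (Fin k → ℕ) → E) := u.2 s

/-- Operators of finite order act on rapidly decreasing sequences. -/
def Order.op {r : ℤ} {T : ((Fin k → ℕ) → E) →ₗ[ℂ] ((Fin k → ℕ) → E)} (hT : Order r T) :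
    Module.End ℂ (Sm k E) :=
  T.restrict fun _ hu _ => hT.mem (hu _)

@[simp] lemma Order.coe_op {r : ℤ} {T : ((Fin k → ℕ) → E) →ₗ[ℂ] ((Fin k → ℕ) → E)}
    (hT : Order r T) (u : Sm k E) : (hT.op u : (Fin k → ℕ) → E) = T u := rfl

/-- Inclusion of rapidly decreasing sequences into the Hilbert space. -/
def Sm.toHilₗ : Sm k E →ₗ[ℂ] Hil k E where
  toFun u := toHil u (u.mem 0)
  map_add' _ _ := rfl
  map_smul' _ _ := rfl

@[simp] lemma Sm.coe_toHilₗ (u : Sm k E) : (Sm.toHilₗ u : (Fin k → ℕ) → E) = u := rfl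

/-- The projection onto the kernel, acting on rapidly decreasing sequences. -/
noncomputable def kerProj (hB : Elliptic B) : Module.End ℂ (Sm k E) where
  toFun u := ⟨((dirKer B).starProjection (Sm.toHilₗ u) : Hil k E),
    dirKer_smooth hB (Submodule.starProjection_apply_mem _ _)⟩
  map_add' u v := by ext1; simp only [map_add]; rfl
  map_smul' c v := by ext1; simp only [map_smul]; rfl

lemma coe_kerProj (hB : Elliptic B) (u : Sm k E) : (kerProj hB u : (Fin k → ℕ) → E) =
    ((dirKer B).starProjection (Sm.toHilₗ u) : Hil k E) := rfl

lemma toHil_kerProj (hB : Elliptic B) (u : Sm k E) :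
    Sm.toHilₗ (kerProj hB u) = (dirKer B).starProjection (Sm.toHilₗ u) := rfl

/-- The Dirac-type operator on rapidly decreasing sequences. -/
noncomputable def dirS (B : Fin k → E →L[ℂ] E) : Module.End ℂ (Sm k E) := (order_dir B).op

@[simp] lemma coe_dirS (u : Sm k E) : (dirS B u : (Fin k → ℕ) → E) = dir B u := rfl

lemma dirS_mul_kerProj (hB : Elliptic B) : dirS B * kerProj hB = 0 := by
  ext1 u
  ext1
  exact mem_dirKer.1 (Submodule.starProjection_apply_mem _ _)

lemma kerProj_mul_dirS (hB : Elliptic B) : kerProj hB * dirS B = 0 := by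
  ext1 u
  ext1
  rw [Module.End.mul_apply, coe_kerProj,
    (dirKer B).starProjection_apply_eq_zero_iff.2]
  · rfl
  · rw [Submodule.mem_orthogonal']
    intro w hw
    rw [Hil.inner_eq]
    exact ip_dir_dirKer (u.mem 1) ⟨w, hw⟩

lemma kerProj_mul_self (hB : Elliptic B) : kerProj hB * kerProj hB = kerProj hB := by
  ext1 u
  ext1
  rw [Module.End.mul_apply, coe_kerProj, toHil_kerProj,
    (dirKer B).starProjection_eq_self_iff.2 (Submodule.starProjection_apply_mem _ _)]
  rfl

/-- The perturbed Dirac-type operator on rapidly decreasing sequences. -/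
noncomputable def dirP (hB : Elliptic B) : Module.End ℂ (Sm k E) := dirS B + kerProj hB

lemma coe_dirP (hB : Elliptic B) (u : Sm k E) : (dirP hB u : (Fin k → ℕ) → E) =
    dir B u + ((dirKer B).starProjection (toHil u (u.mem 0)) : Hil k E) := rfl

lemma nsq_kerProj_le (hB : Elliptic B) (s t : ℤ) : ∃ C : ℝ, 0 ≤ C ∧ ∀ u : Sm k E,
    nsq s (kerProj hB u : (Fin k → ℕ) → E) ≤ C * nsq (max 0 t) (u : (Fin k → ℕ) → E) := by
  obtain ⟨C, hC, h⟩ := dirKer_nsq_le hB s.toNat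
  refine ⟨C, hC, fun u => ?_⟩
  have hm : (dirKer B).starProjection (Sm.toHilₗ u) ∈ dirKer B :=
    Submodule.starProjection_apply_mem _ _
  have h1 := h _ hm
  have h2 := ((kerProj hB u).mem s.toNat).mono (Int.self_le_toNat s)
  rw [← Hil.norm_sq] at h1
  have h3 := Hil.norm_starProjection_le (B := B) (Sm.toHilₗ u)
  have h4 : ‖(dirKer B).starProjection (Sm.toHilₗ u)‖ ^ 2 ≤ ‖Sm.toHilₗ u‖ ^ 2 := by gcongr
  rw [Hil.norm_sq (Sm.toHilₗ u)] at h4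
  have h5 := ((u.mem (max 0 t)).mono (le_max_left 0 t)).2
  refine h2.2.trans (h1.trans (mul_le_mul_of_nonneg_left (h4.trans ?_) hC))
  exact h5

lemma dirP_bijective (hB : Elliptic B) : Function.Bijective (dirP hB) := by
  constructor
  · rw [injective_iff_map_eq_zero]
    intro u hu
    obtain ⟨C, -, h⟩ := exists_nsq_le hB
    have h1 := h u (u.mem 1) (u.mem 0)
    rw [← coe_dirP hB, hu] at h1
    have h2 : nsq 0 (u : (Fin k → ℕ) → E) ≤ 0 := by
      refine ((u.mem 1).mono (by norm_num)).2.trans (h1.trans (le_of_eq ?_))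
      rw [Submodule.coe_zero, nsq_zero, mul_zero]
    ext1
    exact eq_zero_of_nsq (u.mem 0) h2
  · intro f
    obtain ⟨v, hv⟩ := pert_surjective hB (Sm.toHilₗ f)
    have hm1 := mem_lam (Hil.mem v)
    have hm0 := (hm1.mono (s := 0) (by norm_num)).1
    have h1 := pert_apply_of_lam (B := B) (v := v) hm0 rfl
    rw [hv, Sm.coe_toHilₗ] at h1
    have hsm : Smooth (lam (v : (Fin k → ℕ) → E)) := by
      refine smooth_of_dir hB hm0 fun s => ?_
      rw [← sub_eq_of_eq_add h1]
      exact (Mem.sub (f.mem s)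
        (dirKer_smooth hB (Submodule.starProjection_apply_mem _ _) s)).1
    refine ⟨⟨_, hsm⟩, ?_⟩
    ext1
    exact h1.symm

lemma nsq_le_dirP (hB : Elliptic B) (s : ℕ) : ∃ C : ℝ, 0 ≤ C ∧ ∀ u : Sm k E,
    nsq (s + 1) (u : (Fin k → ℕ) → E) ≤ C * nsq s (dirP hB u : (Fin k → ℕ) → E) := by
  induction s with
  | zero =>
    obtain ⟨C, hC, h⟩ := exists_nsq_le hB
    refine ⟨C, hC, fun u => ?_⟩
    have := h u (u.mem 1) (u.mem 0)
    rw [← coe_dirP hB] at this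
    simpa using this
  | succ s ih =>
    obtain ⟨C, hC, h⟩ := ih
    obtain ⟨D, hD, h'⟩ := regularity hB (s + 1)
    obtain ⟨F, hF, h''⟩ := nsq_kerProj_le hB (s + 1) 0
    refine ⟨D * (2 * (1 + F * C) + C), by positivity, fun u => ?_⟩
    have h1 := (h' u (u.mem _) ((dirS B u).mem _)).2
    have h2 := h u
    have h3 := h'' u
    have e1 : dir B (u : (Fin k → ℕ) → E) = (dirP hB u : (Fin k → ℕ) → E) -
        (kerProj hB u : (Fin k → ℕ) → E) := by
      rw [coe_dirP, coe_kerProj]; exact (add_sub_cancel_right _ _).symm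
    have h4 := (Mem.sub ((dirP hB u).mem (s + 1)) ((kerProj hB u).mem (s + 1))).2
    rw [← e1] at h4
    have h5 := (((dirP hB u).mem (s + 1)).mono (s := s) (by linarith)).2
    have h6 : nsq 0 (u : (Fin k → ℕ) → E) ≤ nsq (s + 1) (u : (Fin k → ℕ) → E) :=
      ((u.mem _).mono (by positivity)).2
    simp only [max_self] at h3
    push_cast at h1 ⊢
    have hn := nsq_nonneg (s + 1) (dirP hB u : (Fin k → ℕ) → E)
    set X := nsq (s + 1) (dirP hB u : (Fin k → ℕ) → E)
    have h7 : nsq (s + 1) (u : (Fin k → ℕ) → E) ≤ C * X :=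
      h2.trans (mul_le_mul_of_nonneg_left h5 hC)
    have h8 : nsq (s + 1) (kerProj hB u : (Fin k → ℕ) → E) ≤ F * (C * X) :=
      h3.trans (mul_le_mul_of_nonneg_left (h6.trans h7) hF)
    refine h1.trans ?_
    rw [mul_assoc]
    refine mul_le_mul_of_nonneg_left ?_ hD
    linarith

/-- The inverse of the perturbed Dirac-type operator. -/
noncomputable def inv (hB : Elliptic B) : Module.End ℂ (Sm k E) :=
  (LinearEquiv.ofBijective (dirP hB) (dirP_bijective hB)).symm.toLinearMap

lemma dirP_mul_inv (hB : Elliptic B) : dirP hB * inv hB = 1 := by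
  ext1 u
  exact LinearEquiv.apply_symm_apply (LinearEquiv.ofBijective (dirP hB) (dirP_bijective hB)) u

lemma inv_mul_dirP (hB : Elliptic B) : inv hB * dirP hB = 1 := by
  ext1 u
  exact LinearEquiv.symm_apply_apply (LinearEquiv.ofBijective (dirP hB) (dirP_bijective hB)) u

lemma nsq_inv_le (hB : Elliptic B) (s : ℕ) : ∃ C : ℝ, 0 ≤ C ∧ ∀ u : Sm k E,
    nsq (s + 1) (inv hB u : (Fin k → ℕ) → E) ≤ C * nsq s (u : (Fin k → ℕ) → E) := by
  obtain ⟨C, hC, h⟩ := nsq_le_dirP hB s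
  refine ⟨C, hC, fun u => ?_⟩
  have := h (inv hB u)
  rwa [← Module.End.mul_apply, dirP_mul_inv, Module.End.one_apply] at this

lemma kerProj_mul_inv (hB : Elliptic B) : kerProj hB * inv hB = kerProj hB := by
  have h : kerProj hB * dirP hB = kerProj hB := by
    rw [dirP, mul_add, kerProj_mul_dirS, kerProj_mul_self, zero_add]
  calc kerProj hB * inv hB = kerProj hB * dirP hB * inv hB := by rw [h]
    _ = kerProj hB := by rw [mul_assoc, dirP_mul_inv, mul_one]

lemma inv_mul_kerProj (hB : Elliptic B) : inv hB * kerProj hB = kerProj hB := by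
  have h : dirP hB * kerProj hB = kerProj hB := by
    rw [dirP, add_mul, dirS_mul_kerProj, kerProj_mul_self, zero_add]
  calc inv hB * kerProj hB = inv hB * (dirP hB * kerProj hB) := by rw [h]
    _ = kerProj hB := by rw [← mul_assoc, inv_mul_dirP, one_mul]

lemma dirS_mul_inv (hB : Elliptic B) : dirS B * inv hB = 1 - kerProj hB := by
  have h := dirP_mul_inv hB
  rw [dirP, add_mul, kerProj_mul_inv] at h
  rw [← h, add_sub_cancel_right]

lemma inv_mul_dirS (hB : Elliptic B) : inv hB * dirS B = 1 - kerProj hB := by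
  have h := inv_mul_dirP hB
  rw [dirP, mul_add, inv_mul_kerProj] at h
  rw [← h, add_sub_cancel_right]

end Invert

end Fock

namespace Fock

open Finset

section Calculus

variable {k : ℕ} {E : Type*} [NormedAddCommGroup E] [InnerProductSpace ℂ E]
  [CompleteSpace E] [FiniteDimensional ℂ E]

variable (k E) in
/-- Linear operators on rapidly decreasing sequences. -/
abbrev Op := Module.End ℂ (Sm k E)

/-- Annihilation operators. -/
noncomputable def anS (j : Fin k) : Op k E := (order_an j).op

/-- Creation operators. -/
noncomputable def crS (j : Fin k) : Op k E := (order_cr j).op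

/-- Constant coefficient operators. -/
noncomputable def coeffS (M : E →L[ℂ] E) : Op k E := (order_coeffMap M).op

@[simp] lemma coe_anS (j : Fin k) (u : Sm k E) : (anS j u : (Fin k → ℕ) → E) = an j u := rfl

@[simp] lemma coe_crS (j : Fin k) (u : Sm k E) : (crS j u : (Fin k → ℕ) → E) = cr j u := rfl

@[simp] lemma coe_coeffS (M : E →L[ℂ] E) (u : Sm k E) :
    (coeffS M u : (Fin k → ℕ) → E) = coeffMap M u := rfl

/-- The generators of the Weyl algebra. -/
noncomputable def gen : Fin k ⊕ Fin k → Op k E := Sum.elim anS crS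

/-- Operators of order `r` on high regularity. -/
def Ord (r : ℤ) (T : Op k E) : Prop :=
  ∃ s₀ : ℤ, ∀ s ≥ s₀, ∃ C : ℝ, 0 ≤ C ∧ ∀ u : Sm k E,
    nsq s (T u : (Fin k → ℕ) → E) ≤ C * nsq (s + r) (u : (Fin k → ℕ) → E)

lemma Order.ord {r : ℤ} {T : ((Fin k → ℕ) → E) →ₗ[ℂ] ((Fin k → ℕ) → E)} (hT : Order r T) :
    Ord r hT.op :=
  ⟨0, fun s _ => by
    obtain ⟨C, hC, h⟩ := hT s
    exact ⟨C, hC, fun u => (h u (u.mem _)).2⟩⟩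

lemma Ord.mono {r r' : ℤ} (h : r ≤ r') {T : Op k E} (hT : Ord r T) : Ord r' T := by
  obtain ⟨s₀, hT⟩ := hT
  refine ⟨s₀, fun s hs => ?_⟩
  obtain ⟨C, hC, hT⟩ := hT s hs
  exact ⟨C, hC, fun u => (hT u).trans (mul_le_mul_of_nonneg_left
    ((u.mem (s + r')).mono (by linarith)).2 hC)⟩

lemma Ord.add {r : ℤ} {T U : Op k E} (hT : Ord r T) (hU : Ord r U) : Ord r (T + U) := by
  obtain ⟨s₀, hT⟩ := hT
  obtain ⟨s₁, hU⟩ := hU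
  refine ⟨max s₀ s₁, fun s hs => ?_⟩
  obtain ⟨C, hC, hT⟩ := hT s ((le_max_left _ _).trans hs)
  obtain ⟨D, hD, hU⟩ := hU s ((le_max_right _ _).trans hs)
  refine ⟨2 * (C + D), by positivity, fun u => ?_⟩
  have h1 := (((T u).mem s).add ((U u).mem s)).2
  have h2 := hT u
  have h3 := hU u
  rw [LinearMap.add_apply, Submodule.coe_add]
  linarith

lemma Ord.neg {r : ℤ} {T : Op k E} (hT : Ord r T) : Ord r (-T) := by
  obtain ⟨s₀, hT⟩ := hT
  refine ⟨s₀, fun s hs => ?_⟩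
  obtain ⟨C, hC, hT⟩ := hT s hs
  refine ⟨C, hC, fun u => ?_⟩
  rw [LinearMap.neg_apply, Submodule.coe_neg, ((T u).mem s).neg.2]
  exact hT u

lemma Ord.sub {r : ℤ} {T U : Op k E} (hT : Ord r T) (hU : Ord r U) : Ord r (T - U) := by
  rw [sub_eq_add_neg]; exact hT.add hU.neg

lemma Ord.zero (r : ℤ) : Ord r (0 : Op k E) :=
  ⟨0, fun s _ => ⟨0, le_rfl, fun u => by simp⟩⟩

lemma Ord.one : Ord 0 (1 : Op k E) :=
  ⟨0, fun s _ => ⟨1, zero_le_one, fun u => by simp⟩⟩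

lemma Ord.mul {r r' : ℤ} {T U : Op k E} (hT : Ord r T) (hU : Ord r' U) :
    Ord (r + r') (T * U) := by
  obtain ⟨s₀, hT⟩ := hT
  obtain ⟨s₁, hU⟩ := hU
  refine ⟨max s₀ (s₁ - r), fun s hs => ?_⟩
  obtain ⟨C, hC, hT⟩ := hT s ((le_max_left _ _).trans hs)
  obtain ⟨D, hD, hU⟩ := hU (s + r) (by have := (le_max_right _ _).trans hs; linarith)
  refine ⟨C * D, by positivity, fun u => ?_⟩
  rw [Module.End.mul_apply, mul_assoc, ← add_assoc]
  exact (hT (U u)).trans (mul_le_mul_of_nonneg_left (hU u) hC)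

lemma ord_gen (i : Fin k ⊕ Fin k) : Ord 1 (gen i : Op k E) := by
  rcases i with j | j
  · exact (order_an j).ord
  · exact (order_cr j).ord

/-- Symbol classes: commutators with the generators lower the order, `d` times. -/
def Sym : ℕ → ℤ → Op k E → Prop
  | 0, r, T => Ord r T
  | d + 1, r, T => Ord r T ∧ ∀ i, Sym d (r - 1) ⁅T, gen i⁆

lemma Sym.ord {d : ℕ} {r : ℤ} {T : Op k E} (h : Sym d r T) : Ord r T := by
  cases d with
  | zero => exact h
  | succ d => exact h.1

lemma Sym.pred {d : ℕ} {r : ℤ} {T : Op k E} (h : Sym (d + 1) r T) : Sym d r T := by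
  induction d generalizing r T with
  | zero => exact h.1
  | succ d ih => exact ⟨h.1, fun i => ih (h.2 i)⟩

lemma Sym.mono {d : ℕ} {r r' : ℤ} (hr : r ≤ r') {T : Op k E} (h : Sym d r T) : Sym d r' T := by
  induction d generalizing r r' T with
  | zero => exact Ord.mono hr h
  | succ d ih => exact ⟨h.1.mono hr, fun i => ih (by linarith) (h.2 i)⟩

lemma add_lie_ring {R : Type*} [Ring R] (a b c : R) : ⁅a + b, c⁆ = ⁅a, c⁆ + ⁅b, c⁆ := by
  simp only [Ring.lie_def]; noncomm_ring

lemma neg_lie_ring {R : Type*} [Ring R] (a c : R) : ⁅-a, c⁆ = -⁅a, c⁆ := by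
  simp only [Ring.lie_def]; noncomm_ring

lemma zero_lie_ring {R : Type*} [Ring R] (c : R) : ⁅(0 : R), c⁆ = 0 := by
  simp only [Ring.lie_def]; noncomm_ring

lemma Sym.add {d : ℕ} {r : ℤ} {T U : Op k E} (hT : Sym d r T) (hU : Sym d r U) :
    Sym d r (T + U) := by
  induction d generalizing r T U with
  | zero => exact Ord.add hT hU
  | succ d ih => exact ⟨hT.1.add hU.1, fun i => by rw [add_lie_ring]; exact ih (hT.2 i) (hU.2 i)⟩

lemma Sym.neg {d : ℕ} {r : ℤ} {T : Op k E} (hT : Sym d r T) : Sym d r (-T) := by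
  induction d generalizing r T with
  | zero => exact Ord.neg hT
  | succ d ih => exact ⟨hT.1.neg, fun i => by rw [neg_lie_ring]; exact ih (hT.2 i)⟩

lemma Sym.zero (d : ℕ) (r : ℤ) : Sym d r (0 : Op k E) := by
  induction d generalizing r with
  | zero => exact Ord.zero r
  | succ d ih => exact ⟨Ord.zero r, fun i => by rw [zero_lie_ring]; exact ih _⟩

lemma Sym.sum {d : ℕ} {r : ℤ} {ι : Type*} (t : Finset ι) {T : ι → Op k E}
    (h : ∀ i ∈ t, Sym d r (T i)) : Sym d r (∑ i ∈ t, T i) := by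
  classical
  induction t using Finset.induction_on with
  | empty => simpa using Sym.zero d r
  | insert i t hi ih =>
    rw [Finset.sum_insert hi]
    exact (h i (by simp)).add (ih fun j hj => h j (by simp [hj]))

lemma mul_lie' {R : Type*} [Ring R] (a b c : R) : ⁅a * b, c⁆ = a * ⁅b, c⁆ + ⁅a, c⁆ * b := by
  simp only [Ring.lie_def]; noncomm_ring

lemma Sym.mul {d : ℕ} {r r' : ℤ} {T U : Op k E} (hT : Sym d r T) (hU : Sym d r' U) :
    Sym d (r + r') (T * U) := by
  induction d generalizing r r' T U with
  | zero => exact Ord.mul hT hU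
  | succ d ih =>
    refine ⟨hT.1.mul hU.1, fun i => ?_⟩
    rw [mul_lie']
    refine Sym.add ?_ ?_
    · convert ih hT.pred (hU.2 i) using 1; ring
    · convert ih (hT.2 i) hU.pred using 1; ring

lemma Sym.of_commute {r : ℤ} {T : Op k E} (hT : Ord r T) (h : ∀ i, ⁅T, (gen i : Op k E)⁆ = 0) (d : ℕ) :
    Sym d r T := by
  cases d with
  | zero => exact hT
  | succ d => exact ⟨hT, fun i => by rw [h i]; exact Sym.zero _ _⟩

lemma Sym.one (d : ℕ) : Sym d 0 (1 : Op k E) :=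
  Sym.of_commute Ord.one (fun i => by simp [Ring.lie_def]) d

lemma sym_coeffS (M : E →L[ℂ] E) (d : ℕ) : Sym d 0 (coeffS M : Op k E) := by
  refine Sym.of_commute (order_coeffMap M).ord (fun i => ?_) d
  rw [Ring.lie_def, sub_eq_zero]
  ext1 u
  ext1
  rcases i with j | j
  · exact (an_coeffMap _ _ _).symm
  · exact (cr_coeffMap _ _ _).symm

lemma anS_mul_crS_same (j : Fin k) : (anS j * crS j : Op k E) = crS j * anS j + 1 := by
  ext1 u
  ext1
  exact an_cr_same _ _

lemma anS_mul_crS_ne {i j : Fin k} (h : i ≠ j) : (anS i * crS j : Op k E) = crS j * anS i := by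
  ext1 u
  ext1
  exact an_cr_ne h _

lemma anS_mul_anS (i j : Fin k) : (anS i * anS j : Op k E) = anS j * anS i := by
  ext1 u
  ext1
  exact an_an _ _ _

lemma crS_mul_crS (i j : Fin k) : (crS i * crS j : Op k E) = crS j * crS i := by
  ext1 u
  ext1
  exact cr_cr _ _ _

lemma sym_gen (i : Fin k ⊕ Fin k) (d : ℕ) : Sym d 1 (gen i : Op k E) := by
  cases d with
  | zero => exact ord_gen i
  | succ d =>
    refine ⟨ord_gen i, fun i' => ?_⟩
    have h1 : Sym d (1 - 1) (1 : Op k E) := Sym.one d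
    have h0 : Sym d (1 - 1) (0 : Op k E) := Sym.zero d _
    rcases i with i | i <;> rcases i' with j | j
    · have : ⁅(anS i : Op k E), (anS j : Op k E)⁆ = 0 := by rw [Ring.lie_def, anS_mul_anS i j, sub_self]
      exact Eq.mpr (congrArg (Sym d (1 - 1)) this) h0
    · by_cases h : i = j
      · subst h
        have : ⁅(anS i : Op k E), (crS i : Op k E)⁆ = 1 := by
          rw [Ring.lie_def, anS_mul_crS_same _, add_sub_cancel_left]
        exact Eq.mpr (congrArg (Sym d (1 - 1)) this) h1
      · have : ⁅(anS i : Op k E), (crS j : Op k E)⁆ = 0 := by rw [Ring.lie_def, anS_mul_crS_ne h, sub_self]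
        exact Eq.mpr (congrArg (Sym d (1 - 1)) this) h0
    · by_cases h : j = i
      · subst h
        have : ⁅(crS j : Op k E), (anS j : Op k E)⁆ = -1 := by
          rw [Ring.lie_def, anS_mul_crS_same _, sub_add_cancel_left]
        exact Eq.mpr (congrArg (Sym d (1 - 1)) this) h1.neg
      · have : ⁅(crS i : Op k E), (anS j : Op k E)⁆ = 0 := by rw [Ring.lie_def, anS_mul_crS_ne h, sub_self]
        exact Eq.mpr (congrArg (Sym d (1 - 1)) this) h0
    · have : ⁅(crS i : Op k E), (crS j : Op k E)⁆ = 0 := by rw [Ring.lie_def, crS_mul_crS i j, sub_self]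
      exact Eq.mpr (congrArg (Sym d (1 - 1)) this) h0

lemma sym_anS (j : Fin k) (d : ℕ) : Sym d 1 (anS j : Op k E) := sym_gen (Sum.inl j) d

lemma sym_crS (j : Fin k) (d : ℕ) : Sym d 1 (crS j : Op k E) := sym_gen (Sum.inr j) d

lemma Sym.of_smoothing {T : Op k E} (hT : ∀ r, Ord r T) (d : ℕ) (r : ℤ) : Sym d r T := by
  induction d generalizing r T with
  | zero => exact hT r
  | succ d ih =>
    refine ⟨hT r, fun i => ih (fun r' => ?_) _⟩
    rw [Ring.lie_def]
    refine Ord.sub ?_ ?_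
    · simpa using (hT (r' - 1)).mul (ord_gen i)
    · simpa using (ord_gen i).mul (hT (r' - 1))

/-- The creation part of the Dirac-type operator. -/
noncomputable def dirCrS (B : Fin k → E →L[ℂ] E) : Op k E := ∑ j, coeffS (B j) * crS j

/-- The annihilation part of the Dirac-type operator. -/
noncomputable def dirAnS (B : Fin k → E →L[ℂ] E) : Op k E :=
  ∑ j, coeffS (ContinuousLinearMap.adjoint (B j)) * anS j

lemma dirS_eq (B : Fin k → E →L[ℂ] E) : dirS B = dirCrS B + dirAnS B := by
  ext1 u
  ext1
  change dir B u = _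
  rw [dir_apply, dirCr_apply, dirAn_apply, LinearMap.add_apply, Submodule.coe_add,
    dirCrS, dirAnS, LinearMap.sum_apply, LinearMap.sum_apply, AddSubmonoidClass.coe_finsetSum,
    AddSubmonoidClass.coe_finsetSum]
  rfl

lemma sym_dirCrS (B : Fin k → E →L[ℂ] E) (d : ℕ) : Sym d 1 (dirCrS B) := by
  unfold dirCrS
  exact Sym.sum _ fun j _ => by simpa using (sym_coeffS (B j) d).mul (sym_crS j d)

lemma sym_dirAnS (B : Fin k → E →L[ℂ] E) (d : ℕ) : Sym d 1 (dirAnS B) := by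
  unfold dirAnS
  exact Sym.sum _ fun j _ => by simpa using (sym_coeffS _ d).mul (sym_anS j d)

variable {B : Fin k → E →L[ℂ] E} [(dirKer B).HasOrthogonalProjection]

lemma ord_kerProj (hB : Elliptic B) (r : ℤ) : Ord r (kerProj hB) :=
  ⟨-r, fun s hs => by
    obtain ⟨C, hC, h⟩ := nsq_kerProj_le hB s (s + r)
    rw [max_eq_right (by linarith)] at h
    exact ⟨C, hC, h⟩⟩

lemma sym_dirP (hB : Elliptic B) (d : ℕ) : Sym d 1 (dirP hB) := by
  rw [dirP, dirS_eq]
  exact ((sym_dirCrS B d).add (sym_dirAnS B d)).add (Sym.of_smoothing (ord_kerProj hB) d 1)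

lemma ord_inv (hB : Elliptic B) : Ord (-1) (inv hB) :=
  ⟨1, fun s hs => by
    obtain ⟨n, hn⟩ := Int.eq_ofNat_of_zero_le (show 0 ≤ s - 1 by linarith)
    obtain ⟨C, hC, h⟩ := nsq_inv_le hB n
    refine ⟨C, hC, fun u => ?_⟩
    have := h u
    rwa [← hn, sub_add_cancel, sub_eq_add_neg] at this⟩

lemma lie_of_inverse {R : Type*} [Ring R] {a s : R} (h1 : a * s = 1) (h2 : s * a = 1) (x : R) :
    ⁅s, x⁆ = -(s * ⁅a, x⁆ * s) := by
  have e1 : s * x = s * x * (a * s) := by rw [h1, mul_one]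
  have e2 : x * s = s * a * (x * s) := by rw [h2, one_mul]
  rw [Ring.lie_def, Ring.lie_def, e1, e2]
  noncomm_ring

lemma sym_inv (hB : Elliptic B) (d : ℕ) : Sym d (-1) (inv hB) := by
  induction d with
  | zero => exact ord_inv hB
  | succ d ih =>
    refine ⟨ord_inv hB, fun i => ?_⟩
    rw [lie_of_inverse (dirP_mul_inv hB) (inv_mul_dirP hB)]
    exact ((ih.mul ((sym_dirP hB (d + 1)).2 i)).mul ih).neg

/-- The contracted double commutator. -/
noncomputable def contr (T : Op k E) : Op k E := ∑ j, ⁅⁅T, (anS j : Op k E)⁆, (crS j : Op k E)⁆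

lemma Sym.contr {d : ℕ} {r : ℤ} {T : Op k E} (hT : Sym (d + 2) r T) : Sym d (r - 2) (Fock.contr T) := by
  unfold Fock.contr
  exact Sym.sum _ fun j _ => by
    have h1 : Sym (d + 1) (r - 1) ⁅T, anS j⁆ := hT.2 (Sum.inl j)
    have h2 : Sym d (r - 1 - 1) ⁅⁅T, anS j⁆, crS j⁆ := h1.2 (Sum.inr j)
    rwa [sub_sub] at h2

lemma Sym.iterate_contr {r : ℤ} {T : Op k E} (hT : ∀ d, Sym d r T) (n d : ℕ) :
    Sym d (r - 2 * n) (Fock.contr^[n] T) := by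
  induction n generalizing d with
  | zero => simpa using hT d
  | succ n ih =>
    rw [Function.iterate_succ_apply']
    have := (ih (d + 2)).contr
    convert this using 1
    push_cast; ring

end Calculus

end Fock

namespace Fock

open Finset

section Trace

variable {k : ℕ} {E : Type*} [NormedAddCommGroup E] [InnerProductSpace ℂ E]
  [CompleteSpace E] [FiniteDimensional ℂ E]

/-- The sequence supported at a single index. -/
def sing (α : Fin k → ℕ) : E →ₗ[ℂ] Sm k E where
  toFun v := ⟨Pi.single α v, (finSupp_single α v).mem⟩
  map_add' v w := by ext1; exact Pi.single_add (f := fun _ : Fin k → ℕ => E) α v w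
  map_smul' c v := by ext1; exact Pi.single_smul (f := fun _ : Fin k → ℕ => E) α c v

lemma coe_sing (α : Fin k → ℕ) (v : E) : (sing α v : (Fin k → ℕ) → E) = Pi.single α v := rfl

/-- Evaluation at an index. -/
def evalAt (α : Fin k → ℕ) : Sm k E →ₗ[ℂ] E where
  toFun u := (u : (Fin k → ℕ) → E) α
  map_add' _ _ := rfl
  map_smul' _ _ := rfl

/-- Diagonal blocks. -/
def block (T : Op k E) (α : Fin k → ℕ) : E →ₗ[ℂ] E := evalAt α ∘ₗ T ∘ₗ sing α

lemma block_apply (T : Op k E) (α : Fin k → ℕ) (v : E) :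
    block T α v = (T (sing α v) : (Fin k → ℕ) → E) α := rfl

/-- Traces of the diagonal blocks. -/
noncomputable def tr (T : Op k E) (α : Fin k → ℕ) : ℂ := LinearMap.trace ℂ E (block T α)

lemma tr_add (T U : Op k E) (α : Fin k → ℕ) : tr (T + U) α = tr T α + tr U α := by
  rw [tr, tr, tr, ← map_add]; rfl

lemma tr_sub (T U : Op k E) (α : Fin k → ℕ) : tr (T - U) α = tr T α - tr U α := by
  rw [tr, tr, tr, ← map_sub]; rfl

lemma tr_zero (α : Fin k → ℕ) : tr (0 : Op k E) α = 0 := by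
  have : block (0 : Op k E) α = 0 := rfl
  rw [tr, this, map_zero]

lemma tr_sum {ι : Type*} (t : Finset ι) (T : ι → Op k E) (α : Fin k → ℕ) :
    tr (∑ i ∈ t, T i) α = ∑ i ∈ t, tr (T i) α := by
  classical
  induction t using Finset.induction_on with
  | empty => simp [tr_zero]
  | insert i t hi ih => rw [Finset.sum_insert hi, Finset.sum_insert hi, tr_add, ih]

lemma tr_one (α : Fin k → ℕ) : tr (1 : Op k E) α = Module.finrank ℂ E := by
  have : block (1 : Op k E) α = 1 := by
    ext v; rw [block_apply, Module.End.one_apply, coe_sing]; simp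
  rw [tr, this, LinearMap.trace_one]

lemma tr_of_block_smul {T U : Op k E} {α β : Fin k → ℕ} {c : ℂ}
    (h : ∀ v, block T α v = c • block U β v) : tr T α = c * tr U β := by
  have : block T α = c • block U β := LinearMap.ext h
  rw [tr, this, map_smul]; rfl

lemma tr_of_block {T U : Op k E} {α β : Fin k → ℕ}
    (h : ∀ v, block T α v = block U β v) : tr T α = tr U β := by
  have : block T α = block U β := LinearMap.ext h
  rw [tr, this, tr]

lemma tr_of_block_zero {T : Op k E} {α : Fin k → ℕ}
    (h : ∀ v, block T α v = 0) : tr T α = 0 := by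
  have : block T α = 0 := LinearMap.ext h
  rw [tr, this, map_zero]

lemma coeffS_sing (M : E →L[ℂ] E) (α : Fin k → ℕ) (v : E) :
    coeffS M (sing α v) = sing α (M v) := by
  ext1
  funext β
  rw [coe_coeffS, coe_sing, coe_sing, coeffMap_apply]
  rcases eq_or_ne β α with rfl | h
  · simp
  · simp [h]

lemma tr_coeffS_mul (M : E →L[ℂ] E) (T : Op k E) (α : Fin k → ℕ) :
    tr (coeffS M * T) α = tr (T * coeffS M) α := by
  have h1 : block (coeffS M * T) α = (M : E →ₗ[ℂ] E) * block T α := rfl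
  have h2 : block (T * coeffS M) α = block T α * (M : E →ₗ[ℂ] E) := by
    ext v
    rw [block_apply, Module.End.mul_apply, coeffS_sing]
    rfl
  rw [tr, h1, tr, h2, LinearMap.trace_mul_comm]

lemma crS_sing (j : Fin k) (β : Fin k → ℕ) (v : E) :
    crS j (sing β v) = ((Real.sqrt (β j + 1) : ℝ) : ℂ) • sing (up j β) v := by
  ext1
  funext α
  rw [coe_crS, Submodule.coe_smul, Pi.smul_apply, coe_sing, coe_sing]
  by_cases h : α j = 0
  · have : α ≠ up j β := by rintro rfl; simp at h
    rw [cr_apply_of_eq_zero h, Pi.single_eq_of_ne this, smul_zero]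
  · obtain ⟨γ, rfl⟩ := mem_range_up.2 h
    rw [cr_apply_up]
    rcases eq_or_ne γ β with rfl | hγ
    · simp
    · rw [Pi.single_eq_of_ne hγ, Pi.single_eq_of_ne ((up_injective j).ne hγ), smul_zero, smul_zero]

lemma anS_sing_up (j : Fin k) (β : Fin k → ℕ) (v : E) :
    anS j (sing (up j β) v) = ((Real.sqrt (β j + 1) : ℝ) : ℂ) • sing β v := by
  ext1
  funext α
  rw [coe_anS, Submodule.coe_smul, Pi.smul_apply, coe_sing, coe_sing, an_apply]
  rcases eq_or_ne α β with rfl | h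
  · simp
  · rw [Pi.single_eq_of_ne h, Pi.single_eq_of_ne ((up_injective j).ne h), smul_zero, smul_zero]

lemma anS_sing_of_eq_zero {j : Fin k} {α : Fin k → ℕ} (h : α j = 0) (v : E) :
    anS j (sing α v) = 0 := by
  ext1
  funext β
  have : up j β ≠ α := by rintro rfl; simp at h
  rw [coe_anS, coe_sing, an_apply, Pi.single_eq_of_ne this, smul_zero]
  rfl

lemma tr_crS_mul_up (j : Fin k) (T : Op k E) (β : Fin k → ℕ) :
    tr (crS j * T) (up j β) = tr (T * crS j) β := by
  refine tr_of_block fun v => ?_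
  rw [block_apply, block_apply, Module.End.mul_apply, Module.End.mul_apply, crS_sing, map_smul,
    coe_crS, cr_apply_up]
  rfl

lemma tr_crS_mul_of_eq_zero {j : Fin k} {α : Fin k → ℕ} (h : α j = 0) (T : Op k E) :
    tr (crS j * T) α = 0 :=
  tr_of_block_zero fun v => by
    rw [block_apply, Module.End.mul_apply, coe_crS, cr_apply_of_eq_zero h]

lemma tr_mul_anS_up (j : Fin k) (T : Op k E) (β : Fin k → ℕ) :
    tr (T * anS j) (up j β) = tr (anS j * T) β := by
  refine tr_of_block fun v => ?_
  rw [block_apply, block_apply, Module.End.mul_apply, Module.End.mul_apply, anS_sing_up, map_smul,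
    coe_anS, an_apply]
  rfl

lemma tr_mul_anS_of_eq_zero {j : Fin k} {α : Fin k → ℕ} (h : α j = 0) (T : Op k E) :
    tr (T * anS j) α = 0 :=
  tr_of_block_zero fun v => by
    rw [block_apply, Module.End.mul_apply, anS_sing_of_eq_zero h, map_zero]; rfl

lemma crS_anS_sing (j : Fin k) (α : Fin k → ℕ) (v : E) :
    crS j (anS j (sing α v)) = ((α j : ℝ) : ℂ) • sing α v := by
  ext1
  funext β
  rw [coe_crS, coe_anS, cr_an_same_apply, Submodule.coe_smul, Pi.smul_apply, coe_sing]
  rcases eq_or_ne β α with rfl | h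
  · rfl
  · rw [Pi.single_eq_of_ne h, smul_zero, smul_zero]

lemma tr_mul_crS_anS (j : Fin k) (T : Op k E) (α : Fin k → ℕ) :
    tr (T * (crS j * anS j)) α = α j * tr T α := by
  refine tr_of_block_smul fun v => ?_
  rw [block_apply, Module.End.mul_apply, Module.End.mul_apply, crS_anS_sing, map_smul]
  simp [block_apply]

lemma tr_crS_anS_mul (j : Fin k) (T : Op k E) (α : Fin k → ℕ) :
    tr ((crS j * anS j) * T) α = α j * tr T α := by
  refine tr_of_block_smul fun v => ?_
  rw [block_apply, Module.End.mul_apply, Module.End.mul_apply, coe_crS, coe_anS, cr_an_same_apply]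
  simp [block_apply]

/-- Multi-indices of a given degree. -/
def layer (k m : ℕ) : Finset (Fin k → ℕ) := Finset.piAntidiag Finset.univ m

lemma mem_layer {m : ℕ} {α : Fin k → ℕ} : α ∈ layer k m ↔ deg α = m := by
  simp [layer, deg]

lemma card_layer_le (m : ℕ) : (layer k m).card ≤ (m + 1) ^ k := by
  have : layer k m ⊆ Fintype.piFinset fun _ => Finset.range (m + 1) := fun α hα => by
    rw [Fintype.mem_piFinset]
    intro j
    have := le_deg j α
    rw [mem_layer.1 hα] at this
    simp; omega
  exact (Finset.card_le_card this).trans (by simp)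

/-- Traces over the layers. -/
noncomputable def ltr (T : Op k E) (m : ℕ) : ℂ := ∑ α ∈ layer k m, tr T α

lemma ltr_add (T U : Op k E) (m : ℕ) : ltr (T + U) m = ltr T m + ltr U m := by
  simp only [ltr, tr_add, Finset.sum_add_distrib]

lemma ltr_sub (T U : Op k E) (m : ℕ) : ltr (T - U) m = ltr T m - ltr U m := by
  simp only [ltr, tr_sub, Finset.sum_sub_distrib]

lemma ltr_zero (m : ℕ) : ltr (0 : Op k E) m = 0 := by simp [ltr, tr_zero]

lemma ltr_sum {ι : Type*} (t : Finset ι) (T : ι → Op k E) (m : ℕ) :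
    ltr (∑ i ∈ t, T i) m = ∑ i ∈ t, ltr (T i) m := by
  simp only [ltr, tr_sum]
  exact Finset.sum_comm

lemma ltr_coeffS_mul (M : E →L[ℂ] E) (T : Op k E) (m : ℕ) :
    ltr (coeffS M * T) m = ltr (T * coeffS M) m :=
  Finset.sum_congr rfl fun α _ => tr_coeffS_mul M T α

lemma sum_layer_succ {j : Fin k} {f : (Fin k → ℕ) → ℂ} (hf : ∀ α, α j = 0 → f α = 0) (m : ℕ) :
    ∑ α ∈ layer k (m + 1), f α = ∑ β ∈ layer k m, f (up j β) := by
  refine Eq.trans (Eq.symm ?_) (Finset.sum_map (layer k m) ⟨up j, up_injective j⟩ f)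
  refine Finset.sum_subset (fun α hα => ?_) fun α hα hα' => hf α ?_
  · obtain ⟨β, hβ, rfl⟩ := Finset.mem_map.1 hα
    rw [mem_layer] at hβ ⊢
    simp [hβ]
  · by_contra h
    refine hα' (Finset.mem_map.2 ⟨down j α, ?_, up_down h⟩)
    rw [mem_layer] at hα ⊢
    have := deg_down h
    omega

lemma eq_zero_of_mem_layer_zero {α : Fin k → ℕ} (h : α ∈ layer k 0) (j : Fin k) : α j = 0 := by
  have := le_deg j α
  rw [mem_layer.1 h] at this
  omega

lemma ltr_crS_mul_succ (j : Fin k) (T : Op k E) (m : ℕ) :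
    ltr (crS j * T) (m + 1) = ltr (T * crS j) m := by
  rw [ltr, sum_layer_succ (j := j) fun α h => tr_crS_mul_of_eq_zero h T]
  exact Finset.sum_congr rfl fun α _ => tr_crS_mul_up j T α

lemma ltr_crS_mul_zero (j : Fin k) (T : Op k E) : ltr (crS j * T) 0 = 0 :=
  Finset.sum_eq_zero fun _ h => tr_crS_mul_of_eq_zero (eq_zero_of_mem_layer_zero h j) T

lemma ltr_mul_anS_succ (j : Fin k) (T : Op k E) (m : ℕ) :
    ltr (T * anS j) (m + 1) = ltr (anS j * T) m := by
  rw [ltr, sum_layer_succ (j := j) fun α h => tr_mul_anS_of_eq_zero h T]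
  exact Finset.sum_congr rfl fun α _ => tr_mul_anS_up j T α

lemma ltr_mul_anS_zero (j : Fin k) (T : Op k E) : ltr (T * anS j) 0 = 0 :=
  Finset.sum_eq_zero fun _ h => tr_mul_anS_of_eq_zero (eq_zero_of_mem_layer_zero h j) T

lemma sum_ltr_mul_crS_anS (T : Op k E) (m : ℕ) :
    ∑ j, ltr (T * (crS j * anS j)) m = m * ltr T m := by
  simp only [ltr, tr_mul_crS_anS]
  rw [Finset.sum_comm, Finset.mul_sum]
  refine Finset.sum_congr rfl fun α hα => ?_
  rw [← Finset.sum_mul, ← mem_layer.1 hα, deg]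
  push_cast
  rfl

lemma sum_ltr_crS_anS_mul (T : Op k E) (m : ℕ) :
    ∑ j, ltr ((crS j * anS j) * T) m = m * ltr T m := by
  simp only [ltr, tr_crS_anS_mul]
  rw [Finset.sum_comm, Finset.mul_sum]
  refine Finset.sum_congr rfl fun α hα => ?_
  rw [← Finset.sum_mul, ← mem_layer.1 hα, deg]
  push_cast
  rfl

lemma sum_ltr_mul_anS_crS (T : Op k E) (m : ℕ) :
    ∑ j, ltr (T * (anS j * crS j)) m = (m + k) * ltr T m := by
  have h : ∀ j : Fin k, ltr (T * (anS j * crS j)) m = ltr (T * (crS j * anS j)) m + ltr T m :=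
    fun j => by rw [anS_mul_crS_same, mul_add, ltr_add, mul_one]
  simp only [h]
  rw [Finset.sum_add_distrib, sum_ltr_mul_crS_anS]
  simp
  ring

lemma ltr_contr (T : Op k E) (m : ℕ) : ltr (contr T) m =
    (2 * m + k) * ltr T m - (m + 1) * ltr T (m + 1) - ∑ j, ltr (crS j * (T * anS j)) m := by
  have h : ∀ j : Fin k, ltr ⁅⁅T, (anS j : Op k E)⁆, (crS j : Op k E)⁆ m =
      ltr (T * (anS j * crS j)) m - ltr (T * (crS j * anS j)) (m + 1) -
        ltr (crS j * (T * anS j)) m + ltr ((crS j * anS j) * T) m := fun j => by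
    have e : ⁅⁅T, (anS j : Op k E)⁆, (crS j : Op k E)⁆ = T * (anS j * crS j) -
        anS j * (T * crS j) - crS j * (T * anS j) + (crS j * anS j) * T := by
      rw [Ring.lie_def, Ring.lie_def]; noncomm_ring
    rw [e, ltr_add, ltr_sub, ltr_sub, ← ltr_mul_anS_succ, mul_assoc T]
  rw [contr, ltr_sum]
  simp only [h]
  rw [Finset.sum_add_distrib, Finset.sum_sub_distrib, Finset.sum_sub_distrib,
    sum_ltr_mul_anS_crS, sum_ltr_mul_crS_anS, sum_ltr_crS_anS_mul]
  push_cast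
  ring

lemma ltr_contr_zero (T : Op k E) : ltr (contr T) 0 = k * ltr T 0 - ltr T 1 := by
  rw [ltr_contr, Finset.sum_eq_zero fun j _ => ltr_crS_mul_zero j _]
  simp

lemma ltr_contr_succ (T : Op k E) (m : ℕ) : ltr (contr T) (m + 1) =
    (2 * (m + 1) + k) * ltr T (m + 1) - (m + 2) * ltr T (m + 2) - (m + k) * ltr T m := by
  rw [ltr_contr]
  simp only [ltr_crS_mul_succ, mul_assoc]
  rw [sum_ltr_mul_anS_crS]
  push_cast
  ring

lemma norm_trace_le (L : E →ₗ[ℂ] E) {c : ℝ} (hL : ∀ v, ‖L v‖ ≤ c * ‖v‖) :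
    ‖LinearMap.trace ℂ E L‖ ≤ Module.finrank ℂ E * c := by
  rw [LinearMap.trace_eq_sum_inner L (stdOrthonormalBasis ℂ E)]
  refine (norm_sum_le _ _).trans ?_
  have : ∀ i ∈ Finset.univ, ‖inner ℂ (stdOrthonormalBasis ℂ E i)
      (L (stdOrthonormalBasis ℂ E i))‖ ≤ c := fun i _ => by
    refine (norm_inner_le_norm _ _).trans ?_
    have := hL (stdOrthonormalBasis ℂ E i)
    simpa using this
  refine (Finset.sum_le_sum this).trans ?_
  simp

lemma Ord.tr_le {r : ℤ} {T : Op k E} (hT : Ord (2 * r) T) :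
    ∃ C : ℝ, 0 ≤ C ∧ ∀ α, ‖tr T α‖ ≤ C * wt α ^ r := by
  obtain ⟨s, hT⟩ := hT
  obtain ⟨C, hC, h⟩ := hT s le_rfl
  refine ⟨Module.finrank ℂ E * Real.sqrt C, by positivity, fun α => ?_⟩
  rw [mul_assoc]
  refine norm_trace_le _ fun v => ?_
  have hw := wt_pos α
  refine le_of_sq_le_sq ?_ (by positivity)
  have h1 := (term_le_nsq ((T (sing α v)).mem s) α).trans (h (sing α v))
  have h2 : nsq (s + 2 * r) (sing α v : (Fin k → ℕ) → E) = wt α ^ (s + 2 * r) * ‖v‖ ^ 2 := by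
    unfold nsq
    rw [tsum_eq_single α]
    · simp [term, coe_sing]
    · intro β hβ
      simp [term, coe_sing, Pi.single_eq_of_ne hβ]
  rw [h2, zpow_add₀ hw.ne'] at h1
  have h3 : wt α ^ s * ‖block T α v‖ ^ 2 ≤ wt α ^ s * (C * wt α ^ (2 * r) * ‖v‖ ^ 2) := by
    refine le_of_le_of_eq h1 ?_
    ring
  have h4 := le_of_mul_le_mul_left h3 (by positivity)
  rw [mul_pow, mul_pow, Real.sq_sqrt hC]
  rwa [two_mul, zpow_add₀ hw.ne', ← sq] at h4

lemma norm_ltr_le {T : Op k E} {C : ℝ} {r : ℤ} (h : ∀ α, ‖tr T α‖ ≤ C * wt α ^ r) (hC : 0 ≤ C)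
    (m : ℕ) : ‖ltr T m‖ ≤ C * ((m : ℝ) + 1) ^ ((k : ℤ) + r) := by
  have h1 : ∀ α ∈ layer k m, ‖tr T α‖ ≤ C * ((m : ℝ) + 1) ^ r := fun α hα => by
    have := h α
    rwa [wt, mem_layer.1 hα, add_comm] at this
  have hm : (0 : ℝ) < (m : ℝ) + 1 := by positivity
  refine (norm_sum_le_of_le _ h1).trans ?_
  rw [Finset.sum_const, nsmul_eq_mul, zpow_add₀ hm.ne', zpow_natCast]
  have h2 : ((layer k m).card : ℝ) ≤ ((m : ℝ) + 1) ^ k := by exact_mod_cast card_layer_le m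
  calc ((layer k m).card : ℝ) * (C * ((m : ℝ) + 1) ^ r) ≤
      ((m : ℝ) + 1) ^ k * (C * ((m : ℝ) + 1) ^ r) := by gcongr
    _ = _ := by ring

end Trace

end Fock

namespace Fock

open Finset

/-- Sequences of polynomial growth. -/
def PolyGrowth (b : ℕ → ℂ) : Prop := ∃ (C : ℝ) (N : ℕ), 0 ≤ C ∧ ∀ m, ‖b m‖ ≤ C * ((m : ℝ) + 1) ^ N

/-- The generating function of a sequence, on the real line. -/
noncomputable def gf (b : ℕ → ℂ) (t : ℝ) : ℂ := ∑' m, b m * (t : ℂ) ^ m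

lemma summable_succ_pow_mul_geometric (N : ℕ) {r : ℝ} (h0 : 0 ≤ r) (h1 : r < 1) :
    Summable fun m : ℕ => ((m : ℝ) + 1) ^ N * r ^ m := by
  have h := summable_pow_mul_geometric_of_norm_lt_one (R := ℝ) N (r := r)
    (by rwa [Real.norm_of_nonneg h0])
  rcases h0.eq_or_lt with rfl | h0
  · refine summable_of_ne_finset_zero (s := {0}) fun m hm => ?_
    rw [zero_pow (by simpa using hm), mul_zero]
  · have h' := ((summable_nat_add_iff 1).2 h).mul_right r⁻¹
    refine h'.congr fun m => ?_
    push_cast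
    rw [pow_succ r, mul_assoc, mul_assoc, mul_inv_cancel₀ h0.ne', mul_one]

namespace PolyGrowth

variable {b : ℕ → ℂ}

lemma summable_norm (hb : PolyGrowth b) {r : ℝ} (h0 : 0 ≤ r) (h1 : r < 1) :
    Summable fun m : ℕ => ‖b m‖ * r ^ m := by
  obtain ⟨C, N, _, h⟩ := hb
  refine Summable.of_nonneg_of_le (fun m => by positivity) (fun m => ?_)
    ((summable_succ_pow_mul_geometric N h0 h1).mul_left C)
  rw [← mul_assoc]
  exact mul_le_mul_of_nonneg_right (h m) (by positivity)

lemma hasSum (hb : PolyGrowth b) {t : ℝ} (ht : |t| < 1) :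
    HasSum (fun m => b m * (t : ℂ) ^ m) (gf b t) := by
  refine Summable.hasSum (Summable.of_norm ((hb.summable_norm (abs_nonneg t) ht).congr fun m => ?_))
  rw [norm_mul, norm_pow, Complex.norm_real, Real.norm_eq_abs]

lemma deriv (hb : PolyGrowth b) : PolyGrowth fun m => ((m : ℂ) + 1) * b (m + 1) := by
  obtain ⟨C, N, hC, h⟩ := hb
  refine ⟨C * 2 ^ N, N + 1, by positivity, fun m => ?_⟩
  have h1 : ‖(m : ℂ) + 1‖ = (m : ℝ) + 1 := by
    have : ((m : ℂ) + 1) = (((m : ℝ) + 1 : ℝ) : ℂ) := by push_cast; rfl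
    rw [this, Complex.norm_real, Real.norm_of_nonneg (by positivity)]
  rw [norm_mul, h1]
  have h2 := h (m + 1)
  push_cast at h2
  have h3 : ((m : ℝ) + 1 + 1) ^ N ≤ (2 * ((m : ℝ) + 1)) ^ N := by
    gcongr
    have : (0 : ℝ) ≤ m := by positivity
    linarith
  calc ((m : ℝ) + 1) * ‖b (m + 1)‖ ≤ ((m : ℝ) + 1) * (C * (2 * ((m : ℝ) + 1)) ^ N) := by
        gcongr
        exact h2.trans (by gcongr)
    _ = _ := by rw [mul_pow]; ring

lemma hasDerivAt_gf (hb : PolyGrowth b) {t : ℝ} (ht : |t| < 1) :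
    HasDerivAt (gf b) (gf (fun m => ((m : ℂ) + 1) * b (m + 1)) t) t := by
  obtain ⟨r, htr, hr⟩ := exists_between ht
  have h0 : 0 ≤ r := (abs_nonneg t).trans htr.le
  have hs := hb.deriv.summable_norm h0 hr
  have hs' : Summable fun m : ℕ => ‖(m : ℂ) * b m‖ * r ^ (m - 1) := by
    rw [← summable_nat_add_iff 1]
    refine hs.congr fun m => ?_
    simp
  have key := hasDerivAt_tsum_of_isPreconnected (𝕜 := ℝ) (F := ℂ)
    (g := fun m (y : ℝ) => b m * (y : ℂ) ^ m)
    (g' := fun m (y : ℝ) => (m : ℂ) * b m * (y : ℂ) ^ (m - 1)) hs' Metric.isOpen_ball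
    (convex_ball (0 : ℝ) r).isPreconnected (fun m y _ => ?_) (fun m y hy => ?_)
    (y := t) (y₀ := t) (by simpa using htr) (hb.hasSum ht).summable (by simpa using htr)
  · have e : ∑' m : ℕ, (m : ℂ) * b m * (t : ℂ) ^ (m - 1) =
        gf (fun m => ((m : ℂ) + 1) * b (m + 1)) t := by
      have hh : HasSum (fun m : ℕ => ((m + 1 : ℕ) : ℂ) * b (m + 1) * (t : ℂ) ^ (m + 1 - 1))
          (gf (fun m => ((m : ℂ) + 1) * b (m + 1)) t) := by
        refine (hb.deriv.hasSum ht).congr_fun fun m => ?_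
        push_cast
        rfl
      rw [hasSum_nat_add_iff (f := fun m : ℕ => (m : ℂ) * b m * (t : ℂ) ^ (m - 1)) 1] at hh
      simpa using hh.tsum_eq
    rw [← e]
    exact key
  · have h := ((hasDerivAt_pow m y).ofReal_comp).const_mul (b m)
    push_cast at h
    exact h.congr_deriv (by ring)
  · have hy' : |y| ≤ r := by
      have : |y| < r := by simpa using hy
      exact this.le
    rw [norm_mul, norm_pow, Complex.norm_real, Real.norm_eq_abs]
    gcongr

end PolyGrowth

/-- The relation between the layer traces of an operator and of its contraction. -/
structure ContrRel (k : ℕ) (b c : ℕ → ℂ) : Prop where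
  zero : c 0 = k * b 0 - b 1
  succ : ∀ m : ℕ, c (m + 1) = (2 * (m + 1) + k) * b (m + 1) - (m + 2) * b (m + 2) - (m + k) * b m

namespace ContrRel

variable {k : ℕ} {b c : ℕ → ℂ}

lemma gf_eq (h : ContrRel k b c) (hb : PolyGrowth b) {t : ℝ} (ht : |t| < 1) :
    gf c t = k * (1 - t) * gf b t -
      (1 - t) ^ 2 * gf (fun m => ((m : ℂ) + 1) * b (m + 1)) t := by
  set D := gf (fun m => ((m : ℂ) + 1) * b (m + 1)) t with hD
  have s1 := hb.hasSum ht
  have s2 := hb.deriv.hasSum ht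
  rw [← hD] at s2
  have s3 : HasSum (fun m : ℕ => b (m + 1) * (t : ℂ) ^ (m + 1)) (gf b t - b 0) := by
    have := (hasSum_nat_add_iff' 1).2 s1
    simpa using this
  have s4 : HasSum (fun m : ℕ => ((m : ℂ) + 2) * b (m + 2) * (t : ℂ) ^ (m + 1)) (D - b 1) := by
    have := (hasSum_nat_add_iff' 1).2 s2
    simp only [Finset.sum_range_one, Nat.cast_zero, zero_add, one_mul, pow_zero, mul_one] at this
    refine this.congr_fun fun m => ?_
    push_cast
    ring_nf
  have s5 : HasSum (fun m : ℕ => (m : ℂ) * b m * (t : ℂ) ^ m) (t * D) := by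
    have := (hasSum_nat_add_iff (f := fun m : ℕ => (m : ℂ) * b m * (t : ℂ) ^ m) 1
      (g := t * D)).1 (by
        refine (s2.mul_left (t : ℂ)).congr_fun fun m => ?_
        push_cast
        ring)
    simpa using this
  have s6 : HasSum (fun m : ℕ => c (m + 1) * (t : ℂ) ^ (m + 1))
      (2 * (t * D) + k * (gf b t - b 0) - (D - b 1) - t * (t * D) - k * (t * gf b t)) := by
    refine (((((s2.mul_left (t : ℂ)).mul_left 2).add (s3.mul_left (k : ℂ))).sub s4).sub
      (s5.mul_left (t : ℂ))).sub ((s1.mul_left (t : ℂ)).mul_left (k : ℂ)) |>.congr_fun fun m => ?_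
    rw [h.succ]
    ring
  have s7 := ((hasSum_nat_add_iff (f := fun m : ℕ => c m * (t : ℂ) ^ m) 1).1 s6).tsum_eq
  rw [gf, s7]
  simp only [Finset.sum_range_one, pow_zero, mul_one, h.zero]
  ring

lemma norm_sub_le (h : ContrRel k b c) (hb : PolyGrowth b) {C : ℝ}
    (hC : ∀ t ∈ Set.Ioc (-1 : ℝ) 0, ‖gf c t‖ ≤ C) {t : ℝ} (ht : t ∈ Set.Ioc (-1 : ℝ) 0) :
    ‖(1 - (t : ℂ)) ^ k * gf b t - b 0‖ ≤ 2 ^ k * C := by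
  have habs : ∀ s ∈ Set.Ioc (-1 : ℝ) 0, |s| < 1 := fun s hs => abs_lt.2 ⟨hs.1, by linarith [hs.2]⟩
  have hn : ∀ s ∈ Set.Ioc (-1 : ℝ) 0, ‖1 - (s : ℂ)‖ = 1 - s := fun s hs => by
    have : 1 - (s : ℂ) = ((1 - s : ℝ) : ℂ) := by push_cast; rfl
    rw [this, Complex.norm_real, Real.norm_of_nonneg (by linarith [hs.2])]
  have hC0 : 0 ≤ C := (norm_nonneg _).trans (hC 0 (by simp))
  set D := gf fun m => ((m : ℂ) + 1) * b (m + 1) with hD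
  have hd : ∀ s ∈ Set.Ioc (-1 : ℝ) 0, HasDerivAt (fun s : ℝ => (1 - (s : ℂ)) ^ k * gf b s)
      (-(k * (1 - (s : ℂ)) ^ (k - 1)) * gf b s + (1 - (s : ℂ)) ^ k * D s) s := fun s hs => by
    have h1 : HasDerivAt (fun s : ℝ => (1 - (s : ℂ)) ^ k) (-(k * (1 - (s : ℂ)) ^ (k - 1))) s := by
      have := ((((hasDerivAt_id s).const_sub 1).pow k).ofReal_comp)
      push_cast at this
      convert this using 1
      · ext; simp
      · simp
    exact h1.mul (hb.hasDerivAt_gf (habs s hs))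
  have hbd : ∀ s ∈ Set.Ioc (-1 : ℝ) 0,
      ‖-(k * (1 - (s : ℂ)) ^ (k - 1)) * gf b s + (1 - (s : ℂ)) ^ k * D s‖ ≤ 2 ^ k * C :=
    fun s hs => by
    have e : (-(k * (1 - (s : ℂ)) ^ (k - 1)) * gf b s + (1 - (s : ℂ)) ^ k * D s) *
        (1 - (s : ℂ)) ^ 2 = - ((1 - (s : ℂ)) ^ k * gf c s) := by
      rw [h.gf_eq hb (habs s hs)]
      rcases k with _ | k
      · simp [hD]; ring
      · simp only [Nat.add_sub_cancel, hD]; ring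
    have e2 := congrArg norm e
    rw [norm_mul, norm_neg, norm_mul, norm_pow, norm_pow, hn s hs] at e2
    have h1 : (1 : ℝ) ≤ (1 - s) ^ 2 := one_le_pow₀ (by linarith [hs.2])
    calc _ ≤ ‖-(k * (1 - (s : ℂ)) ^ (k - 1)) * gf b s + (1 - (s : ℂ)) ^ k * D s‖ * (1 - s) ^ 2 :=
          le_mul_of_one_le_right (norm_nonneg _) h1
      _ = (1 - s) ^ k * ‖gf c s‖ := e2
      _ ≤ 2 ^ k * C := by
          have := hC s hs
          have h2 : (0 : ℝ) ≤ 1 - s := by linarith [hs.2]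
          have h3 : 1 - s ≤ 2 := by linarith [hs.1]
          gcongr
  have hm := (convex_Ioc (-1 : ℝ) 0).norm_image_sub_le_of_norm_hasDerivWithin_le
    (fun s hs => (hd s hs).hasDerivWithinAt) hbd (x := 0) (y := t) (by simp) ht
  have h0 : gf b 0 = b 0 := by
    rw [gf, tsum_eq_single 0 (fun m hm => by simp [hm])]
    simp
  simp only [Complex.ofReal_zero, sub_zero, one_pow, one_mul, h0] at hm
  refine hm.trans ?_
  have : ‖t‖ ≤ 1 := (habs t ht).le
  exact mul_le_of_le_one_right (by positivity) this

lemma bounded (h : ContrRel k b c) (hb : PolyGrowth b)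
    (hC : ∃ C : ℝ, ∀ t ∈ Set.Ioc (-1 : ℝ) 0, ‖gf c t‖ ≤ C) :
    ∃ C : ℝ, ∀ t ∈ Set.Ioc (-1 : ℝ) 0, ‖gf b t‖ ≤ C := by
  obtain ⟨C, hC⟩ := hC
  refine ⟨‖b 0‖ + 2 ^ k * C, fun t ht => ?_⟩
  have h1 := h.norm_sub_le hb hC ht
  have h2 : ‖gf b t‖ ≤ ‖(1 - (t : ℂ)) ^ k * gf b t‖ := by
    have : 1 - (t : ℂ) = ((1 - t : ℝ) : ℂ) := by push_cast; rfl
    rw [norm_mul, norm_pow, this, Complex.norm_real, Real.norm_of_nonneg (by linarith [ht.2])]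
    exact le_mul_of_one_le_left (norm_nonneg _) (one_le_pow₀ (by linarith [ht.2]))
  refine h2.trans ?_
  have h3 := norm_add_le ((1 - (t : ℂ)) ^ k * gf b t - b 0) (b 0)
  rw [sub_add_cancel] at h3
  linarith

end ContrRel

lemma norm_gf_le_of_summable {b : ℕ → ℂ} (hb : Summable fun m => ‖b m‖) {t : ℝ} (ht : |t| ≤ 1) :
    ‖gf b t‖ ≤ ∑' m, ‖b m‖ := by
  refine tsum_of_norm_bounded hb.hasSum fun m => ?_
  rw [norm_mul, norm_pow, Complex.norm_real, Real.norm_eq_abs]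
  exact mul_le_of_le_one_right (norm_nonneg _) (pow_le_one₀ (abs_nonneg _) ht)

lemma tendsto_gf_neg_one {b : ℕ → ℂ} (hb : Summable fun m => ‖b m‖) :
    Filter.Tendsto (gf b) (nhdsWithin (-1) (Set.Ioc (-1) 0)) (nhds (∑' m, b m * (-1) ^ m)) := by
  have hc : ContinuousOn (gf b) (Set.Icc (-1) 1) := by
    refine continuousOn_tsum (fun m => by fun_prop) hb fun m t ht => ?_
    rw [norm_mul, norm_pow, Complex.norm_real, Real.norm_eq_abs]
    exact mul_le_of_le_one_right (norm_nonneg _) (pow_le_one₀ (abs_nonneg _) (abs_le.2 ht))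
  have h := (hc (-1) (by norm_num)).mono
    (fun x hx => ⟨hx.1.le, hx.2.trans zero_le_one⟩ : Set.Ioc (-1 : ℝ) 0 ⊆ Set.Icc (-1) 1)
  have h2 : gf b (-1) = ∑' m, b m * (-1) ^ m := by simp [gf]
  rw [← h2]
  exact h

end Fock

namespace Fock

open Finset

lemma exists_int_trace_of_involutive {W : Type*} [AddCommGroup W] [Module ℂ W]
    [FiniteDimensional ℂ W] {f : W →ₗ[ℂ] W} (hf : f * f = 1) :
    ∃ z : ℤ, LinearMap.trace ℂ W f = z := by
  set p : W →ₗ[ℂ] W := (2⁻¹ : ℂ) • (1 + f) with hp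
  have hi : IsIdempotentElem p := by
    have h2 : (1 + f) * (1 + f) = (2 : ℂ) • (1 + f) := by
      rw [mul_add, add_mul, add_mul, hf, two_smul]
      simp only [mul_one, one_mul]
      abel
    rw [IsIdempotentElem, hp, smul_mul_assoc, mul_smul_comm, h2, smul_smul, smul_smul]
    norm_num
  have ht := (LinearMap.IsIdempotentElem.isProj_range p hi).trace
  have e : f = (2 : ℂ) • p - 1 := by
    rw [hp, smul_smul]
    norm_num
  refine ⟨2 * Module.finrank ℂ (LinearMap.range p) - Module.finrank ℂ W, ?_⟩
  rw [e, map_sub, map_smul, ht, LinearMap.trace_one]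
  push_cast
  rfl

section Parity

variable {k : ℕ} {E : Type*} [NormedAddCommGroup E] [InnerProductSpace ℂ E]
  [CompleteSpace E] [FiniteDimensional ℂ E]

/-- The parity of an index. -/
def sgn (α : Fin k → ℕ) : ℝ := (-1) ^ deg α

lemma sgn_sq (α : Fin k → ℕ) : sgn α ^ 2 = 1 := by
  rw [sgn, ← pow_mul, mul_comm, pow_mul]; simp

lemma sgn_up (j : Fin k) (α : Fin k → ℕ) : sgn (up j α) = -sgn α := by
  rw [sgn, sgn, deg_up, pow_succ]; ring

lemma an_parity (j : Fin k) (u : (Fin k → ℕ) → E) : an j (dg sgn u) = -dg sgn (an j u) := by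
  funext α
  rw [Pi.neg_apply, an_apply, dg_apply, dg_apply, an_apply, sgn_up, smul_comm]
  push_cast
  rw [neg_smul]

lemma cr_parity (j : Fin k) (u : (Fin k → ℕ) → E) : cr j (dg sgn u) = -dg sgn (cr j u) := by
  funext α
  by_cases h : α j = 0
  · rw [Pi.neg_apply, dg_apply, cr_apply_of_eq_zero h, cr_apply_of_eq_zero h, smul_zero, neg_zero]
  · rw [← up_down h, Pi.neg_apply, cr_apply_up, dg_apply, dg_apply, cr_apply_up, sgn_up, smul_comm]
    push_cast
    rw [neg_smul, neg_neg]

lemma dir_parity (B : Fin k → E →L[ℂ] E) (u : (Fin k → ℕ) → E) :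
    dir B (dg sgn u) = -dg sgn (dir B u) := by
  simp only [dir_apply, dirCr_apply, dirAn_apply, an_parity, cr_parity, map_neg, map_add, map_sum,
    dg_coeffMap, Finset.sum_neg_distrib, neg_add]

lemma parity_bound : ∃ C : ℝ, 0 ≤ C ∧ ∀ u : (Fin k → ℕ) → E, Mem 0 u →
    Mem 0 (dg sgn u) ∧ nsq 0 (dg sgn u) ≤ C * nsq 0 u :=
  ⟨1, zero_le_one, fun u hu => Mem.of_le (fun α => by rw [term_dg, sgn_sq]) hu⟩

variable {B : Fin k → E →L[ℂ] E}

lemma parity_mem_dirKer {v : Hil k E} (hv : v ∈ dirKer B) :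
    bdd (dg sgn) parity_bound v ∈ dirKer B := by
  rw [mem_dirKer, coe_bdd, dir_parity, mem_dirKer.1 hv, map_zero, neg_zero]

/-- The parity involution on the kernel. -/
noncomputable def kerParity (B : Fin k → E →L[ℂ] E) : dirKer B →ₗ[ℂ] dirKer B :=
  (bdd (dg sgn) parity_bound).toLinearMap.restrict fun _ hv => parity_mem_dirKer hv

lemma coe_kerParity (v : dirKer B) (α : Fin k → ℕ) :
    ((kerParity B v : Hil k E) : (Fin k → ℕ) → E) α = ((sgn α : ℝ) : ℂ) • (v : Hil k E) α := rfl

lemma kerParity_mul_self : kerParity B * kerParity B = 1 := by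
  ext v : 2
  ext1
  funext α
  rw [Module.End.mul_apply, coe_kerParity, coe_kerParity, smul_smul, ← Complex.ofReal_mul, ← sq,
    sgn_sq, Complex.ofReal_one, one_smul]
  rfl

variable [(dirKer B).HasOrthogonalProjection]

lemma tr_kerProj (hB : Elliptic B) {ι : Type*} [Fintype ι]
    (b : OrthonormalBasis ι ℂ (dirKer B)) (α : Fin k → ℕ) :
    tr (kerProj hB) α = ∑ i, inner ℂ ((b i : Hil k E) α) ((b i : Hil k E) α) := by
  have h : block (kerProj hB) α = ∑ i, (InnerProductSpace.rankOne ℂ ((b i : Hil k E) α)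
      ((b i : Hil k E) α)).toLinearMap := by
    ext v
    rw [block_apply, coe_kerProj, b.starProjection_eq_sum_rankOne, LinearMap.sum_apply]
    have h1 : ∀ i, (inner ℂ (b i : Hil k E) (Sm.toHilₗ (sing α v)) : ℂ) =
        inner ℂ ((b i : Hil k E) α) v := fun i => by
      rw [Hil.inner_eq, Sm.coe_toHilₗ, coe_sing, ← ip_conj, ip_single, inner_conj_symm]
    have h2 : ((∑ i, InnerProductSpace.rankOne ℂ (b i : Hil k E) (b i : Hil k E))
        (Sm.toHilₗ (sing α v)) : Hil k E) =
        ∑ i, (inner ℂ ((b i : Hil k E) α) v : ℂ) • (b i : Hil k E) := by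
      rw [_root_.sum_apply]
      exact Finset.sum_congr rfl fun i _ => by rw [InnerProductSpace.rankOne_apply, h1]
    rw [h2, lp.coeFn_sum, Finset.sum_apply]
    exact Finset.sum_congr rfl fun i _ => by
      rw [ContinuousLinearMap.coe_coe, InnerProductSpace.rankOne_apply]
      rfl
  rw [tr, h, map_sum]
  exact Finset.sum_congr rfl fun i _ => InnerProductSpace.trace_rankOne _ _

lemma coe_layer (m : ℕ) : (layer k m : Set (Fin k → ℕ)) = deg ⁻¹' {m} := by
  ext α
  rw [Finset.mem_coe, mem_layer]
  rfl

lemma hasSum_layer {f : (Fin k → ℕ) → ℂ} {a : ℂ} (h : HasSum f a) :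
    HasSum (fun m => ∑ α ∈ layer k m, f α) a :=
  (h.tsum_fiberwise deg).congr_fun fun m => by rw [← coe_layer, Finset.tsum_subtype']

lemma exists_int_hasSum_ltr_kerProj [FiniteDimensional ℂ (dirKer B)] (hB : Elliptic B) :
    ∃ z : ℤ, HasSum (fun m => ltr (kerProj hB) m * (-1) ^ m) (z : ℂ) := by
  obtain ⟨z, hz⟩ := exists_int_trace_of_involutive (kerParity_mul_self (B := B))
  refine ⟨z, ?_⟩
  set b := stdOrthonormalBasis ℂ (dirKer B) with hb
  have h1 : HasSum (fun α => ∑ i, (inner ℂ ((b i : Hil k E) α)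
      (((sgn α : ℝ) : ℂ) • (b i : Hil k E) α) : ℂ)) z := by
    rw [← hz, LinearMap.trace_eq_sum_inner _ b]
    refine hasSum_sum fun i _ => ?_
    rw [Submodule.coe_inner, Hil.inner_eq]
    exact (summable_inner_zero (Hil.mem (b i : Hil k E))
      (Hil.mem (kerParity B (b i) : Hil k E))).hasSum
  refine (hasSum_layer h1).congr_fun fun m => ?_
  rw [ltr, Finset.sum_mul]
  refine Finset.sum_congr rfl fun α hα => ?_
  rw [tr_kerProj hB b, Finset.sum_mul]
  refine Finset.sum_congr rfl fun i _ => ?_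
  rw [inner_smul_right, sgn, mem_layer.1 hα, mul_comm]
  push_cast
  rfl

end Parity

end Fock

namespace Fock

open Finset

section Index

variable {k : ℕ} {E : Type*} [NormedAddCommGroup E] [InnerProductSpace ℂ E]
  [CompleteSpace E] [FiniteDimensional ℂ E]

lemma Ord.polyGrowth {T : Op k E} (hT : Ord 0 T) : PolyGrowth (ltr T) := by
  obtain ⟨C, hC, h⟩ := Ord.tr_le (r := 0) hT
  refine ⟨C, k, hC, fun m => ?_⟩
  have := norm_ltr_le h hC m
  rwa [add_zero, zpow_natCast] at this

lemma Ord.summable_ltr {T : Op k E} (hT : Ord (-(2 * ((k : ℤ) + 2))) T) :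
    Summable fun m => ‖ltr T m‖ := by
  have e : -(2 * ((k : ℤ) + 2)) = 2 * (-((k : ℤ) + 2)) := by ring
  rw [e] at hT
  obtain ⟨C, hC, h⟩ := hT.tr_le
  have hs : Summable fun m : ℕ => C * (((m : ℝ) + 1) ^ 2)⁻¹ := by
    have h1 := (summable_nat_add_iff 1).2 (Real.summable_nat_pow_inv.2 one_lt_two)
    exact (h1.mul_left C).congr fun m => by push_cast; rfl
  refine Summable.of_nonneg_of_le (fun m => norm_nonneg _) (fun m => ?_) hs
  refine (norm_ltr_le h hC m).trans_eq ?_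
  have e : (k : ℤ) + -((k : ℤ) + 2) = -((2 : ℕ) : ℤ) := by push_cast; ring
  rw [e, zpow_neg, zpow_natCast]

lemma contrRel (T : Op k E) : ContrRel k (ltr T) (ltr (contr T)) :=
  ⟨ltr_contr_zero T, ltr_contr_succ T⟩

lemma exists_gf_ltr_le {T : Op k E} (hT : ∀ d, Sym d 0 T) :
    ∃ C : ℝ, ∀ t ∈ Set.Ioc (-1 : ℝ) 0, ‖gf (ltr T) t‖ ≤ C := by
  have key : ∀ n, (∃ C : ℝ, ∀ t ∈ Set.Ioc (-1 : ℝ) 0, ‖gf (ltr (contr^[n] T)) t‖ ≤ C) →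
      ∃ C : ℝ, ∀ t ∈ Set.Ioc (-1 : ℝ) 0, ‖gf (ltr T) t‖ ≤ C := by
    intro n
    induction n with
    | zero => exact id
    | succ n ih =>
      intro h
      refine ih ((contrRel _).bounded ?_ ?_ (c := ltr (contr (contr^[n] T))))
      · exact ((Sym.iterate_contr hT n 0).ord.mono (by omega)).polyGrowth
      · rwa [← Function.iterate_succ_apply' contr]
  have hJ : Ord (-(2 * ((k : ℤ) + 2))) (contr^[k + 2] T) :=
    (Sym.iterate_contr hT (k + 2) 0).ord.mono (by push_cast; omega)
  refine key (k + 2) ⟨∑' m, ‖ltr (contr^[k + 2] T) m‖, fun t ht => ?_⟩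
  exact norm_gf_le_of_summable hJ.summable_ltr (abs_le.2 ⟨ht.1.le, by linarith [ht.2]⟩)

lemma contr_one : contr (1 : Op k E) = 0 := by
  refine Finset.sum_eq_zero fun j _ => ?_
  have h : ⁅(1 : Op k E), (anS j : Op k E)⁆ = 0 := by
    rw [Ring.lie_def, one_mul, mul_one, sub_self]
  rw [h, zero_lie_ring]

lemma ltr_one_zero : ltr (1 : Op k E) 0 = Module.finrank ℂ E := by
  have h : layer k 0 = {0} := by simp [layer]
  rw [ltr, h, Finset.sum_singleton, tr_one]

lemma gf_ltr_one {t : ℝ} (ht : t ∈ Set.Ioc (-1 : ℝ) 0) :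
    (1 - (t : ℂ)) ^ k * gf (ltr (1 : Op k E)) t = Module.finrank ℂ E := by
  have h0 : ∀ t ∈ Set.Ioc (-1 : ℝ) 0, ‖gf (ltr (contr (1 : Op k E))) t‖ ≤ 0 := fun t _ => by
    rw [contr_one, gf]
    simp [ltr_zero]
  have h := (contrRel (1 : Op k E)).norm_sub_le Ord.one.polyGrowth h0 ht
  rw [mul_zero, norm_le_zero_iff, sub_eq_zero, ltr_one_zero] at h
  exact h

lemma ltr_dirCrS_mul_succ (B : Fin k → E →L[ℂ] E) (T : Op k E) (m : ℕ) :
    ltr (dirCrS B * T) (m + 1) = ltr (T * dirCrS B) m := by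
  rw [dirCrS, Finset.sum_mul, Finset.mul_sum, ltr_sum, ltr_sum]
  refine Finset.sum_congr rfl fun j _ => ?_
  rw [mul_assoc, ltr_coeffS_mul, mul_assoc, ltr_crS_mul_succ, mul_assoc]

lemma ltr_dirCrS_mul_zero (B : Fin k → E →L[ℂ] E) (T : Op k E) : ltr (dirCrS B * T) 0 = 0 := by
  rw [dirCrS, Finset.sum_mul, ltr_sum]
  refine Finset.sum_eq_zero fun j _ => ?_
  rw [mul_assoc, ltr_coeffS_mul, mul_assoc, ltr_crS_mul_zero]

lemma ltr_mul_dirAnS_succ (B : Fin k → E →L[ℂ] E) (T : Op k E) (m : ℕ) :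
    ltr (T * dirAnS B) (m + 1) = ltr (dirAnS B * T) m := by
  rw [dirAnS, Finset.sum_mul, Finset.mul_sum, ltr_sum, ltr_sum]
  refine Finset.sum_congr rfl fun j _ => ?_
  rw [← mul_assoc, ltr_mul_anS_succ, ← mul_assoc, ← ltr_coeffS_mul, mul_assoc]

lemma ltr_mul_dirAnS_zero (B : Fin k → E →L[ℂ] E) (T : Op k E) : ltr (T * dirAnS B) 0 = 0 := by
  rw [dirAnS, Finset.mul_sum, ltr_sum]
  refine Finset.sum_eq_zero fun j _ => ?_
  rw [← mul_assoc, ltr_mul_anS_zero]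

variable {B : Fin k → E →L[ℂ] E} [(dirKer B).HasOrthogonalProjection]

lemma ltr_parametrix (hB : Elliptic B) (m : ℕ) : ltr (1 - kerProj hB) m =
    ltr (inv hB * dirCrS B) m + ltr (inv hB * dirAnS B) m := by
  rw [← inv_mul_dirS, dirS_eq, mul_add, ltr_add]

lemma ltr_parametrix_succ (hB : Elliptic B) (m : ℕ) : ltr (1 - kerProj hB) (m + 1) =
    ltr (inv hB * dirCrS B) m + ltr (inv hB * dirAnS B) (m + 2) := by
  rw [← dirS_mul_inv, dirS_eq, add_mul, ltr_add, ltr_dirCrS_mul_succ, ← ltr_mul_dirAnS_succ]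

lemma ltr_parametrix_zero (hB : Elliptic B) : ltr (1 - kerProj hB) 0 =
    ltr (inv hB * dirAnS B) 1 := by
  rw [← dirS_mul_inv, dirS_eq, add_mul, ltr_add, ltr_dirCrS_mul_zero, ← ltr_mul_dirAnS_succ,
    zero_add]

lemma sym_inv_mul_dirCrS (hB : Elliptic B) (d : ℕ) : Sym d 0 (inv hB * dirCrS B) := by
  simpa using (sym_inv hB d).mul (sym_dirCrS B d)

lemma sym_inv_mul_dirAnS (hB : Elliptic B) (d : ℕ) : Sym d 0 (inv hB * dirAnS B) := by
  simpa using (sym_inv hB d).mul (sym_dirAnS B d)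

lemma gf_parametrix (hB : Elliptic B) {t : ℝ} (ht : |t| < 1) :
    2 * t * gf (ltr (1 - kerProj hB)) t = t * (1 + t) * gf (ltr (inv hB * dirCrS B)) t +
      (1 + t) * gf (ltr (inv hB * dirAnS B)) t := by
  have hp := (sym_inv_mul_dirCrS hB 0).ord.polyGrowth.hasSum ht
  have hq := (sym_inv_mul_dirAnS hB 0).ord.polyGrowth.hasSum ht
  set p := ltr (inv hB * dirCrS B)
  set q := ltr (inv hB * dirAnS B)
  set c := ltr (1 - kerProj hB) with hc
  have h1 : gf c t = gf p t + gf q t := by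
    refine HasSum.tsum_eq ((hp.add hq).congr_fun fun m => ?_)
    rw [hc, ltr_parametrix]
    ring
  have hq2 : HasSum (fun m => q (m + 2) * (t : ℂ) ^ (m + 2)) (gf q t - q 1 * t) := by
    have := (hasSum_nat_add_iff' 2).2 hq
    have h0 : q 0 = 0 := ltr_mul_dirAnS_zero _ _
    simpa [Finset.sum_range_succ, h0] using this
  have h2 : t * gf c t = t ^ 2 * gf p t + gf q t := by
    have h3 : HasSum (fun m => (t : ℂ) * (c (m + 1) * (t : ℂ) ^ (m + 1)))
        (t ^ 2 * gf p t + (gf q t - q 1 * t)) := by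
      refine ((hp.mul_left ((t : ℂ) ^ 2)).add hq2).congr_fun fun m => ?_
      rw [hc, ltr_parametrix_succ]
      ring
    have h4 := ((hasSum_nat_add_iff (f := fun m => (t : ℂ) * (c m * (t : ℂ) ^ m)) 1).1 h3).tsum_eq
    rw [tsum_mul_left] at h4
    rw [gf, h4]
    simp only [Finset.sum_range_one, pow_zero, mul_one]
    rw [hc, ltr_parametrix_zero]
    ring
  linear_combination t * h1 + h2

lemma tendsto_gf_parametrix (hB : Elliptic B) :
    Filter.Tendsto (gf (ltr (1 - kerProj hB))) (nhdsWithin (-1) (Set.Ioc (-1) 0)) (nhds 0) := by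
  obtain ⟨C₁, h₁⟩ := exists_gf_ltr_le (sym_inv_mul_dirCrS hB)
  obtain ⟨C₂, h₂⟩ := exists_gf_ltr_le (sym_inv_mul_dirAnS hB)
  have hC₁ : 0 ≤ C₁ := (norm_nonneg _).trans (h₁ 0 (by simp))
  have hC₂ : 0 ≤ C₂ := (norm_nonneg _).trans (h₂ 0 (by simp))
  have hmain : ∀ t ∈ Set.Ioc (-1 : ℝ) 0, ‖(2 * (t : ℂ)) * gf (ltr (1 - kerProj hB)) t‖ ≤
      (1 + t) * (C₁ + C₂) := fun t ht => by
    rw [gf_parametrix hB (abs_lt.2 ⟨ht.1, by linarith [ht.2]⟩)]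
    have hn : ‖1 + (t : ℂ)‖ = 1 + t := by
      have : 1 + (t : ℂ) = ((1 + t : ℝ) : ℂ) := by push_cast; rfl
      rw [this, Complex.norm_real, Real.norm_of_nonneg (by linarith [ht.1])]
    have ht1 : ‖(t : ℂ)‖ ≤ 1 := by
      rw [Complex.norm_real, Real.norm_eq_abs]
      exact abs_le.2 ⟨ht.1.le, by linarith [ht.2]⟩
    have h0 : 0 ≤ 1 + t := by linarith [ht.1]
    refine (norm_add_le _ _).trans ?_
    rw [norm_mul, norm_mul, norm_mul, hn, mul_add (1 + t)]
    have := h₁ t ht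
    have := h₂ t ht
    have h3 : ‖(t : ℂ)‖ * (1 + t) ≤ 1 + t := mul_le_of_le_one_left h0 ht1
    gcongr
  have hlim : Filter.Tendsto (fun t : ℝ => (1 + t) * (C₁ + C₂))
      (nhdsWithin (-1) (Set.Ioc (-1) 0)) (nhds 0) := by
    have : ContinuousAt (fun t : ℝ => (1 + t) * (C₁ + C₂)) (-1) := by fun_prop
    have h := this.tendsto.mono_left (nhdsWithin_le_nhds (s := Set.Ioc (-1) 0))
    simpa using h
  have h1 : Filter.Tendsto (fun t : ℝ => (2 * (t : ℂ)) * gf (ltr (1 - kerProj hB)) t)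
      (nhdsWithin (-1) (Set.Ioc (-1) 0)) (nhds 0) :=
    squeeze_zero_norm' (Filter.eventually_of_mem self_mem_nhdsWithin hmain) hlim
  have h2 : Filter.Tendsto (fun t : ℝ => (2 * (t : ℂ))⁻¹)
      (nhdsWithin (-1) (Set.Ioc (-1) 0)) (nhds (2 * ((-1 : ℝ) : ℂ))⁻¹) := by
    have : ContinuousAt (fun t : ℝ => (2 * (t : ℂ))⁻¹) (-1) :=
      ContinuousAt.inv₀ (by fun_prop) (by simp)
    exact this.tendsto.mono_left nhdsWithin_le_nhds
  have h3 := h2.mul h1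
  rw [mul_zero] at h3
  have hne : ∀ᶠ t : ℝ in nhdsWithin (-1) (Set.Ioc (-1) 0), t ≠ 0 :=
    nhdsWithin_le_nhds (eventually_ne_nhds (by norm_num))
  refine h3.congr' (hne.mono fun t ht => ?_)
  have : (2 * (t : ℂ)) ≠ 0 := by simpa using ht
  rw [← mul_assoc, inv_mul_cancel₀ this, one_mul]

/-- The dimension of the coefficients of an elliptic symbol in `k` complex variables is divisible
by `2 ^ k`. -/
theorem exists_finrank_eq {B : Fin k → E →L[ℂ] E} (hB : Elliptic B) :
    ∃ z : ℤ, (Module.finrank ℂ E : ℤ) = 2 ^ k * z := by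
  have := finiteDimensional_dirKer hB
  obtain ⟨z, hz⟩ := exists_int_hasSum_ltr_kerProj hB
  refine ⟨z, ?_⟩
  have hP := tendsto_gf_neg_one (ord_kerProj hB _).summable_ltr
  rw [hz.tsum_eq] at hP
  have h1 := (tendsto_gf_parametrix hB).add hP
  have h2 : Filter.Tendsto (fun t : ℝ => (1 - (t : ℂ)) ^ k)
      (nhdsWithin (-1) (Set.Ioc (-1) 0)) (nhds ((1 - ((-1 : ℝ) : ℂ)) ^ k)) := by
    have : ContinuousAt (fun t : ℝ => (1 - (t : ℂ)) ^ k) (-1) := by fun_prop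
    exact this.tendsto.mono_left nhdsWithin_le_nhds
  have h3 := h2.mul h1
  have h4 : Filter.Tendsto (fun _ : ℝ => (Module.finrank ℂ E : ℂ))
      (nhdsWithin (-1) (Set.Ioc (-1) 0)) (nhds ((1 - ((-1 : ℝ) : ℂ)) ^ k * (0 + z))) := by
    refine h3.congr' (Filter.eventually_of_mem self_mem_nhdsWithin fun t ht => ?_)
    have ht1 : |t| < 1 := abs_lt.2 ⟨ht.1, by linarith [ht.2]⟩
    have hone := (Ord.one (k := k) (E := E)).polyGrowth.hasSum ht1
    have hker := (ord_kerProj hB 0).polyGrowth.hasSum ht1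
    have h5 : gf (ltr (1 - kerProj hB)) t = gf (ltr (1 : Op k E)) t - gf (ltr (kerProj hB)) t := by
      refine HasSum.tsum_eq ((hone.sub hker).congr_fun fun m => ?_)
      rw [ltr_sub]
      ring
    rw [h5, sub_add_cancel, gf_ltr_one ht]
  have hne : (nhdsWithin (-1 : ℝ) (Set.Ioc (-1) 0)).NeBot := by
    rw [nhdsWithin_Ioc_eq_nhdsGT (by norm_num)]
    infer_instance
  have h6 := tendsto_nhds_unique h4 tendsto_const_nhds
  have h7 : (Module.finrank ℂ E : ℂ) = 2 ^ k * z := by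
    rw [← h6]
    push_cast
    norm_num
  exact_mod_cast h7

end Index

end Fock

namespace Fock

open Finset

lemma elliptic_of_forall_ne_zero {k : ℕ} {E : Type*} [NormedAddCommGroup E]
    [InnerProductSpace ℂ E] [CompleteSpace E] [FiniteDimensional ℂ E] {B : Fin k → E →L[ℂ] E}
    (h : ∀ (z : Fin k → ℂ) (v : E), z ≠ 0 → v ≠ 0 →
      ∑ j, z j • B j v + ∑ j, (starRingEnd ℂ) (z j) • ContinuousLinearMap.adjoint (B j) v ≠ 0) :
    Elliptic B := by
  set S : EuclideanSpace ℂ (Fin k) × E → E := fun p => ∑ j, p.1 j • B j p.2 +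
    ∑ j, (starRingEnd ℂ) (p.1 j) • ContinuousLinearMap.adjoint (B j) p.2 with hS
  have hS_smul : ∀ (r s : ℝ) (z : EuclideanSpace ℂ (Fin k)) (v : E),
      S (((r : ℂ) • z), ((s : ℂ) • v)) = ((r * s : ℝ) : ℂ) • S (z, v) := fun r s z v => by
    simp only [hS, PiLp.smul_apply, smul_eq_mul, map_mul, Complex.conj_ofReal, map_smul,
      smul_add, Finset.smul_sum, smul_smul]
    push_cast
    congr 1 <;> exact Finset.sum_congr rfl fun j _ => by congr 1; ring
  have hcont : Continuous S := by
    simp only [hS]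
    refine (continuous_finsetSum _ fun j _ => ?_).add (continuous_finsetSum _ fun j _ => ?_)
    · fun_prop
    · exact (Complex.continuous_conj.comp (by fun_prop)).smul (by fun_prop)
  have : ProperSpace E := FiniteDimensional.proper ℂ E
  have hcpt : IsCompact (Metric.sphere (0 : EuclideanSpace ℂ (Fin k)) 1 ×ˢ
      Metric.sphere (0 : E) 1) := (isCompact_sphere _ _).prod (isCompact_sphere _ _)
  obtain ⟨c, hc, hle⟩ := hcpt.exists_forall_le' (f := fun p => ‖S p‖ ^ 2) (a := 0)
    (by fun_prop) (fun p hp => by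
      have h1 : p.1 ≠ 0 := ne_zero_of_mem_unit_sphere ⟨p.1, hp.1⟩
      have h2 : p.2 ≠ 0 := ne_zero_of_mem_unit_sphere ⟨p.2, hp.2⟩
      have := h (fun j => p.1 j) p.2 (fun h0 => h1 (by ext j; exact congrFun h0 j)) h2
      have h3 : 0 < ‖S p‖ := norm_pos_iff.2 this
      positivity)
  refine ⟨c, hc, fun z v => ?_⟩
  set w : EuclideanSpace ℂ (Fin k) := WithLp.toLp 2 z with hw
  have hzw : ∑ j, ‖z j‖ ^ 2 = ‖w‖ ^ 2 := (EuclideanSpace.norm_sq_eq w).symm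
  have hSz : ∑ j, z j • B j v + ∑ j, (starRingEnd ℂ) (z j) • ContinuousLinearMap.adjoint (B j) v =
    S (w, v) := rfl
  rw [hzw, hSz]
  rcases eq_or_ne w 0 with hw0 | hw0
  · rw [hw0, norm_zero, zero_pow two_ne_zero, zero_mul, mul_zero]
    positivity
  rcases eq_or_ne v 0 with hv0 | hv0
  · rw [hv0, norm_zero, zero_pow two_ne_zero, mul_zero, mul_zero]
    positivity
  have hwn : ‖w‖ ≠ 0 := norm_ne_zero_iff.2 hw0
  have hvn : ‖v‖ ≠ 0 := norm_ne_zero_iff.2 hv0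
  have h1 := hle (((‖w‖⁻¹ : ℝ) : ℂ) • w, ((‖v‖⁻¹ : ℝ) : ℂ) • v) (by
    constructor
    · simp [norm_smul, hwn]
    · simp [norm_smul, hvn])
  simp only [hS_smul, norm_smul, Complex.norm_real, Real.norm_eq_abs, mul_pow, sq_abs] at h1
  rw [inv_pow, inv_pow, ← mul_inv, inv_mul_eq_div, le_div_iff₀ (by positivity)] at h1
  exact h1

section Division

open Matrix

variable {k : ℕ} {ι : Type*} [Fintype ι] [DecidableEq ι]

lemma elliptic_of_matrix {β γ : Fin k → Matrix ι ι ℂ}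
    (h : ∀ z : Fin k → ℂ, z ≠ 0 →
      (∑ j, (z j • β j + (starRingEnd ℂ) (z j) • γ j)).det ≠ 0) :
    Elliptic fun j => Matrix.toEuclideanCLM (𝕜 := ℂ) (fromBlocks 0 (γ j)ᴴ (β j) 0) := by
  refine elliptic_of_forall_ne_zero fun z v hz hv h0 => ?_
  set f := ∑ j, (z j • β j + (starRingEnd ℂ) (z j) • γ j) with hf
  set M : Matrix (ι ⊕ ι) (ι ⊕ ι) ℂ := fromBlocks 0 fᴴ f 0 with hM
  have hadj : ∀ j, ContinuousLinearMap.adjoint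
      (Matrix.toEuclideanCLM (𝕜 := ℂ) (fromBlocks 0 (γ j)ᴴ (β j) 0)) =
      Matrix.toEuclideanCLM (𝕜 := ℂ) (fromBlocks 0 (β j)ᴴ (γ j) 0) := fun j => by
    rw [← ContinuousLinearMap.star_eq_adjoint, ← map_star, star_eq_conjTranspose,
      fromBlocks_conjTranspose]
    simp
  have hMv : Matrix.toEuclideanCLM (𝕜 := ℂ) M v = 0 := by
    rw [← h0]
    simp only [hadj]
    have e : M = ∑ j, z j • fromBlocks 0 (γ j)ᴴ (β j) 0 +
        ∑ j, (starRingEnd ℂ) (z j) • fromBlocks 0 (β j)ᴴ (γ j) 0 := by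
      rw [← Finset.sum_add_distrib, hM, hf]
      ext (a | a) (b | b) <;>
        simp [Matrix.sum_apply, conjTranspose_apply, add_comm]
    rw [e, map_add, map_sum, map_sum]
    simp only [map_smul, _root_.add_apply, _root_.sum_apply,
      _root_.smul_apply]
  have hdet : (M * M).det ≠ 0 := by
    rw [hM, fromBlocks_multiply]
    simp only [zero_mul, mul_zero, zero_add, add_zero]
    rw [det_fromBlocks_zero₂₁, det_mul, det_mul, det_conjTranspose]
    have := h z hz
    simpa using this
  rw [det_mul] at hdet
  have hu : IsUnit M := (isUnit_iff_isUnit_det M).2 (left_ne_zero_of_mul hdet).isUnit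
  have h2 : M⁻¹ * M = 1 := nonsing_inv_mul M ((isUnit_iff_isUnit_det M).1 hu)
  have h3 := congrArg (fun T => Matrix.toEuclideanCLM (𝕜 := ℂ) T v) h2
  simp only [map_mul, map_one] at h3
  have h4 : Matrix.toEuclideanCLM (𝕜 := ℂ) M⁻¹ (Matrix.toEuclideanCLM (𝕜 := ℂ) M v) = v := h3
  rw [hMv, map_zero] at h4
  exact hv h4.symm

lemma two_pow_dvd_of_real_matrices {k : ℕ}
    (A : Fin k ⊕ Fin k → Matrix (Fin k ⊕ Fin k) (Fin k ⊕ Fin k) ℝ)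
    (hA : ∀ x : Fin k ⊕ Fin k → ℝ, x ≠ 0 → (∑ i, x i • A i).det ≠ 0) : 2 ^ k ∣ 4 * k := by
  set c : Matrix (Fin k ⊕ Fin k) (Fin k ⊕ Fin k) ℝ → Matrix (Fin k ⊕ Fin k) (Fin k ⊕ Fin k) ℂ :=
    fun M => M.map Complex.ofRealHom with hc
  have hB := elliptic_of_matrix
    (β := fun j => (2⁻¹ : ℂ) • (c (A (Sum.inl j)) - Complex.I • c (A (Sum.inr j))))
    (γ := fun j => (2⁻¹ : ℂ) • (c (A (Sum.inl j)) + Complex.I • c (A (Sum.inr j))))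
    (fun z hz => by
      set x : Fin k ⊕ Fin k → ℝ := Sum.elim (fun j => (z j).re) (fun j => (z j).im) with hx
      have hx0 : x ≠ 0 := fun h0 => hz (by
        funext j
        exact Complex.ext (congrFun h0 (Sum.inl j)) (congrFun h0 (Sum.inr j)))
      have e : ∑ j, (z j • ((2⁻¹ : ℂ) • (c (A (Sum.inl j)) - Complex.I • c (A (Sum.inr j)))) +
          (starRingEnd ℂ) (z j) •
            ((2⁻¹ : ℂ) • (c (A (Sum.inl j)) + Complex.I • c (A (Sum.inr j))))) =
          Complex.ofRealHom.mapMatrix (∑ i, x i • A i) := by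
        ext a b
        rw [Fintype.sum_sum_type, ← Finset.sum_add_distrib, map_sum, Matrix.sum_apply,
          Matrix.sum_apply]
        refine Finset.sum_congr rfl fun j _ => ?_
        refine Complex.ext ?_ ?_ <;> simp [hc, hx] <;> ring
      rw [e, ← RingHom.map_det]
      simpa using hA x hx0)
  obtain ⟨w, hw⟩ := exists_finrank_eq hB
  have h4 : ((4 * k : ℕ) : ℤ) = ((2 ^ k : ℕ) : ℤ) * w := by
    rw [finrank_euclideanSpace] at hw
    simp only [Fintype.card_sum, Fintype.card_fin] at hw
    push_cast at hw ⊢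
    linarith
  exact Int.natCast_dvd_natCast.1 ⟨w, h4⟩

lemma eq_of_two_pow_dvd {k : ℕ} (hk : 0 < k) (h : 2 ^ k ∣ 4 * k) : k = 1 ∨ k = 2 ∨ k = 4 := by
  have hlt : ∀ m, 4 * (m + 5) < 2 ^ (m + 5) := fun m => by
    induction m with
    | zero => norm_num
    | succ m ih => rw [show m + 1 + 5 = m + 5 + 1 by ring, pow_succ]; omega
  have h5 : k < 5 := by
    by_contra h5
    obtain ⟨m, rfl⟩ := Nat.exists_eq_add_of_le' (not_lt.1 h5)
    exact absurd (Nat.le_of_dvd (by omega) h) (not_le.2 (hlt m))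
  interval_cases k <;> omega

variable {V : Type*} [AddCommGroup V] [Module ℝ V]

lemma det_toMatrix_ne_zero (b : Module.Basis ι ℝ V) {m : V →ₗ[ℝ] V →ₗ[ℝ] V}
    (hm : ∀ v w : V, m v w = 0 → v = 0 ∨ w = 0) {v : V} (hv : v ≠ 0) :
    (LinearMap.toMatrix b b (m v)).det ≠ 0 := by
  have := Module.Finite.of_basis b
  rw [LinearMap.det_toMatrix]
  intro h
  have h1 : LinearMap.ker (m v) = ⊥ :=
    (LinearMap.ker_eq_bot').2 fun w hw => (hm v w hw).resolve_left hv
  have h2 := (LinearEquiv.ofInjectiveEndo (m v) (LinearMap.ker_eq_bot.1 h1)).isUnit_det'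
  have e : ((LinearEquiv.ofInjectiveEndo (m v) (LinearMap.ker_eq_bot.1 h1) : V ≃ₗ[ℝ] V) :
      V →ₗ[ℝ] V) = m v := LinearMap.ext fun w => rfl
  rw [e] at h2
  exact h2.ne_zero h

lemma even_finrank_of_one_lt [FiniteDimensional ℝ V] {m : V →ₗ[ℝ] V →ₗ[ℝ] V}
    (hm : ∀ v w : V, m v w = 0 → v = 0 ∨ w = 0) (hn : 1 < Module.finrank ℝ V) :
    Even (Module.finrank ℝ V) := by
  by_contra hodd
  rw [Nat.not_even_iff_odd] at hodd
  set n := Module.finrank ℝ V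
  set b := Module.finBasis ℝ V
  set L : (Fin n → ℝ) →ₗ[ℝ] Matrix (Fin n) (Fin n) ℝ :=
    (LinearMap.toMatrix b b).toLinearMap ∘ₗ m ∘ₗ b.equivFun.symm.toLinearMap with hL
  have hcont : Continuous fun x => (L x).det := L.continuous_of_finiteDimensional.matrix_det
  have hne : ∀ x, x ≠ 0 → (L x).det ≠ 0 := fun x hx =>
    det_toMatrix_ne_zero b hm (b.equivFun.symm.map_ne_zero_iff.2 hx)
  have hneg : ∀ x, (L (-x)).det = -(L x).det := fun x => by
    rw [map_neg, det_neg, Fintype.card_fin, hodd.neg_one_pow, neg_one_mul]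
  have hconn : IsPreconnected ({0}ᶜ : Set (Fin n → ℝ)) :=
    (isConnected_compl_singleton_of_one_lt_rank (by simpa using hn) 0).isPreconnected
  obtain ⟨x, hx⟩ : ∃ x : Fin n → ℝ, x ≠ 0 :=
    ⟨fun _ => 1, fun h => one_ne_zero (congrFun h ⟨0, by omega⟩)⟩
  have hx' : -x ≠ 0 := neg_ne_zero.2 hx
  have himg := hconn.image _ hcont.continuousOn
  have hmem : (0 : ℝ) ∈ (fun x => (L x).det) '' {0}ᶜ := by
    rcases le_total 0 (L x).det with h | h
    · exact himg.Icc_subset ⟨-x, hx', rfl⟩ ⟨x, hx, rfl⟩ ⟨by simp only [hneg]; linarith, h⟩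
    · exact himg.Icc_subset ⟨x, hx, rfl⟩ ⟨-x, hx', rfl⟩ ⟨h, by simp only [hneg]; linarith⟩
  obtain ⟨y, hy, hy0⟩ := hmem
  exact hne y hy hy0

lemma two_pow_dvd_of_finrank_eq_add [FiniteDimensional ℝ V] {m : V →ₗ[ℝ] V →ₗ[ℝ] V}
    (hm : ∀ v w : V, m v w = 0 → v = 0 ∨ w = 0) {k : ℕ} (hk : Module.finrank ℝ V = k + k) :
    2 ^ k ∣ 4 * k := by
  set b : Module.Basis (Fin k ⊕ Fin k) ℝ V :=
    (Module.finBasisOfFinrankEq ℝ V hk).reindex finSumFinEquiv.symm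
  refine two_pow_dvd_of_real_matrices (fun i => LinearMap.toMatrix b b (m (b i))) fun x hx => ?_
  have e : ∑ i, x i • LinearMap.toMatrix b b (m (b i)) =
      LinearMap.toMatrix b b (m (b.equivFun.symm x)) := by
    rw [b.equivFun_symm_apply, map_sum, map_sum]
    simp only [map_smul]
  rw [e]
  exact det_toMatrix_ne_zero b hm (b.equivFun.symm.map_ne_zero_iff.2 hx)

end Division

end Fock

/-- Bott–Milnor–Kervaire: a nonzero finite-dimensional real vector space with a bilinear
multiplication without zero divisors has dimension 1, 2, 4, or 8. -/
theorem stmt_5 (V : Type*) [AddCommGroup V] [Module ℝ V] [FiniteDimensional ℝ V]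
    [Nontrivial V] (m : V →ₗ[ℝ] V →ₗ[ℝ] V)
    (hm : ∀ v w : V, m v w = 0 → v = 0 ∨ w = 0) :
    Module.finrank ℝ V = 1 ∨ Module.finrank ℝ V = 2 ∨
      Module.finrank ℝ V = 4 ∨ Module.finrank ℝ V = 8 := by
  have hpos : 0 < Module.finrank ℝ V := Module.finrank_pos
  rcases Nat.lt_or_ge 1 (Module.finrank ℝ V) with h | h
  · obtain ⟨k, hk⟩ := Fock.even_finrank_of_one_lt hm h
    rcases Fock.eq_of_two_pow_dvd (by omega) (Fock.two_pow_dvd_of_finrank_eq_add hm hk) with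
      rfl | rfl | rfl <;> omega
  · omega
end
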